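/- arXiv:math/0612085 — 3 statements merged into one kernel-verified Lean document; each statement's English description precedes it below -/
import Mathlib

section
/- Let n and m be natural numbers with 2m ≥ 3(n+1). A compact metric space X of covering dimension at most n quasi-embeds in ℝ^m (i.e., for every ε > 0 there is an ε-map X → ℝ^m) if and only if for every compact subset K ⊆ X̃ = {(x,y) ∈ X×X : x ≠ y} that is invariant under the swap involution (x,y) ↦ (y,x), there exists a continuous map f : K → S^{m-1} with f(y,x) = −f(x,y) for all (x,y) ∈ K. -/
open Topology Metric

/-- Covering dimension at most `n`: every open cover admits an open refinement in which
each point lies in at most `n+1` members. -/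
def CoveringDimLE (X : Type*) [TopologicalSpace X] (n : ℕ) : Prop :=
  ∀ U : Set (Set X), (∀ u ∈ U, IsOpen u) → ⋃₀ U = Set.univ →
    ∃ V : Set (Set X), (∀ v ∈ V, IsOpen v) ∧ ⋃₀ V = Set.univ ∧
      (∀ v ∈ V, ∃ u ∈ U, v ⊆ u) ∧
      ∀ x : X, {v ∈ V | x ∈ v}.Finite ∧ {v ∈ V | x ∈ v}.ncard ≤ n + 1

open Set in
/-- Two continuous maps that agree on the overlap of two closed sets have a common continuous
extension to the whole space. -/
theorem exists_continuous_glue {Z V : Type*} [TopologicalSpace Z] [NormalSpace Z]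
    [NormedAddCommGroup V] [NormedSpace ℝ V] [FiniteDimensional ℝ V] {C D : Set Z}
    (hC : IsClosed C) (hD : IsClosed D) {u v : Z → V} (hu : ContinuousOn u C)
    (hv : ContinuousOn v D) (huv : ∀ z ∈ C, z ∈ D → u z = v z) :
    ∃ w : Z → V, Continuous w ∧ EqOn w u C ∧ EqOn w v D := by
  classical
  have hT : TietzeExtension V := TietzeExtension.of_tvs ℝ
  set w₀ : Z → V := fun z => if z ∈ C then u z else v z with hw₀
  have h1 : EqOn w₀ u C := fun z hz => by simp [hw₀, hz]
  have h2 : EqOn w₀ v D := fun z hz => by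
    by_cases h : z ∈ C
    · simp [hw₀, h, huv z h hz]
    · simp [hw₀, h]
  have hw : ContinuousOn w₀ (C ∪ D) :=
    (hu.congr h1).union_of_isClosed (hv.congr h2) hC hD
  obtain ⟨w, hw'⟩ := ContinuousMap.exists_restrict_eq (hC.union hD)
    (⟨fun z : ↥(C ∪ D) => w₀ z, continuousOn_iff_continuous_domRestrict.1 hw⟩ : C(↥(C ∪ D), V))
  have hww : EqOn w w₀ (C ∪ D) := fun z hz => by
    exact DFunLike.congr_fun hw' ⟨z, hz⟩
  exact ⟨w, w.continuous, fun z hz => (hww (Or.inl hz)).trans (h1 hz),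
    fun z hz => (hww (Or.inr hz)).trans (h2 hz)⟩

/-- A continuous nowhere zero map on a compact set is bounded away from zero. -/
theorem IsCompact.exists_pos_lt_norm {Z V : Type*} [TopologicalSpace Z] [NormedAddCommGroup V]
    {K : Set Z} (hK : IsCompact K) {u : Z → V} (hu : ContinuousOn u K) (h : ∀ z ∈ K, u z ≠ 0) :
    ∃ η > 0, ∀ z ∈ K, η < ‖u z‖ := by
  rcases K.eq_empty_or_nonempty with rfl | hne
  · exact ⟨1, one_pos, by simp⟩
  obtain ⟨z₀, hz₀, hmin⟩ := hK.exists_isMinOn hne hu.norm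
  have hp : 0 < ‖u z₀‖ := norm_pos_iff.2 (h z₀ hz₀)
  exact ⟨‖u z₀‖ / 2, half_pos hp, fun z hz => (half_lt_self hp).trans_le (hmin hz)⟩

open Set in
/-- Borsuk's homotopy extension property for maps that avoid the origin: slowing the homotopy `u`
down away from `C` keeps it nowhere zero over `S`. -/
theorem exists_slowdown {Z V : Type*} [TopologicalSpace Z] [T2Space Z] [NormalSpace Z]
    [NormedAddCommGroup V] {C S : Set Z} (hC : IsClosed C) (hS : IsCompact S) {u : Z × ℝ → V}
    (hu : Continuous u) (hCu : ∀ z ∈ C, ∀ r ∈ Icc (0 : ℝ) 1, u (z, r) ≠ 0)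
    (hSu : ∀ z ∈ S, u (z, 0) ≠ 0) :
    ∃ l : Z → ℝ, Continuous l ∧ (∀ z, l z ∈ Icc (0 : ℝ) 1) ∧ (∀ z ∈ C, l z = 1) ∧
      ∀ z ∈ S, ∀ r ∈ Icc (0 : ℝ) 1, u (z, l z * r) ≠ 0 := by
  set D : Set Z := Prod.fst '' ((S ×ˢ Icc (0 : ℝ) 1) ∩ u ⁻¹' {0}) with hDdef
  have hD : IsClosed D :=
    (((hS.prod isCompact_Icc).inter_right (isClosed_singleton.preimage hu)).image
      continuous_fst).isClosed
  have hDC : Disjoint D C := by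
    rw [Set.disjoint_left]
    rintro _ ⟨⟨z, r⟩, ⟨⟨-, hr⟩, h0⟩, rfl⟩ hz
    exact hCu z hz r hr h0
  obtain ⟨l, hl0, hl1, hl⟩ := exists_continuous_zero_one_of_isClosed hD hC hDC
  refine ⟨l, l.continuous, hl, fun z hz => hl1 hz, fun z hz r hr h0 => ?_⟩
  have hmem : z ∈ D := ⟨(z, l z * r), ⟨⟨hz, mul_nonneg (hl z).1 hr.1,
    mul_le_one₀ (hl z).2 hr.1 hr.2⟩, h0⟩, rfl⟩
  have : l z = 0 := hl0 hmem
  rw [this, zero_mul] at h0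
  exact hSu z hz h0

section Deformation

open Set

/-- `Ψ` deforms, through nowhere zero maps on `B × F`, the difference map `g x - f y` into
`Ψ (x, y, 1)`. -/
structure IsDeformation {E Y V : Type*} [TopologicalSpace E] [TopologicalSpace Y]
    [NormedAddCommGroup V] (f : Y → V) (B : Set E) (F : Set Y) (g : E → V)
    (Ψ : E × Y × ℝ → V) : Prop where
  continuous_left : Continuous g
  continuous : Continuous Ψ
  zero : ∀ x ∈ B, ∀ y ∈ F, Ψ (x, y, 0) = g x - f y
  ne_zero : ∀ x ∈ B, ∀ y ∈ F, ∀ t ∈ Icc (0 : ℝ) 1, Ψ (x, y, t) ≠ 0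

/-- The deformation `(g, Ψ)` over `A × F` extends to one over `B × F` with the same final map. -/
def HasDeformationExtension {E Y V : Type*} [TopologicalSpace E] [TopologicalSpace Y]
    [NormedAddCommGroup V] (f : Y → V) (A B : Set E) (F : Set Y) (g : E → V)
    (Ψ : E × Y × ℝ → V) : Prop :=
  ∃ (g' : E → V) (Ψ' : E × Y × ℝ → V), IsDeformation f B F g' Ψ' ∧ EqOn g' g A ∧
    (∀ x ∈ A, ∀ y ∈ F, ∀ t ∈ Icc (0 : ℝ) 1, Ψ' (x, y, t) = Ψ (x, y, t)) ∧
    ∀ x ∈ B, ∀ y ∈ F, Ψ' (x, y, 1) = Ψ (x, y, 1)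

variable {E Y V : Type*} [MetricSpace E] [MetricSpace Y] [NormedAddCommGroup V]
  [NormedSpace ℝ V] {f : Y → V} {A B : Set E} {F : Set Y} {g : E → V} {Ψ : E × Y × ℝ → V}

theorem hasDeformationExtension_of_osc_le (hf : Continuous f) (hB : IsCompact B)
    (hA : IsClosed A) (h : IsDeformation f A F g Ψ) {η : ℝ} (hη : 0 < η)
    (hηA : ∀ x ∈ A, ∀ y ∈ F, ∀ t ∈ Icc (0 : ℝ) 1, 4 * η < ‖Ψ (x, y, t)‖)
    (hηB : ∀ x ∈ B, ∀ y ∈ F, 4 * η < ‖Ψ (x, y, 1)‖)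
    (hΨ : ∀ x ∈ B, ∀ y ∈ F, ∀ y' ∈ F, ∀ t ∈ Icc (0 : ℝ) 1, ‖Ψ (x, y, t) - Ψ (x, y', t)‖ ≤ η)
    (hfη : ∀ y ∈ F, ∀ y' ∈ F, ‖f y - f y'‖ ≤ η) :
    HasDeformationExtension f A B F g Ψ := by
  rcases F.eq_empty_or_nonempty with rfl | ⟨y₀, hy₀⟩
  · exact ⟨g, Ψ, ⟨h.continuous_left, h.continuous, by simp, by simp⟩, fun _ _ => rfl, by simp,
      by simp⟩
  have hΨc := h.continuous
  obtain ⟨l, hl, hlI, hlA, hlB⟩ := exists_slowdown (C := A) (S := B)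
    (u := fun z : E × ℝ => Ψ (z.1, y₀, 1 - z.2)) hA hB (by fun_prop)
    (fun x hx r hr => h.ne_zero x hx y₀ hy₀ _ ⟨by linarith [hr.2], by linarith [hr.1]⟩)
    (fun x hx h0 => by
      have := hηB x hx y₀ hy₀
      simp only [sub_zero] at h0
      rw [h0, norm_zero] at this
      linarith)
  have htI : ∀ x, ∀ t ∈ Icc (0 : ℝ) 1, 1 - l x * (1 - t) ∈ Icc (0 : ℝ) 1 := fun x t ht =>
    ⟨by nlinarith [(hlI x).1, (hlI x).2, ht.1, ht.2], by nlinarith [(hlI x).1, ht.2]⟩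
  set ψ₀ : E × ℝ → V := fun z => Ψ (z.1, y₀, 1 - l z.1 * (1 - z.2)) with hψ₀
  have hψ₀c : Continuous ψ₀ := by fun_prop
  obtain ⟨μ, hμ, hμψ⟩ := (hB.prod (isCompact_Icc (a := (0 : ℝ)) (b := 1))).exists_pos_lt_norm
    (u := ψ₀) hψ₀c.continuousOn (fun z hz => hlB z.1 hz.1 (1 - z.2)
      ⟨by linarith [hz.2.2], by linarith [hz.2.1]⟩)
  set ψ : E × ℝ → V := fun z => max 1 (4 * η / max ‖ψ₀ z‖ μ) • ψ₀ z with hψ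
  have hmax : ∀ z, max ‖ψ₀ z‖ μ ≠ 0 := fun z => (lt_max_of_lt_right hμ).ne'
  have hψc : Continuous ψ := by
    have : Continuous fun z => 4 * η / max ‖ψ₀ z‖ μ :=
      continuous_const.div (by fun_prop) hmax
    fun_prop
  have hψeq : ∀ z, 4 * η < ‖ψ₀ z‖ → ψ z = ψ₀ z := fun z hz => by
    have h1 : 4 * η / max ‖ψ₀ z‖ μ ≤ 1 :=
      (div_le_one (lt_max_of_lt_right hμ)).2 (hz.le.trans (le_max_left _ _))
    simp only [hψ, max_eq_left h1, one_smul]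
  have hψge : ∀ x ∈ B, ∀ t ∈ Icc (0 : ℝ) 1, 4 * η ≤ ‖ψ (x, t)‖ := fun x hx t ht => by
    have h1 : μ < ‖ψ₀ (x, t)‖ := hμψ _ ⟨hx, ht⟩
    have h2 : 4 * η / ‖ψ₀ (x, t)‖ * ‖ψ₀ (x, t)‖ = 4 * η :=
      div_mul_cancel₀ _ (hμ.trans h1).ne'
    simp only [hψ, norm_smul, max_eq_left h1.le]
    rw [Real.norm_of_nonneg (le_max_of_le_left zero_le_one)]
    nlinarith [le_max_right 1 (4 * η / ‖ψ₀ (x, t)‖), norm_nonneg (ψ₀ (x, t))]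
  set d : E × Y × ℝ → V := fun z => Ψ (z.1, z.2.1, 1 - l z.1 * (1 - z.2.2)) -
    Ψ (z.1, y₀, 1 - l z.1 * (1 - z.2.2)) with hd
  set c : E × Y → V := fun z => (f y₀ - f z.2) - d (z.1, z.2, 0) with hc
  have hdc : Continuous d := by fun_prop
  have hdη : ∀ x ∈ B, ∀ y ∈ F, ∀ t ∈ Icc (0 : ℝ) 1, ‖d (x, y, t)‖ ≤ η := fun x hx y hy t ht =>
    hΨ x hx y hy y₀ hy₀ _ (htI x t ht)
  refine ⟨fun x => f y₀ + ψ (x, 0),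
    fun z => ψ (z.1, z.2.2) + (d z + (1 - z.2.2) • c (z.1, z.2.1)),
    ⟨by fun_prop, by fun_prop, fun x hx y hy => ?_, fun x hx y hy t ht h0 => ?_⟩,
    fun x hx => ?_, fun x hx y hy t ht => ?_, fun x hx y hy => ?_⟩
  · simp only [hc, sub_zero, one_smul]
    abel
  · have h1 : ‖(1 - t) • c (x, y)‖ ≤ 2 * η := by
      have hcn : ‖c (x, y)‖ ≤ η + η := (norm_sub_le _ _).trans
        (add_le_add (hfη y₀ hy₀ y hy) (hdη x hx y hy 0 ⟨le_rfl, zero_le_one⟩))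
      rw [norm_smul, Real.norm_of_nonneg (by linarith [ht.2])]
      nlinarith [ht.1, ht.2, norm_nonneg (c (x, y))]
    have h2 := hψge x hx t ht
    have h3 := hdη x hx y hy t ht
    have h4 : ‖d (x, y, t) + (1 - t) • c (x, y)‖ ≤ η + 2 * η :=
      (norm_add_le _ _).trans (add_le_add h3 h1)
    have h5 := eq_neg_of_add_eq_zero_left h0
    simp only at h5
    rw [h5, norm_neg] at h2
    linarith
  · have h1 : ψ (x, 0) = ψ₀ (x, 0) := hψeq _ (by
      simpa [hψ₀, hlA x hx] using hηA x hx y₀ hy₀ 0 ⟨le_rfl, zero_le_one⟩)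
    have h2 := h.zero x hx y₀ hy₀
    simp [h1, hψ₀, hlA x hx, h2]
  · have h1 : ψ (x, t) = ψ₀ (x, t) := hψeq _ (by
      simpa [hψ₀, hlA x hx] using hηA x hx y₀ hy₀ t ht)
    have h2 := h.zero x hx y₀ hy₀
    have h3 := h.zero x hx y hy
    simp [h1, hψ₀, hlA x hx, h2, hc, hd, h3]
  · have h1 : ψ (x, 1) = ψ₀ (x, 1) := hψeq _ (by simpa [hψ₀] using hηB x hx y₀ hy₀)
    simp [h1, hψ₀, hd]

end Deformation

section Deformation
open Set

variable {E Y V : Type*} [MetricSpace E] [MetricSpace Y] [NormedAddCommGroup V]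
  [NormedSpace ℝ V] {f : Y → V} {A B : Set E} {F : Set Y} {g : E → V} {Ψ : E × Y × ℝ → V}

theorem IsDeformation.slide [FiniteDimensional ℝ V] {F₀ : Set Y} {κ : E × ℝ → V}
    {ϑ : E × ℝ × Y × ℝ → V} (hB : IsCompact B) (hA : IsCompact A) (hAB : A ⊆ B)
    (hF : IsCompact F) (hF₀ : IsCompact F₀) (hκ : Continuous κ)
    (hϑ : Continuous ϑ) (h : IsDeformation f B F (fun x => κ (x, 0)) Ψ)
    (hκf : ∀ x ∈ B, ∀ r ∈ Icc (0 : ℝ) 1, ∀ y ∈ F, κ (x, r) ≠ f y)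
    (hκA : ∀ x ∈ A, ∀ r ∈ Icc (0 : ℝ) 1, κ (x, r) = κ (x, 0))
    (hϑB : ∀ x ∈ B, ∀ r ∈ Icc (0 : ℝ) 1, ∀ y ∈ F₀, ∀ t ∈ Icc (0 : ℝ) 1,
      ϑ (x, r, y, t) ≠ 0 ∧ ϑ (x, 0, y, t) = Ψ (x, y, t) ∧ ϑ (x, r, y, 0) = κ (x, r) - f y ∧
        ϑ (x, r, y, 1) = Ψ (x, y, 1))
    (hϑA : ∀ x ∈ A, ∀ r ∈ Icc (0 : ℝ) 1, ∀ y ∈ F₀, ∀ t ∈ Icc (0 : ℝ) 1,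
      ϑ (x, r, y, t) = Ψ (x, y, t)) :
    ∃ Ψ' : E × Y × ℝ → V, IsDeformation f B F (fun x => κ (x, 1)) Ψ' ∧
      (∀ x ∈ A, ∀ y ∈ F, ∀ t ∈ Icc (0 : ℝ) 1, Ψ' (x, y, t) = Ψ (x, y, t)) ∧
      (∀ x ∈ B, ∀ y ∈ F, Ψ' (x, y, 1) = Ψ (x, y, 1)) ∧
      ∀ x ∈ B, ∀ y ∈ F₀, ∀ t ∈ Icc (0 : ℝ) 1, Ψ' (x, y, t) = ϑ (x, 1, y, t) := by
  have hI : IsCompact (Icc (0 : ℝ) 1) := isCompact_Icc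
  have h01 : (0 : ℝ) ∈ Icc (0 : ℝ) 1 := ⟨le_rfl, zero_le_one⟩
  have h11 : (1 : ℝ) ∈ Icc (0 : ℝ) 1 := ⟨zero_le_one, le_rfl⟩
  have hΨc := h.continuous
  have hends : IsClosed ({0, 1} : Set ℝ) := (Set.toFinite _).isClosed
  set ω : (E × Y × ℝ) × ℝ → V := fun z =>
    Ψ z.1 + (1 - z.1.2.2) • (κ (z.1.1, z.2) - κ (z.1.1, 0)) with hω
  have hωc : Continuous ω := by fun_prop
  set S : Set (E × Y × ℝ) := B ×ˢ F ×ˢ Icc (0 : ℝ) 1 with hS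
  have hSc : IsCompact S := hB.prod (hF.prod hI)
  set C : Set (E × Y × ℝ) := S ∩ (Prod.fst ⁻¹' A ∪ (fun z => z.2.2) ⁻¹' {0, 1}) with hC
  have hCc : IsClosed C := hSc.isClosed.inter ((hA.isClosed.preimage continuous_fst).union
    (hends.preimage (by fun_prop)))
  set D : Set (E × Y × ℝ) := B ×ˢ F₀ ×ˢ Icc (0 : ℝ) 1 with hD
  have hDc : IsClosed D := (hB.prod (hF₀.prod hI)).isClosed
  obtain ⟨u, hu, huω, huϑ⟩ := exists_continuous_glue
    (C := (S ×ˢ Icc (0 : ℝ) 1) ∩ (Prod.fst ⁻¹' C ∪ Prod.snd ⁻¹' {0})) (D := D ×ˢ Icc (0 : ℝ) 1)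
    (u := ω) (v := fun z => ϑ (z.1.1, z.2, z.1.2.1, z.1.2.2))
    ((hSc.prod hI).isClosed.inter ((hCc.preimage continuous_fst).union
      (isClosed_singleton.preimage continuous_snd))) (hDc.prod hI.isClosed) hωc.continuousOn
    (by fun_prop) (by
      rintro ⟨⟨x, y, t⟩, r⟩ ⟨⟨⟨hx, hy, ht⟩, hr⟩, hz⟩ ⟨⟨-, hy₀, -⟩, -⟩
      simp only at hx hy ht hr hy₀
      obtain ⟨-, e1, e2, e3⟩ := hϑB x hx r hr y hy₀ t ht
      rcases hz with ⟨-, hxA | ht' | ht'⟩ | hr0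
      · simp only [mem_preimage] at hxA
        simp [hω, hϑA x hxA r hr y hy₀ t ht, hκA x hxA r hr]
      · simp only at ht'
        subst ht'
        simp [hω, e2, h.zero x hx y hy]
      · simp only [mem_singleton_iff] at ht'
        subst ht'
        simp [hω, e3]
      · simp only [mem_preimage, mem_singleton_iff] at hr0
        subst hr0
        simp [hω, e1])
  have huC : ∀ z ∈ C, ∀ r ∈ Icc (0 : ℝ) 1, u (z, r) = ω (z, r) := fun z hz r hr =>
    huω ⟨⟨hz.1, hr⟩, Or.inl hz⟩
  have huS : ∀ z ∈ S, u (z, 0) = Ψ z := fun z hz => by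
    rw [huω ⟨⟨hz, h01⟩, Or.inr rfl⟩]
    simp [hω]
  have huD : ∀ x ∈ B, ∀ y ∈ F₀, ∀ t ∈ Icc (0 : ℝ) 1, ∀ r ∈ Icc (0 : ℝ) 1,
      u ((x, y, t), r) = ϑ (x, r, y, t) := fun x hx y hy t ht r hr => huϑ ⟨⟨hx, hy, ht⟩, hr⟩
  have huA : ∀ x ∈ A, ∀ y ∈ F, ∀ t ∈ Icc (0 : ℝ) 1, ∀ r ∈ Icc (0 : ℝ) 1,
      u ((x, y, t), r) = Ψ (x, y, t) := fun x hx y hy t ht r hr => by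
    rw [huC _ ⟨⟨hAB hx, hy, ht⟩, Or.inl hx⟩ r hr]
    simp [hω, hκA x hx r hr]
  have hu0 : ∀ x ∈ B, ∀ y ∈ F, ∀ r ∈ Icc (0 : ℝ) 1, u ((x, y, 0), r) = κ (x, r) - f y :=
      fun x hx y hy r hr => by
    rw [huC _ ⟨⟨hx, hy, h01⟩, Or.inr (Or.inl rfl)⟩ r hr]
    simp [hω, h.zero x hx y hy]
  have hu1 : ∀ x ∈ B, ∀ y ∈ F, ∀ r ∈ Icc (0 : ℝ) 1, u ((x, y, 1), r) = Ψ (x, y, 1) :=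
      fun x hx y hy r hr => by
    rw [huC _ ⟨⟨hx, hy, h11⟩, Or.inr (Or.inr (mem_singleton _))⟩ r hr]
    simp [hω]
  obtain ⟨l, hl, hlI, hlC, hlS⟩ := exists_slowdown (hCc.union hDc) hSc hu (by
      rintro ⟨x, y, t⟩ (⟨⟨hx, hy, ht⟩, hz⟩ | ⟨hx, hy, ht⟩) r hr
      · simp only at hx hy ht
        rcases hz with hxA | ht' | ht'
        · rw [huA x hxA y hy t ht r hr]
          exact h.ne_zero x hx y hy t ht
        · simp only at ht'
          subst ht'
          rw [hu0 x hx y hy r hr]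
          exact sub_ne_zero.2 (hκf x hx r hr y hy)
        · simp only [mem_singleton_iff] at ht'
          subst ht'
          rw [hu1 x hx y hy r hr]
          exact h.ne_zero x hx y hy 1 ht
      · simp only at hx hy ht
        rw [huD x hx y hy t ht r hr]
        exact (hϑB x hx r hr y hy t ht).1)
    (fun z hz => by
      rw [huS z hz]
      exact h.ne_zero _ hz.1 _ hz.2.1 _ hz.2.2)
  have hl0 : ∀ x ∈ B, ∀ y ∈ F, l (x, y, 0) = 1 := fun x hx y hy =>
    hlC _ (Or.inl ⟨⟨hx, hy, h01⟩, Or.inr (Or.inl rfl)⟩)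
  refine ⟨fun z => u (z, l z), ⟨by fun_prop, by fun_prop, fun x hx y hy => ?_,
    fun x hx y hy t ht => ?_⟩, fun x hx y hy t ht => ?_, fun x hx y hy => ?_,
    fun x hx y hy t ht => ?_⟩
  · simp only [hl0 x hx y hy]
    exact hu0 x hx y hy 1 h11
  · simpa using hlS (x, y, t) ⟨hx, hy, ht⟩ 1 h11
  · exact huA x hx y hy t ht _ (hlI _)
  · exact hu1 x hx y hy _ (hlI _)
  · simp only [hlC _ (Or.inr (⟨hx, hy, ht⟩ : (x, y, t) ∈ D))]
    exact huD x hx y hy t ht 1 h11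

end Deformation

section Deformation
open Set

variable {E Y V : Type*} [MetricSpace E] [MetricSpace Y] [NormedAddCommGroup V]
  [NormedSpace ℝ V] {f : Y → V} {A B : Set E} {F : Set Y} {g : E → V} {Ψ : E × Y × ℝ → V}

/-- Gluing step: extensions over `F₁` and over `F₂` can be combined if extensions over
`F₁ ∩ F₂` exist with one more parameter and the images of `F₁`, `F₂` are in general position. -/
theorem HasDeformationExtension.union [FiniteDimensional ℝ V] {F₁ F₂ : Set Y}
    (hf : Continuous f) (hB : IsCompact B) (hA : IsCompact A) (hAB : A ⊆ B)
    (hF₁ : IsCompact F₁) (hF₂ : IsCompact F₂)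
    (h : IsDeformation f A (F₁ ∪ F₂) g Ψ)
    (H₁ : HasDeformationExtension f A B F₁ g Ψ) (H₂ : HasDeformationExtension f A B F₂ g Ψ)
    (H₀ : ∀ (g' : E × ℝ → V) (Ψ' : (E × ℝ) × Y × ℝ → V),
      IsDeformation f (A ×ˢ Icc (0 : ℝ) 1 ∪ B ×ˢ {0, 1}) (F₁ ∩ F₂) g' Ψ' →
      (∀ x ∈ B ×ˢ Icc (0 : ℝ) 1, ∀ y ∈ F₁ ∩ F₂, Ψ' (x, y, 1) ≠ 0) →
      HasDeformationExtension f (A ×ˢ Icc (0 : ℝ) 1 ∪ B ×ˢ {0, 1}) (B ×ˢ Icc (0 : ℝ) 1)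
        (F₁ ∩ F₂) g' Ψ')
    (hq : ∀ h : E × ℝ → V, Continuous h → ∀ η > 0, ∃ q : E × ℝ → V, Continuous q ∧
      (∀ z ∈ B ×ˢ Icc (0 : ℝ) 1, ‖q z - h z‖ < η) ∧
      ∀ x s s', ∀ y ∈ F₁, ∀ y' ∈ F₂, y ≠ y' → q (x, s) = f y → q (x, s') ≠ f y') :
    HasDeformationExtension f A B (F₁ ∪ F₂) g Ψ := by
  have hI : IsCompact (Icc (0 : ℝ) 1) := isCompact_Icc
  have h01 : (0 : ℝ) ∈ Icc (0 : ℝ) 1 := ⟨le_rfl, zero_le_one⟩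
  have h11 : (1 : ℝ) ∈ Icc (0 : ℝ) 1 := ⟨zero_le_one, le_rfl⟩
  have hF₀ : IsCompact (F₁ ∩ F₂) := hF₁.inter hF₂
  obtain ⟨g₁, Ψ₁, D₁, hg₁, hΨ₁A, hΨ₁B⟩ := H₁
  obtain ⟨g₂, Ψ₂, D₂, hg₂, hΨ₂A, hΨ₂B⟩ := H₂
  have hc₁ := D₁.continuous
  have hc₂ := D₂.continuous
  have hcg₁ := D₁.continuous_left
  have hcg₂ := D₂.continuous_left
  set G : E × ℝ → V := fun z => (1 - z.2) • g₁ z.1 + z.2 • g₂ z.1 with hG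
  set Γ : (E × ℝ) × Y × ℝ → V := fun z =>
    (1 - z.1.2) • Ψ₁ (z.1.1, z.2) + z.1.2 • Ψ₂ (z.1.1, z.2) with hΓ
  have hΓA : ∀ x ∈ A, ∀ s : ℝ, ∀ y ∈ F₁ ∩ F₂, ∀ t ∈ Icc (0 : ℝ) 1,
      Γ ((x, s), y, t) = Ψ (x, y, t) := fun x hx s y hy t ht => by
    simp only [hΓ, hΨ₁A x hx y hy.1 t ht, hΨ₂A x hx y hy.2 t ht, ← add_smul, sub_add_cancel,
      one_smul]
  have hGA : ∀ x ∈ A, ∀ s : ℝ, G (x, s) = g x := fun x hx s => by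
    simp only [hG, hg₁ hx, hg₂ hx, ← add_smul, sub_add_cancel, one_smul]
  have hΓ1 : ∀ x ∈ B, ∀ s : ℝ, ∀ y ∈ F₁ ∩ F₂, Γ ((x, s), y, 1) = Ψ (x, y, 1) :=
      fun x hx s y hy => by
    simp only [hΓ, hΨ₁B x hx y hy.1, hΨ₂B x hx y hy.2, ← add_smul, sub_add_cancel, one_smul]
  obtain ⟨h', Θ, DΘ, hh', hΘA, hΘB⟩ := H₀ G Γ ⟨by fun_prop, by fun_prop, by
      rintro ⟨x, s⟩ (⟨hx, -⟩ | ⟨hx, hs | hs⟩) y hy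
      · have := h.zero x hx y (Or.inl hy.1)
        rw [hΓA x hx s y hy 0 h01, hGA x hx s, this]
      · simp only at hs hx
        subst hs
        simp [hΓ, hG, D₁.zero x hx y hy.1]
      · simp only [mem_singleton_iff] at hs hx
        subst hs
        simp [hΓ, hG, D₂.zero x hx y hy.2], by
      rintro ⟨x, s⟩ (⟨hx, -⟩ | ⟨hx, hs | hs⟩) y hy t ht
      · rw [hΓA x hx s y hy t ht]
        exact h.ne_zero x hx y (Or.inl hy.1) t ht
      · simp only at hs hx
        subst hs
        simpa [hΓ] using D₁.ne_zero x hx y hy.1 t ht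
      · simp only [mem_singleton_iff] at hs hx
        subst hs
        simpa [hΓ] using D₂.ne_zero x hx y hy.2 t ht⟩ (by
      rintro ⟨x, s⟩ ⟨hx, -⟩ y hy
      rw [hΓ1 x hx s y hy, ← hΨ₁B x hx y hy.1]
      exact D₁.ne_zero x hx y hy.1 1 h11)
  have hcΘ := DΘ.continuous
  have hch := DΘ.continuous_left
  obtain ⟨η₀, hη₀, hΘη⟩ := ((hB.prod hI).prod (hF₀.prod hI)).exists_pos_lt_norm
    hcΘ.continuousOn (fun z hz => DΘ.ne_zero z.1 hz.1 z.2.1 hz.2.1 z.2.2 hz.2.2)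
  obtain ⟨η₁, hη₁, hΨ₁η⟩ := (hB.prod (hF₁.prod hI)).exists_pos_lt_norm
    hc₁.continuousOn (fun z hz => D₁.ne_zero z.1 hz.1 z.2.1 hz.2.1 z.2.2 hz.2.2)
  obtain ⟨η₂, hη₂, hΨ₂η⟩ := (hB.prod (hF₂.prod hI)).exists_pos_lt_norm
    hc₂.continuousOn (fun z hz => D₂.ne_zero z.1 hz.1 z.2.1 hz.2.1 z.2.2 hz.2.2)
  obtain ⟨η₃, hη₃, hΨη⟩ := (hA.prod ((hF₁.union hF₂).prod hI)).exists_pos_lt_norm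
    h.continuous.continuousOn (fun z hz => h.ne_zero z.1 hz.1 z.2.1 hz.2.1 z.2.2 hz.2.2)
  obtain ⟨η, hη, hηη₀, hηη₁, hηη₂, hηη₃⟩ : ∃ η > 0, η ≤ η₀ ∧ η ≤ η₁ ∧ η ≤ η₂ ∧ η ≤ η₃ :=
    ⟨min (min η₀ η₁) (min η₂ η₃), by positivity, by simp, by simp, by simp, by simp⟩
  obtain ⟨q, hqc, hqh, hqf⟩ := hq h' hch η hη
  have hh'A : ∀ x ∈ A, ∀ s ∈ Icc (0 : ℝ) 1, h' (x, s) = g x := fun x hx s hs => by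
    rw [hh' (Or.inl ⟨hx, hs⟩), hGA x hx]
  -- the part of `B` where the perturbation has to be carried out in full
  set A' : Set E := (fun z : E × ℝ × Y => z.1) '' ((B ×ˢ Icc (0 : ℝ) 1 ×ˢ (F₁ ∪ F₂)) ∩
    {z | ‖h' (z.1, z.2.1) - f z.2.2‖ ≤ η}) with hA'
  have hA'c : IsClosed A' := by
    refine (((hB.prod (hI.prod (hF₁.union hF₂))).inter_right ?_).image continuous_fst).isClosed
    exact isClosed_le (by fun_prop) continuous_const
  have hAA' : Disjoint A A' := by
    rw [Set.disjoint_left]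
    rintro x hxA ⟨⟨x', s, y⟩, ⟨⟨-, hs, hy⟩, hz⟩, rfl⟩
    have h1 := hΨη (x', y, 0) ⟨hxA, hy, h01⟩
    simp only at hxA hs hy
    rw [h.zero x' hxA y hy, ← hh'A x' hxA s hs] at h1
    simp only [mem_ofPred_eq] at hz
    linarith
  obtain ⟨l, hlA, hlA', hlI⟩ := exists_continuous_zero_one_of_isClosed hA.isClosed hA'c hAA'
  have hlc : Continuous l := l.continuous
  set w : E × ℝ → V := fun z => l z.1 • (q z - h' z) with hw
  have hwc : Continuous w := by fun_prop
  have hwη : ∀ x ∈ B, ∀ s ∈ Icc (0 : ℝ) 1, ‖w (x, s)‖ < η := fun x hx s hs => by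
    have h1 := hqh (x, s) ⟨hx, hs⟩
    simp only [hw, norm_smul, Real.norm_of_nonneg (hlI x).1]
    nlinarith [(hlI x).1, (hlI x).2, norm_nonneg (q (x, s) - h' (x, s))]
  have hwA : ∀ x ∈ A, ∀ s, w (x, s) = 0 := fun x hx s => by
    have h1 : l x = 0 := hlA hx
    simp [hw, h1]
  have hwt : ∀ x ∈ B, ∀ s ∈ Icc (0 : ℝ) 1, ∀ t ∈ Icc (0 : ℝ) 1, ∀ v : V, η < ‖v‖ →
      v + (1 - t) • w (x, s) ≠ 0 := fun x hx s hs t ht v hv h0 => by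
    rw [eq_neg_of_add_eq_zero_left h0, norm_neg, norm_smul,
      Real.norm_of_nonneg (by linarith [ht.2])] at hv
    nlinarith [hwη x hx s hs, ht.1, norm_nonneg (w (x, s)), ht.2]
  set k : E × ℝ → V := fun z => h' z + w z with hk
  have hkc : Continuous k := by fun_prop
  have hkq : ∀ x ∈ B, ∀ s ∈ Icc (0 : ℝ) 1, ∀ y ∈ F₁ ∪ F₂, k (x, s) = f y →
      ∀ s', k (x, s') = q (x, s') := fun x hx s hs y hy hxy s' => by
    have hxA' : x ∈ A' := by
      refine ⟨(x, s, y), ⟨⟨hx, hs, hy⟩, ?_⟩, rfl⟩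
      have h1 : h' (x, s) - f y = - w (x, s) := by
        rw [← hxy]
        simp [hk]
      simp only [mem_ofPred_eq, h1, norm_neg]
      exact (hwη x hx s hs).le
    have h1 : l x = 1 := hlA' hxA'
    simp [hk, hw, h1]
  have hkF : ∀ x ∈ B, ∀ s ∈ Icc (0 : ℝ) 1, ∀ s' ∈ Icc (0 : ℝ) 1, ∀ y ∈ F₁, ∀ y' ∈ F₂,
      k (x, s) = f y → k (x, s') ≠ f y' := fun x hx s hs s' hs' y hy y' hy' h1 h2 => by
    by_cases hyy : y = y'
    · subst hyy
      refine hwt x hx s hs 0 h01 _ (hηη₀.trans_lt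
        (hΘη ((x, s), y, 0) ⟨⟨hx, hs⟩, ⟨hy, hy'⟩, h01⟩)) ?_
      rw [DΘ.zero (x, s) ⟨hx, hs⟩ y ⟨hy, hy'⟩, ← h1]
      simp [hk]
    · refine hqf x s s' y hy y' hy' hyy ?_ ?_
      · rw [← hkq x hx s hs y (Or.inl hy) h1, h1]
      · rw [← hkq x hx s hs y (Or.inl hy) h1, h2]
  have hshadow : ∀ F' : Set Y, IsCompact F' → IsClosed ((fun z : E × ℝ × Y => z.1) ''
      ((B ×ˢ Icc (0 : ℝ) 1 ×ˢ F') ∩ {z | k (z.1, z.2.1) = f z.2.2})) := fun F' hF' => by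
    refine (((hB.prod (hI.prod hF')).inter_right ?_).image continuous_fst).isClosed
    exact isClosed_eq (by fun_prop) (by fun_prop)
  obtain ⟨σ, hσ₁, hσ₂, hσI⟩ := exists_continuous_zero_one_of_isClosed (hshadow F₁ hF₁)
    (hshadow F₂ hF₂) (by
      rw [Set.disjoint_left]
      rintro x ⟨⟨x₁, s, y⟩, ⟨⟨hx, hs, hy⟩, h1⟩, rfl⟩ ⟨⟨x₂, s', y'⟩, ⟨⟨-, hs', hy'⟩, h2⟩, hxx⟩
      simp only [mem_ofPred_eq] at hx hs hy hs' hy' h1 h2 hxx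
      subst hxx
      exact hkF x₂ hx s hs s' hs' y hy y' hy' h1 h2)
  have hσc : Continuous σ := σ.continuous
  have hσ₁' : ∀ x ∈ B, ∀ s ∈ Icc (0 : ℝ) 1, ∀ y ∈ F₁, k (x, s) = f y → σ x = 0 :=
    fun x hx s hs y hy h1 => hσ₁ ⟨(x, s, y), ⟨⟨hx, hs, hy⟩, h1⟩, rfl⟩
  have hσ₂' : ∀ x ∈ B, ∀ s ∈ Icc (0 : ℝ) 1, ∀ y ∈ F₂, k (x, s) = f y → σ x = 1 :=
    fun x hx s hs y hy h1 => hσ₂ ⟨(x, s, y), ⟨⟨hx, hs, hy⟩, h1⟩, rfl⟩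
  have hpath₁ : ∀ x, ∀ r ∈ Icc (0 : ℝ) 1, r * σ x ∈ Icc (0 : ℝ) 1 := fun x r hr =>
    ⟨mul_nonneg hr.1 (hσI x).1, mul_le_one₀ hr.2 (hσI x).1 (hσI x).2⟩
  have hpath₂ : ∀ x, ∀ r ∈ Icc (0 : ℝ) 1, 1 - r * (1 - σ x) ∈ Icc (0 : ℝ) 1 := fun x r hr =>
    ⟨by nlinarith [hr.1, hr.2, (hσI x).1, (hσI x).2], by nlinarith [hr.1, (hσI x).2]⟩
  set Θ' : (E × ℝ) × Y × ℝ → V := fun z => Θ z + (1 - z.2.2) • w z.1 with hΘ'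
  have hΘ'c : Continuous Θ' := by fun_prop
  have hΘ'ne : ∀ x ∈ B, ∀ s ∈ Icc (0 : ℝ) 1, ∀ y ∈ F₁ ∩ F₂, ∀ t ∈ Icc (0 : ℝ) 1,
      Θ' ((x, s), y, t) ≠ 0 := fun x hx s hs y hy t ht =>
    hwt x hx s hs t ht _ (hηη₀.trans_lt (hΘη ((x, s), y, t) ⟨⟨hx, hs⟩, hy, ht⟩))
  have hΘ'0 : ∀ x ∈ B, ∀ s ∈ Icc (0 : ℝ) 1, ∀ y ∈ F₁ ∩ F₂,
      Θ' ((x, s), y, 0) = k (x, s) - f y := fun x hx s hs y hy => by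
    simp only [hΘ', DΘ.zero (x, s) ⟨hx, hs⟩ y hy, hk, sub_zero, one_smul]
    abel
  have hΘ'1 : ∀ x ∈ B, ∀ s ∈ Icc (0 : ℝ) 1, ∀ y ∈ F₁ ∩ F₂,
      Θ' ((x, s), y, 1) = Ψ (x, y, 1) := fun x hx s hs y hy => by
    simp only [hΘ', hΘB (x, s) ⟨hx, hs⟩ y hy, hΓ1 x hx s y hy, sub_self, zero_smul, add_zero]
  have hΘ'A : ∀ x ∈ A, ∀ s ∈ Icc (0 : ℝ) 1, ∀ y ∈ F₁ ∩ F₂, ∀ t ∈ Icc (0 : ℝ) 1,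
      Θ' ((x, s), y, t) = Ψ (x, y, t) := fun x hx s hs y hy t ht => by
    simp only [hΘ', hΘA (x, s) (Or.inl ⟨hx, hs⟩) y hy t ht, hΓA x hx s y hy t ht, hwA x hx,
      smul_zero, add_zero]
  have hkA : ∀ x ∈ A, ∀ s ∈ Icc (0 : ℝ) 1, k (x, s) = g x := fun x hx s hs => by
    simp only [hk, hwA x hx, add_zero, hh'A x hx s hs]
  obtain ⟨Λ₁, L₁, hL₁A, hL₁B, hL₁⟩ := IsDeformation.slide (f := f)
    (Ψ := fun z => Ψ₁ z + (1 - z.2.2) • w (z.1, 0))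
    (κ := fun z => k (z.1, z.2 * σ z.1)) (ϑ := fun z => Θ' ((z.1, z.2.1 * σ z.1), z.2.2))
    hB hA hAB hF₁ hF₀ (by fun_prop) (by fun_prop)
    ⟨by fun_prop, by fun_prop, fun x hx y hy => by
      have h1 : h' (x, 0) = g₁ x := by
        rw [hh' (Or.inr ⟨hx, Or.inl rfl⟩)]
        simp [hG]
      simp only [D₁.zero x hx y hy, hk, zero_mul, h1, sub_zero, one_smul]
      abel, fun x hx y hy t ht =>
      hwt x hx 0 h01 t ht _ (hηη₁.trans_lt (hΨ₁η (x, y, t) ⟨hx, hy, ht⟩))⟩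
    (fun x hx r hr y hy h1 => by
      simp only at h1
      have h2 := hσ₁' x hx _ (hpath₁ x r hr) y hy h1
      rw [h2, mul_zero] at h1
      have h3 : h' (x, 0) = g₁ x := by
        rw [hh' (Or.inr ⟨hx, Or.inl rfl⟩)]
        simp [hG]
      refine hwt x hx 0 h01 0 h01 _ (hηη₁.trans_lt (hΨ₁η (x, y, 0) ⟨hx, hy, h01⟩)) ?_
      rw [D₁.zero x hx y hy, ← h1, hk, ← h3]
      simp)
    (fun x hx r hr => by
      simp only [hkA x hx _ (hpath₁ x r hr), hkA x hx _ (hpath₁ x 0 h01)])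
    (fun x hx r hr y hy t ht => ⟨hΘ'ne x hx _ (hpath₁ x r hr) y hy t ht, by
        simp only [hΘ', zero_mul, hΘA (x, 0) (Or.inr ⟨hx, Or.inl rfl⟩) y hy t ht, hΓ]
        simp,
      hΘ'0 x hx _ (hpath₁ x r hr) y hy, by
        simp only [hΘ'1 x hx _ (hpath₁ x r hr) y hy, hΨ₁B x hx y hy.1]
        simp⟩)
    (fun x hx r hr y hy t ht => by
      simp only [hΘ'A x hx _ (hpath₁ x r hr) y hy t ht, hΨ₁A x hx y hy.1 t ht, hwA x hx,
        smul_zero, add_zero])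
  obtain ⟨Λ₂, L₂, hL₂A, hL₂B, hL₂⟩ := IsDeformation.slide (f := f)
    (Ψ := fun z => Ψ₂ z + (1 - z.2.2) • w (z.1, 1))
    (κ := fun z => k (z.1, 1 - z.2 * (1 - σ z.1)))
    (ϑ := fun z => Θ' ((z.1, 1 - z.2.1 * (1 - σ z.1)), z.2.2))
    hB hA hAB hF₂ hF₀ (by fun_prop) (by fun_prop)
    ⟨by fun_prop, by fun_prop, fun x hx y hy => by
      have h1 : h' (x, 1) = g₂ x := by
        rw [hh' (Or.inr ⟨hx, Or.inr (mem_singleton _)⟩)]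
        simp [hG]
      simp only [D₂.zero x hx y hy, hk, zero_mul, h1, sub_zero, one_smul]
      abel, fun x hx y hy t ht =>
      hwt x hx 1 h11 t ht _ (hηη₂.trans_lt (hΨ₂η (x, y, t) ⟨hx, hy, ht⟩))⟩
    (fun x hx r hr y hy h1 => by
      simp only at h1
      have h2 := hσ₂' x hx _ (hpath₂ x r hr) y hy h1
      rw [h2, sub_self, mul_zero, sub_zero] at h1
      have h3 : h' (x, 1) = g₂ x := by
        rw [hh' (Or.inr ⟨hx, Or.inr (mem_singleton _)⟩)]
        simp [hG]
      refine hwt x hx 1 h11 0 h01 _ (hηη₂.trans_lt (hΨ₂η (x, y, 0) ⟨hx, hy, h01⟩)) ?_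
      rw [D₂.zero x hx y hy, ← h1, hk, ← h3]
      simp)
    (fun x hx r hr => by
      simp only [hkA x hx _ (hpath₂ x r hr), hkA x hx _ (hpath₂ x 0 h01)])
    (fun x hx r hr y hy t ht => ⟨hΘ'ne x hx _ (hpath₂ x r hr) y hy t ht, by
        simp only [hΘ', zero_mul, sub_zero,
          hΘA (x, 1) (Or.inr ⟨hx, Or.inr (mem_singleton _)⟩) y hy t ht, hΓ]
        simp,
      hΘ'0 x hx _ (hpath₂ x r hr) y hy, by
        simp only [hΘ'1 x hx _ (hpath₂ x r hr) y hy, hΨ₂B x hx y hy.2]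
        simp⟩)
    (fun x hx r hr y hy t ht => by
      simp only [hΘ'A x hx _ (hpath₂ x r hr) y hy t ht, hΨ₂A x hx y hy.2 t ht, hwA x hx,
        smul_zero, add_zero])
  simp only [one_mul, sub_sub_cancel] at L₁ L₂ hL₁ hL₂
  obtain ⟨Λ, hΛ, hΛ₁, hΛ₂⟩ := exists_continuous_glue (hB.prod (hF₁.prod hI)).isClosed
    (hB.prod (hF₂.prod hI)).isClosed L₁.continuous.continuousOn L₂.continuous.continuousOn (by
      rintro ⟨x, y, t⟩ ⟨hx, hy, ht⟩ ⟨-, hy', -⟩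
      rw [hL₁ x hx y ⟨hy, hy'⟩ t ht, hL₂ x hx y ⟨hy, hy'⟩ t ht])
  refine ⟨fun x => k (x, σ x), Λ, ⟨by fun_prop, hΛ, ?_, ?_⟩, fun x hx => hkA x hx _ (hσI x),
    ?_, ?_⟩
  · rintro x hx y (hy | hy)
    · rw [hΛ₁ ⟨hx, hy, h01⟩, L₁.zero x hx y hy]
    · rw [hΛ₂ ⟨hx, hy, h01⟩, L₂.zero x hx y hy]
  · rintro x hx y (hy | hy) t ht
    · rw [hΛ₁ ⟨hx, hy, ht⟩]
      exact L₁.ne_zero x hx y hy t ht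
    · rw [hΛ₂ ⟨hx, hy, ht⟩]
      exact L₂.ne_zero x hx y hy t ht
  · rintro x hx y (hy | hy) t ht
    · rw [hΛ₁ ⟨hAB hx, hy, ht⟩, hL₁A x hx y hy t ht, hwA x hx, smul_zero, add_zero,
        hΨ₁A x hx y hy t ht]
    · rw [hΛ₂ ⟨hAB hx, hy, ht⟩, hL₂A x hx y hy t ht, hwA x hx, smul_zero, add_zero,
        hΨ₂A x hx y hy t ht]
  · rintro x hx y (hy | hy)
    · rw [hΛ₁ ⟨hx, hy, h11⟩, hL₁B x hx y hy, sub_self, zero_smul, add_zero, hΨ₁B x hx y hy]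
    · rw [hΛ₂ ⟨hx, hy, h11⟩, hL₂B x hx y hy, sub_self, zero_smul, add_zero, hΨ₂B x hx y hy]

end Deformation

section Deformation
open Set

/-- Finitely many rationals outside a finite set separate all `δ`-distant points of `[-R, R]`. -/
theorem exists_finset_rat_separating {δ : ℝ} (hδ : 0 < δ) (R : ℝ) (s : Finset ℝ) :
    ∃ S : Finset ℚ, (∀ c ∈ S, (c : ℝ) ∉ s) ∧
      ∀ a b : ℝ, |a| ≤ R → a + δ ≤ b → ∃ c ∈ S, a < (c : ℝ) ∧ (c : ℝ) < b := by
  classical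
  have key : ∀ j : ℤ, ∃ c : ℚ, (c : ℝ) ∉ s ∧ j * (δ / 3) < c ∧ (c : ℝ) < (j + 1) * (δ / 3) := by
    intro j
    have hlt : j * (δ / 3) < (j + 1) * (δ / 3) := by nlinarith
    have hopen : IsOpen (Ioo ((j : ℝ) * (δ / 3)) ((j + 1) * (δ / 3)) \ (s : Set ℝ)) :=
      isOpen_Ioo.sdiff s.finite_toSet.isClosed
    have hne : (Ioo ((j : ℝ) * (δ / 3)) ((j + 1) * (δ / 3)) \ (s : Set ℝ)).Nonempty :=
      ((Ioo_infinite hlt).sdiff s.finite_toSet).nonempty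
    obtain ⟨c, hc⟩ := Rat.denseRange_cast.exists_mem_open hopen hne
    exact ⟨c, fun h => hc.2 (by simpa using h), hc.1.1, hc.1.2⟩
  choose c hcs hc1 hc2 using key
  refine ⟨(Finset.Icc (⌊-R / (δ / 3)⌋ + 1) (⌊R / (δ / 3)⌋ + 1)).image c, fun q hq => ?_,
    fun a b ha hab => ?_⟩
  · obtain ⟨j, -, rfl⟩ := Finset.mem_image.1 hq
    exact hcs j
  · have h3 : 0 < δ / 3 := by positivity
    obtain ⟨ha1, ha2⟩ := abs_le.1 ha
    refine ⟨c (⌊a / (δ / 3)⌋ + 1), Finset.mem_image_of_mem _ (Finset.mem_Icc.2 ⟨?_, ?_⟩), ?_, ?_⟩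
    · gcongr
    · gcongr
    · refine lt_trans ?_ (hc1 _)
      have := Int.lt_floor_add_one (a / (δ / 3))
      rw [div_lt_iff₀ h3] at this
      push_cast
      exact this
    · refine (hc2 _).trans_le ?_
      have := Int.floor_le (a / (δ / 3))
      rw [le_div_iff₀ h3] at this
      push_cast
      nlinarith

/-- The hyperplane `y i = c`. -/
def coordHyperplane {ι : Type*} (i : ι) (c : ℚ) : AffineSubspace ℝ (ι → ℝ) :=
  AffineSubspace.mk' (fun _ => (c : ℝ)) (LinearMap.ker (LinearMap.proj (R := ℝ) i))

theorem mem_coordHyperplane {ι : Type*} {i : ι} {c : ℚ} {y : ι → ℝ} :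
    y ∈ coordHyperplane i c ↔ y i = c := by
  simp [coordHyperplane, AffineSubspace.mem_mk', sub_eq_zero]

theorem finrank_direction_inf_coordHyperplane_lt {ι : Type*} [Finite ι]
    {P : AffineSubspace ℝ (ι → ℝ)} {i : ι} {c : ℚ} {y z : ι → ℝ} (hy : y ∈ P)
    (hyc : y i = c) (hz : z ∈ P) (hzc : z i ≠ c) :
    Module.finrank ℝ (P ⊓ coordHyperplane i c).direction < Module.finrank ℝ P.direction := by
  rw [AffineSubspace.direction_inf_of_mem hy (mem_coordHyperplane.2 hyc), coordHyperplane,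
    AffineSubspace.direction_mk']
  refine Submodule.finrank_lt_finrank_of_lt (lt_of_le_of_ne inf_le_left fun h => hzc ?_)
  have h1 : z -ᵥ y ∈ P.direction := AffineSubspace.vsub_mem_direction hz hy
  rw [← h] at h1
  have h2 := h1.2
  simp only [SetLike.mem_coe, LinearMap.mem_ker, LinearMap.proj_apply, vsub_eq_sub,
    Pi.sub_apply] at h2
  linarith

/-- `f` is in general position with respect to the family `𝒜` of affine subspaces: homotopies
can be approximated by ones along which no point meets `f` at two different times in subspaces of
small total dimension. -/
def IsGeneric {ι V : Type*} [Fintype ι] [NormedAddCommGroup V] [NormedSpace ℝ V]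
    (𝒜 : Set (AffineSubspace ℝ (ι → ℝ))) (f : (ι → ℝ) → V) : Prop :=
  ∀ (E : Type) [NormedAddCommGroup E] [NormedSpace ℝ E] [FiniteDimensional ℝ E] (B : Set E),
    IsCompact B → ∀ h : E × ℝ → V, Continuous h → ∀ η > 0, ∃ q : E × ℝ → V, Continuous q ∧
      (∀ z ∈ B ×ˢ Icc (0 : ℝ) 1, ‖q z - h z‖ < η) ∧
      ∀ P ∈ 𝒜, ∀ Q ∈ 𝒜, Module.finrank ℝ E + 2 + Module.finrank ℝ P.direction +
          Module.finrank ℝ Q.direction < 2 * Module.finrank ℝ V →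
        ∀ x s s', ∀ y ∈ P, ∀ y' ∈ Q, y ≠ y' → q (x, s) = f y → q (x, s') ≠ f y'

/-- `F` is covered by finitely many members of `𝒜` of dimension less than `k`. -/
def IsCoveredBelow {ι : Type*} (𝒜 : Set (AffineSubspace ℝ (ι → ℝ))) (k : ℕ)
    (F : Set (ι → ℝ)) : Prop :=
  ∃ T : Finset (AffineSubspace ℝ (ι → ℝ)), (∀ P ∈ T, P ∈ 𝒜 ∧ Module.finrank ℝ P.direction < k) ∧
    ∀ y ∈ F, ∃ P ∈ T, y ∈ P

theorem IsCoveredBelow.mono {ι : Type*} {𝒜 : Set (AffineSubspace ℝ (ι → ℝ))} {k : ℕ}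
    {F F' : Set (ι → ℝ)} (h : IsCoveredBelow 𝒜 k F) (hF : F' ⊆ F) : IsCoveredBelow 𝒜 k F' :=
  let ⟨T, hT, hFT⟩ := h
  ⟨T, hT, fun y hy => hFT y (hF hy)⟩

/-- All but finitely many hyperplanes `y i = c` cut down the dimension. -/
theorem IsCoveredBelow.exists_cut {ι : Type*} [Finite ι] {𝒜 : Set (AffineSubspace ℝ (ι → ℝ))}
    (h𝒜 : ∀ P ∈ 𝒜, ∀ i c, P ⊓ coordHyperplane i c ∈ 𝒜) {k : ℕ} {F : Set (ι → ℝ)}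
    (h : IsCoveredBelow 𝒜 (k + 1) F) (i : ι) :
    ∃ s : Finset ℝ, ∀ c : ℚ, (c : ℝ) ∉ s → IsCoveredBelow 𝒜 k (F ∩ {y | y i = c}) := by
  classical
  obtain ⟨T, hT, hFT⟩ := h
  refine ⟨T.image fun P => if hP : ∃ y : ι → ℝ, y ∈ P then hP.choose i else 0, fun c hc =>
    ⟨(T.image (· ⊓ coordHyperplane i c)).filter fun P => ∃ y, y ∈ P, fun P hP => ?_, ?_⟩⟩
  · obtain ⟨hP, y, hy⟩ := Finset.mem_filter.1 hP
    obtain ⟨Q, hQ, rfl⟩ := Finset.mem_image.1 hP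
    refine ⟨h𝒜 Q (hT Q hQ).1 i c, lt_of_lt_of_le ?_ (Nat.lt_succ_iff.1 (hT Q hQ).2)⟩
    have hne : ∃ z, z ∈ Q := ⟨y, hy.1⟩
    refine finrank_direction_inf_coordHyperplane_lt hy.1 (mem_coordHyperplane.1 hy.2)
      hne.choose_spec fun h0 => hc (Finset.mem_image.2 ⟨Q, hQ, ?_⟩)
    rw [dif_pos hne, h0]
  · rintro y ⟨hy, hyc⟩
    obtain ⟨P, hP, hyP⟩ := hFT y hy
    have hmem : y ∈ P ⊓ coordHyperplane i c := ⟨hyP, mem_coordHyperplane.2 hyc⟩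
    exact ⟨P ⊓ coordHyperplane i c, Finset.mem_filter.2
      ⟨Finset.mem_image_of_mem (· ⊓ coordHyperplane i c) hP, y, hmem⟩, hmem⟩

theorem IsGeneric.hasDeformationExtension {ι V : Type*} [Fintype ι] [NormedAddCommGroup V]
    [NormedSpace ℝ V] [FiniteDimensional ℝ V] {𝒜 : Set (AffineSubspace ℝ (ι → ℝ))}
    (h𝒜 : ∀ P ∈ 𝒜, ∀ i c, P ⊓ coordHyperplane i c ∈ 𝒜) {f : (ι → ℝ) → V} (hf : Continuous f)
    (hgen : IsGeneric 𝒜 f) (k : ℕ) :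
    ∀ (E : Type) [NormedAddCommGroup E] [NormedSpace ℝ E] [FiniteDimensional ℝ E] (A B : Set E)
      (F : Set (ι → ℝ)) (g : E → V) (Ψ : E × (ι → ℝ) × ℝ → V),
      Module.finrank ℝ E + 2 * k < 2 * Module.finrank ℝ V → IsCompact B → IsCompact A → A ⊆ B →
      IsCompact F → IsCoveredBelow 𝒜 k F → IsDeformation f A F g Ψ →
      (∀ x ∈ B, ∀ y ∈ F, Ψ (x, y, 1) ≠ 0) → HasDeformationExtension f A B F g Ψ := by
  classical
  induction k with
  | zero =>
    intro E _ _ _ A B F g Ψ _ _ _ _ _ hcov h _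
    obtain ⟨T, hT, hFT⟩ := hcov
    obtain rfl : F = ∅ := eq_empty_of_forall_notMem fun y hy => by
      obtain ⟨P, hP, -⟩ := hFT y hy
      exact Nat.not_lt_zero _ (hT P hP).2
    exact ⟨g, Ψ, ⟨h.continuous_left, h.continuous, by simp, by simp⟩, fun _ _ => rfl, by simp,
      by simp⟩
  | succ k ih =>
    intro E _ _ _ A B F g Ψ hdim hB hA hAB hF hcov h h1
    have hI : IsCompact (Icc (0 : ℝ) 1) := isCompact_Icc
    have hΨc := h.continuous
    obtain ⟨η₁, hη₁, hA₁⟩ := (hA.prod (hF.prod hI)).exists_pos_lt_norm hΨc.continuousOn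
      (fun z hz => h.ne_zero z.1 hz.1 z.2.1 hz.2.1 z.2.2 hz.2.2)
    obtain ⟨η₂, hη₂, hB₂⟩ := (hB.prod hF).exists_pos_lt_norm
      (u := fun z : E × (ι → ℝ) => Ψ (z.1, z.2, 1)) (by fun_prop)
      (fun z hz => h1 z.1 hz.1 z.2 hz.2)
    obtain ⟨η, hη, hηη₁, hηη₂⟩ : ∃ η > 0, 4 * η ≤ η₁ ∧ 4 * η ≤ η₂ :=
      ⟨min η₁ η₂ / 4, by positivity, by linarith [min_le_left η₁ η₂],
        by linarith [min_le_right η₁ η₂]⟩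
    obtain ⟨δ₁, hδ₁, hΨδ⟩ := Metric.uniformContinuousOn_iff.1
      ((hB.prod (hF.prod hI)).uniformContinuousOn_of_continuous hΨc.continuousOn) η hη
    obtain ⟨δ₂, hδ₂, hfδ⟩ := Metric.uniformContinuousOn_iff.1
      (hF.uniformContinuousOn_of_continuous hf.continuousOn) η hη
    obtain ⟨R, hR⟩ := hF.isBounded.exists_norm_le
    set δ := min δ₁ δ₂ with hδ
    have hδ0 : 0 < δ := lt_min hδ₁ hδ₂
    have hcut := fun i => hcov.exists_cut h𝒜 i
    choose s hs using hcut
    have hsep := fun i => exists_finset_rat_separating hδ0 R (s i)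
    choose S hS hSsep using hsep
    have main : ∀ L : Finset (ι × ℚ), (∀ c ∈ L, IsCoveredBelow 𝒜 k (F ∩ {y | y c.1 = c.2})) →
        ∀ F' ⊆ F, IsCompact F' → (∀ y ∈ F', ∀ y' ∈ F',
          (∀ c ∈ L, ¬ (y c.1 < (c.2 : ℝ) ∧ (c.2 : ℝ) < y' c.1) ∧
            ¬ (y' c.1 < (c.2 : ℝ) ∧ (c.2 : ℝ) < y c.1)) → dist y y' < δ) →
        HasDeformationExtension f A B F' g Ψ := by
      intro L
      induction L using Finset.induction_on with
      | empty =>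
        intro _ F' hF' _ hclose
        have hclose' : ∀ y ∈ F', ∀ y' ∈ F', dist y y' < δ := fun y hy y' hy' =>
          hclose y hy y' hy' (by simp)
        refine hasDeformationExtension_of_osc_le hf hB hA.isClosed ⟨h.continuous_left, hΨc,
          fun x hx y hy => h.zero x hx y (hF' hy), fun x hx y hy => h.ne_zero x hx y (hF' hy)⟩
          hη (fun x hx y hy t ht => hηη₁.trans_lt (hA₁ (x, y, t) ⟨hx, hF' hy, ht⟩))
          (fun x hx y hy => hηη₂.trans_lt (hB₂ (x, y) ⟨hx, hF' hy⟩)) ?_ ?_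
        · intro x hx y hy y' hy' t ht
          rw [← dist_eq_norm]
          refine (hΨδ (x, y, t) ⟨hx, hF' hy, ht⟩ (x, y', t) ⟨hx, hF' hy', ht⟩ ?_).le
          simp only [Prod.dist_eq, dist_self]
          exact max_lt hδ₁ (max_lt ((hclose' y hy y' hy').trans_le (min_le_left _ _)) hδ₁)
        · intro y hy y' hy'
          rw [← dist_eq_norm]
          exact (hfδ y (hF' hy) y' (hF' hy')
            ((hclose' y hy y' hy').trans_le (min_le_right _ _))).le
      | insert c L _ ihL =>
        intro hL F' hF' hF'c hclose
        have hL' : ∀ c ∈ L, IsCoveredBelow 𝒜 k (F ∩ {y | y c.1 = c.2}) := fun d hd =>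
          hL d (Finset.mem_insert_of_mem hd)
        have hcl₁ : IsClosed {y : ι → ℝ | y c.1 ≤ c.2} :=
          isClosed_le (by fun_prop) continuous_const
        have hcl₂ : IsClosed {y : ι → ℝ | (c.2 : ℝ) ≤ y c.1} :=
          isClosed_le continuous_const (by fun_prop)
        have hF₁ := hF'c.inter_right hcl₁
        have hF₂ := hF'c.inter_right hcl₂
        have hunion : F' = (F' ∩ {y | y c.1 ≤ c.2}) ∪ (F' ∩ {y | (c.2 : ℝ) ≤ y c.1}) := by
          rw [← inter_union_distrib_left, eq_comm, inter_eq_left]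
          exact fun y _ => le_total (y c.1) (c.2 : ℝ)
        have E₁ := ihL hL' _ (inter_subset_left.trans hF') hF₁ fun y hy y' hy' hd =>
          hclose y hy.1 y' hy'.1 (Finset.forall_mem_insert _ _ _ |>.2
            ⟨⟨fun h0 => absurd hy'.2 (not_le.2 h0.2), fun h0 => absurd hy.2 (not_le.2 h0.2)⟩, hd⟩)
        have E₂ := ihL hL' _ (inter_subset_left.trans hF') hF₂ fun y hy y' hy' hd =>
          hclose y hy.1 y' hy'.1 (Finset.forall_mem_insert _ _ _ |>.2
            ⟨⟨fun h0 => absurd hy.2 (not_le.2 h0.1), fun h0 => absurd hy'.2 (not_le.2 h0.1)⟩, hd⟩)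
        rw [hunion]
        refine E₁.union hf hB hA hAB hF₁ hF₂ ⟨h.continuous_left, hΨc,
          fun x hx y hy => h.zero x hx y (hF' (hunion ▸ hy)),
          fun x hx y hy => h.ne_zero x hx y (hF' (hunion ▸ hy))⟩ E₂ ?_ ?_
        · intro g' Ψ' h' h1'
          refine ih (E × ℝ) _ _ _ g' Ψ' ?_ (hB.prod hI) ?_ ?_ (hF₁.inter hF₂) ?_ h' h1'
          · rw [Module.finrank_prod, Module.finrank_self]
            omega
          · exact (hA.prod hI).union (hB.prod (Set.toFinite _).isCompact)
          · refine union_subset (prod_mono hAB subset_rfl) (prod_mono subset_rfl ?_)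
            rintro t (rfl | rfl) <;> simp
          · refine (hL c (Finset.mem_insert_self _ _)).mono ?_
            rintro y ⟨⟨hy, hy1⟩, -, hy2⟩
            exact ⟨hF' hy, le_antisymm hy1 hy2⟩
        · intro h' hh' η' hη'
          obtain ⟨q, hq, hqh, hqf⟩ := hgen E B hB h' hh' η' hη'
          obtain ⟨T, hT, hFT⟩ := hcov
          refine ⟨q, hq, hqh, fun x s s' y hy y' hy' hyy => ?_⟩
          obtain ⟨P, hP, hyP⟩ := hFT y (hF' hy.1)
          obtain ⟨Q, hQ, hyQ⟩ := hFT y' (hF' hy'.1)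
          refine hqf P (hT P hP).1 Q (hT Q hQ).1 ?_ x s s' y hyP y' hyQ hyy
          have := (hT P hP).2
          have := (hT Q hQ).2
          omega
    refine main (Finset.univ.biUnion fun i => (S i).image (Prod.mk i)) (fun c hc => ?_) F
      subset_rfl hF fun y hy y' hy' hyy => ?_
    · obtain ⟨i, -, hi⟩ := Finset.mem_biUnion.1 hc
      obtain ⟨d, hd, rfl⟩ := Finset.mem_image.1 hi
      exact hs i d (hS i d hd)
    · refine (dist_pi_lt_iff hδ0).2 fun i => ?_
      by_contra! hge
      have hmem : ∀ c ∈ S i, (i, c) ∈ Finset.univ.biUnion fun i => (S i).image (Prod.mk i) :=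
        fun c hc => Finset.mem_biUnion.2 ⟨i, Finset.mem_univ _, Finset.mem_image_of_mem _ hc⟩
      have hb : ∀ y ∈ F, |y i| ≤ R := fun y hy => (norm_le_pi_norm y i).trans (hR y hy)
      rw [Real.dist_eq] at hge
      rcases le_abs'.1 hge with h0 | h0
      · obtain ⟨c, hc, hc1, hc2⟩ := hSsep i (y i) (y' i) (hb y hy) (by linarith)
        exact (hyy _ (hmem c hc)).1 ⟨hc1, hc2⟩
      · obtain ⟨c, hc, hc1, hc2⟩ := hSsep i (y' i) (y i) (hb y' hy') (by linarith)
        exact (hyy _ (hmem c hc)).2 ⟨hc1, hc2⟩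

end Deformation

section GeneralPosition
open Set

/-- A countable family of `C¹` maps approximating every continuous map uniformly on compacts. -/
theorem exists_countable_contDiff_approx (X V : Type*) [NormedAddCommGroup X] [NormedSpace ℝ X]
    [FiniteDimensional ℝ X] [NormedAddCommGroup V] [NormedSpace ℝ V] [FiniteDimensional ℝ V] :
    ∃ 𝒬 : Set (X → V), 𝒬.Countable ∧ (∀ q ∈ 𝒬, ContDiff ℝ 1 q) ∧
      ∀ h : X → V, Continuous h → ∀ B : Set X, IsCompact B → ∀ η > 0,
        ∃ q ∈ 𝒬, ∀ z ∈ B, ‖q z - h z‖ < η := by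
  have := FiniteDimensional.proper ℝ X
  have := FiniteDimensional.proper ℝ V
  obtain ⟨D, hDc, hD⟩ := TopologicalSpace.exists_countable_dense C(X, V)
  have key : ∀ (d : C(X, V)) (n : ℕ), ∃ q : X → V, ContDiff ℝ 1 q ∧
      ∀ x, dist (q x) (d x) < 1 / ((n : ℝ) + 1) := fun d n => by
    obtain ⟨q, hq, hqd, -⟩ := d.continuous.exists_contDiff_approx (ε := fun _ => 1 / ((n : ℝ) + 1))
      1 continuous_const (fun _ => Nat.one_div_pos_of_nat)
    exact ⟨q, hq, hqd⟩
  choose q hq hqd using key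
  refine ⟨(fun p : C(X, V) × ℕ => q p.1 p.2) '' (D ×ˢ univ),
    (hDc.prod countable_univ).image _, ?_, fun h hh B hB η hη => ?_⟩
  · rintro _ ⟨p, -, rfl⟩
    exact hq _ _
  · have hnhds : {c : C(X, V) | ∀ z ∈ B, dist (c z) (h z) < η / 2} ∈ 𝓝 (⟨h, hh⟩ : C(X, V)) := by
      have h1 := (ContinuousMap.tendsto_iff_forall_isCompact_tendstoUniformlyOn
        (F := fun c : C(X, V) => c) (f := ⟨h, hh⟩)).1 Filter.tendsto_id B hB
      filter_upwards [Metric.tendstoUniformlyOn_iff.1 h1 _ (half_pos hη)] with c hc z hz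
      rw [dist_comm]
      exact hc z hz
    obtain ⟨d, hdD, hd⟩ := hD.inter_nhds_nonempty hnhds
    obtain ⟨n, hn⟩ := exists_nat_one_div_lt (half_pos hη)
    refine ⟨_, ⟨(d, n), ⟨hdD, mem_univ _⟩, rfl⟩, fun z hz => ?_⟩
    rw [← dist_eq_norm]
    have h1 := hqd d n z
    have h2 := hd z hz
    have h3 := dist_triangle (q d n z) (d z) (h z)
    simp only
    linarith

/-- The perturbation of `f` by the affine map with coefficients `b`. -/
def affinePerturb {ι V : Type*} [Fintype ι] [NormedAddCommGroup V] [NormedSpace ℝ V]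
    (f : (ι → ℝ) → V) (b : V × (ι → V)) (y : ι → ℝ) : V :=
  f y + b.1 + ∑ w, y w • b.2 w

theorem dimH_setOf_affinePerturb_le {ι V E : Type*} [Fintype ι] [NormedAddCommGroup V]
    [NormedSpace ℝ V] [FiniteDimensional ℝ V] [NormedAddCommGroup E] [NormedSpace ℝ E]
    [FiniteDimensional ℝ E] {f : (ι → ℝ) → V} (hf : ContDiff ℝ 1 f) {q : E × ℝ → V}
    (hq : ContDiff ℝ 1 q) (P Q : AffineSubspace ℝ (ι → ℝ)) (i : ι) :
    dimH {b : V × (ι → V) | ∃ x s s', ∃ y ∈ P, ∃ y' ∈ Q, y' i < y i ∧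
      q (x, s) = affinePerturb f b y ∧ q (x, s') = affinePerturb f b y'} ≤
    (Module.finrank ℝ E + 2 + Module.finrank ℝ P.direction + Module.finrank ℝ Q.direction +
      (Fintype.card ι - 1) * Module.finrank ℝ V : ℕ) := by
  classical
  rcases (P : Set (ι → ℝ)).eq_empty_or_nonempty with hP | ⟨p₀, hp₀⟩
  · have hP' : ∀ y, y ∉ P := fun y hy => (hP ▸ hy : y ∈ (∅ : Set (ι → ℝ)))
    simp [hP']
  rcases (Q : Set (ι → ℝ)).eq_empty_or_nonempty with hQ | ⟨q₀, hq₀⟩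
  · have hQ' : ∀ y, y ∉ Q := fun y hy => (hQ ▸ hy : y ∈ (∅ : Set (ι → ℝ)))
    simp [hQ']
  let M := (E × ℝ × ℝ) × (P.direction × Q.direction) × ({w // w ≠ i} → V)
  let Y : M → ι → ℝ := fun z => p₀ + (z.2.1.1 : ι → ℝ)
  let Y' : M → ι → ℝ := fun z => q₀ + (z.2.1.2 : ι → ℝ)
  have hY : ContDiff ℝ 1 Y := contDiff_const.add
    (P.direction.subtypeL.contDiff.comp (by fun_prop : ContDiff ℝ 1 fun z : M => z.2.1.1))
  have hY' : ContDiff ℝ 1 Y' := contDiff_const.add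
    (Q.direction.subtypeL.contDiff.comp (by fun_prop : ContDiff ℝ 1 fun z : M => z.2.1.2))
  let D : Set M := {z | 0 < Y z i - Y' z i}
  have hDeq : D = {z | q₀ i - p₀ i < (z.2.1.1 : ι → ℝ) i - (z.2.1.2 : ι → ℝ) i} := by
    ext z
    simp only [D, Y, Y', mem_ofPred_eq, Pi.add_apply]
    constructor <;> intro h <;> linarith
  have hD : Convex ℝ D := by
    rw [hDeq]
    refine convex_halfSpace_gt ⟨fun z z' => ?_, fun c z => ?_⟩ _
    · exact add_sub_add_comm ((z.2.1.1 : ι → ℝ) i) ((z'.2.1.1 : ι → ℝ) i) _ _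
    · exact (mul_sub c ((z.2.1.1 : ι → ℝ) i) _).symm
  let c : M → ι → V := fun z w => if h : w ≠ i then z.2.2 ⟨w, h⟩ else
    (Y z i - Y' z i)⁻¹ • (q (z.1.1, z.1.2.1) - q (z.1.1, z.1.2.2) - f (Y z) + f (Y' z) -
      ∑ w : {w // w ≠ i}, (Y z w - Y' z w) • z.2.2 w)
  have hYw : ∀ w, ContDiff ℝ 1 fun z => Y z w := fun w => contDiff_pi.1 hY w
  have hYw' : ∀ w, ContDiff ℝ 1 fun z => Y' z w := fun w => contDiff_pi.1 hY' w
  have hc : ∀ w, ContDiffOn ℝ 1 (fun z => c z w) D := fun w => by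
    by_cases hw : w ≠ i
    · simp only [c, dif_pos hw]
      exact ((contDiff_apply ℝ V (⟨w, hw⟩ : {w // w ≠ i})).comp
        (contDiff_snd.comp contDiff_snd)).contDiffOn
    · simp only [c, dif_neg hw]
      refine (((hYw i).sub (hYw' i)).contDiffOn.inv fun z hz => ne_of_gt hz).smul
        (ContDiff.contDiffOn ?_)
      have h1 : ContDiff ℝ 1 fun z : M => q (z.1.1, z.1.2.1) := hq.comp (by fun_prop)
      have h2 : ContDiff ℝ 1 fun z : M => q (z.1.1, z.1.2.2) := hq.comp (by fun_prop)
      refine (((h1.sub h2).sub (hf.comp hY)).add (hf.comp hY')).sub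
        (ContDiff.sum fun w _ => ((hYw w).sub (hYw' w)).smul ?_)
      exact (contDiff_apply ℝ V w).comp (contDiff_snd.comp contDiff_snd)
  let G : M → V × (ι → V) := fun z =>
    (q (z.1.1, z.1.2.1) - f (Y z) - ∑ w, Y z w • c z w, c z)
  have hG : ContDiffOn ℝ 1 G D := by
    refine ContDiffOn.prodMk ?_ (contDiffOn_pi.2 hc)
    have h1 : ContDiff ℝ 1 fun z : M => q (z.1.1, z.1.2.1) := hq.comp (by fun_prop)
    exact (h1.sub (hf.comp hY)).contDiffOn.sub
      (ContDiffOn.sum fun w _ => (hYw w).contDiffOn.smul (hc w))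
  refine (dimH_mono (t := G '' D) ?_).trans ((hG.dimH_image_le hD subset_rfl).trans
    ((dimH_mono (subset_univ _)).trans (Eq.le ?_)))
  · rintro ⟨b₀, b⟩ ⟨x, s, s', y, hy, y', hy', hlt, h1, h2⟩
    let z : M := ((x, s, s'), (⟨y - p₀, AffineSubspace.vsub_mem_direction hy hp₀⟩,
      ⟨y' - q₀, AffineSubspace.vsub_mem_direction hy' hq₀⟩), fun w => b w)
    have hYz : Y z = y := by simp [Y, z]
    have hYz' : Y' z = y' := by simp [Y', z]
    have hcz : c z = b := by
      funext w
      by_cases hw : w ≠ i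
      · simp only [c, dif_pos hw, z]
      · obtain rfl : w = i := not_not.1 hw
        have hsum : q (x, s) - q (x, s') - f y + f y' = ∑ w, (y w - y' w) • b w := by
          simp only [h1, h2, affinePerturb, sub_smul, Finset.sum_sub_distrib]
          abel
        simp only [c, dif_neg hw, hYz, hYz']
        rw [inv_smul_eq_iff₀ (sub_pos.2 hlt).ne', sub_eq_iff_eq_add, hsum,
          Fintype.sum_eq_add_sum_subtype_ne _ w]
    refine ⟨z, ?_, ?_⟩
    · simp only [D, mem_ofPred_eq, hYz, hYz']
      linarith
    · simp only [G, hcz, hYz]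
      refine Prod.ext ?_ rfl
      simp only [z, h1, affinePerturb]
      abel
  · rw [Real.dimH_univ_eq_finrank]
    simp only [M, Module.finrank_prod, Module.finrank_self, Module.finrank_pi_fintype,
      Finset.sum_const, Finset.card_univ, smul_eq_mul]
    have hcard : Fintype.card {w // w ≠ i} = Fintype.card ι - 1 := Set.card_ne_eq i
    rw [hcard]
    congr 1
    ring

end GeneralPosition

section GeneralPosition
open Set

theorem exists_affinePerturb_isGeneric {ι V : Type*} [Fintype ι] [NormedAddCommGroup V]
    [NormedSpace ℝ V] [FiniteDimensional ℝ V] (hV : 0 < Module.finrank ℝ V)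
    {𝒜 : Set (AffineSubspace ℝ (ι → ℝ))} (h𝒜 : 𝒜.Countable) {f : (ι → ℝ) → V}
    (hf : ContDiff ℝ 1 f) {ε : ℝ} (hε : 0 < ε) :
    ∃ b : V × (ι → V), ‖b‖ < ε ∧ IsGeneric 𝒜 (affinePerturb f b) := by
  have h𝒬 := fun p : ℕ => exists_countable_contDiff_approx ((Fin p → ℝ) × ℝ) V
  choose 𝒬 h𝒬c h𝒬s h𝒬 using h𝒬
  let bad : ∀ p : ℕ, ((Fin p → ℝ) × ℝ → V) → AffineSubspace ℝ (ι → ℝ) →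
      AffineSubspace ℝ (ι → ℝ) → ι → Set (V × (ι → V)) := fun p q P Q i =>
    {b | p + 2 + Module.finrank ℝ P.direction + Module.finrank ℝ Q.direction <
      2 * Module.finrank ℝ V ∧ ∃ x s s', ∃ y ∈ P, ∃ y' ∈ Q, y' i < y i ∧
        q (x, s) = affinePerturb f b y ∧ q (x, s') = affinePerturb f b y'}
  let N := (Fintype.card ι + 1) * Module.finrank ℝ V - 1
  have hbad : ∀ p, ∀ q ∈ 𝒬 p, ∀ P Q i, dimH (bad p q P Q i) ≤ (N : ℕ) := by
    intro p q hq P Q i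
    by_cases hd : p + 2 + Module.finrank ℝ P.direction + Module.finrank ℝ Q.direction <
      2 * Module.finrank ℝ V
    · refine (dimH_mono fun b hb => hb.2).trans
        ((dimH_setOf_affinePerturb_le hf (h𝒬s p q hq) P Q i).trans ?_)
      rw [Module.finrank_fin_fun]
      obtain ⟨C, hC⟩ : ∃ C, Fintype.card ι = C + 1 :=
        Nat.exists_eq_succ_of_ne_zero (Fintype.card_pos_iff.2 ⟨i⟩).ne'
      simp only [N, hC, add_tsub_cancel_right, add_mul, one_mul]
      generalize C * Module.finrank ℝ V = K
      norm_cast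
      omega
    · simp [bad, hd]
  have hdim : dimH (⋃ p, ⋃ q ∈ 𝒬 p, ⋃ P ∈ 𝒜, ⋃ Q ∈ 𝒜, ⋃ i, bad p q P Q i) ≤ (N : ℕ) := by
    rw [dimH_iUnion]
    refine iSup_le fun p => ?_
    rw [dimH_bUnion (h𝒬c p)]
    refine iSup₂_le fun q hq => ?_
    rw [dimH_bUnion h𝒜]
    refine iSup₂_le fun P _ => ?_
    rw [dimH_bUnion h𝒜]
    refine iSup₂_le fun Q _ => ?_
    rw [dimH_iUnion]
    exact iSup_le fun i => hbad p q hq P Q i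
  have hdense := dense_compl_of_dimH_lt_finrank (hdim.trans_lt (by
    have hfin : Module.finrank ℝ (V × (ι → V)) =
        (Fintype.card ι + 1) * Module.finrank ℝ V := by
      simp [Module.finrank_pi_fintype]
      ring
    rw [hfin, Nat.cast_lt]
    exact Nat.sub_lt (by positivity) one_pos))
  obtain ⟨b, hb, hbε⟩ := hdense.exists_dist_lt 0 hε
  rw [dist_zero_left] at hbε
  refine ⟨b, hbε, fun E _ _ _ B hB h hh η hη => ?_⟩
  let e : E ≃L[ℝ] (Fin (Module.finrank ℝ E) → ℝ) :=
    ContinuousLinearEquiv.ofFinrankEq (by simp)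
  obtain ⟨q, hq, hqh⟩ := h𝒬 (Module.finrank ℝ E) (fun z => h (e.symm z.1, z.2)) (by fun_prop)
    ((fun z : E × ℝ => (e z.1, z.2)) '' (B ×ˢ Icc (0 : ℝ) 1))
    ((hB.prod isCompact_Icc).image (by fun_prop)) η hη
  have hqc : Continuous q := (h𝒬s _ q hq).continuous
  have hgood : ∀ P ∈ 𝒜, ∀ Q ∈ 𝒜, ∀ i, b ∉ bad _ q P Q i := fun P hP Q hQ i hmem => by
    refine hb ?_
    simp only [mem_iUnion]
    exact ⟨_, q, hq, P, hP, Q, hQ, i, hmem⟩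
  refine ⟨fun z => q (e z.1, z.2), by fun_prop, fun z hz => ?_, ?_⟩
  · simpa using hqh _ (mem_image_of_mem _ hz)
  · intro P hP Q hQ hd x s s' y hy y' hy' hne h1 h2
    obtain ⟨i, hi⟩ := Function.ne_iff.1 hne
    rcases lt_or_gt_of_ne hi with hlt | hlt
    · exact hgood Q hQ P hP i ⟨by omega, e x, s', s, y', hy', y, hy, hlt, h2, h1⟩
    · exact hgood P hP Q hQ i ⟨hd, e x, s, s', y, hy, y', hy', hlt, h1, h2⟩

theorem exists_isGeneric_approx {ι V : Type*} [Fintype ι] [NormedAddCommGroup V]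
    [NormedSpace ℝ V] [FiniteDimensional ℝ V] (hV : 0 < Module.finrank ℝ V)
    {𝒜 : Set (AffineSubspace ℝ (ι → ℝ))} (h𝒜 : 𝒜.Countable) {f : (ι → ℝ) → V}
    (hf : Continuous f) {K : Set (ι → ℝ)} (hK : IsCompact K) {η : ℝ} (hη : 0 < η) :
    ∃ f' : (ι → ℝ) → V, Continuous f' ∧ IsGeneric 𝒜 f' ∧ ∀ y ∈ K, ‖f' y - f y‖ < η := by
  obtain ⟨f₁, hf₁, hff₁, -⟩ := hf.exists_contDiff_approx (ε := fun _ => η / 2) 1 continuous_const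
    (fun _ => half_pos hη)
  obtain ⟨R, hR0, hR⟩ := hK.isBounded.exists_pos_norm_le
  have hpos : 0 < 1 + Fintype.card ι * R := by positivity
  obtain ⟨b, hb, hgen⟩ := exists_affinePerturb_isGeneric hV h𝒜 hf₁
    (div_pos (half_pos hη) hpos)
  refine ⟨affinePerturb f₁ b, ?_, hgen, fun y hy => ?_⟩
  · have := hf₁.continuous
    unfold affinePerturb
    fun_prop
  · have h1 := hff₁ y
    rw [dist_eq_norm] at h1
    have h2 : ‖∑ w, y w • b.2 w‖ ≤ ∑ _w : ι, R * ‖b‖ := by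
      refine norm_sum_le_of_le _ fun w _ => ?_
      rw [norm_smul]
      exact mul_le_mul ((norm_le_pi_norm y w).trans (hR y hy))
        ((norm_le_pi_norm b.2 w).trans (norm_snd_le b)) (norm_nonneg _) hR0.le
    have h3 := norm_fst_le b
    rw [Finset.sum_const, Finset.card_univ, nsmul_eq_mul] at h2
    rw [lt_div_iff₀ hpos] at hb
    have h4 : affinePerturb f₁ b y - f y = (f₁ y - f y) + (b.1 + ∑ w, y w • b.2 w) := by
      simp only [affinePerturb]
      abel
    rw [h4]
    have h5 := norm_add_le (f₁ y - f y) (b.1 + ∑ w, y w • b.2 w)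
    have h6 := norm_add_le b.1 (∑ w, y w • b.2 w)
    nlinarith

end GeneralPosition

section Simplicial
open Set

variable {ι : Type} [Fintype ι]

/-- The face of the standard simplex spanned by the vertices in `s`. -/
def simplexFace (s : Finset ι) : Set (ι → ℝ) :=
  {y | (∀ v, 0 ≤ y v) ∧ ∑ v, y v = 1 ∧ ∀ v ∉ s, y v = 0}

theorem isCompact_simplexFace (s : Finset ι) : IsCompact (simplexFace s) := by
  have h : simplexFace s = stdSimplex ℝ ι ∩ {y | ∀ v ∉ s, y v = 0} := by
    ext y
    simp only [simplexFace, stdSimplex, mem_ofPred_eq, mem_inter_iff]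
    tauto
  rw [h]
  refine (isCompact_stdSimplex ℝ ι).inter_right ?_
  simp only [ofPred_forall]
  exact isClosed_iInter fun v => isClosed_iInter fun _ => isClosed_eq (by fun_prop) (by fun_prop)

theorem simplexFace_mono {s t : Finset ι} (h : s ⊆ t) : simplexFace s ⊆ simplexFace t :=
  fun _ hy => ⟨hy.1, hy.2.1, fun v hv => hy.2.2 v fun hs => hv (h hs)⟩

theorem exists_pos_of_mem_simplexFace {s : Finset ι} {y : ι → ℝ} (hy : y ∈ simplexFace s) :
    ∃ v ∈ s, 0 < y v := by
  obtain ⟨v, -, hv⟩ := Finset.exists_ne_zero_of_sum_ne_zero (hy.2.1.trans_ne one_ne_zero)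
  exact ⟨v, by_contra fun h => hv (hy.2.2 v h), (hy.1 v).lt_of_ne' hv⟩

theorem mem_simplexFace_erase [DecidableEq ι] {s : Finset ι} {y : ι → ℝ} (hy : y ∈ simplexFace s) {v : ι}
    (hv : y v = 0) : y ∈ simplexFace (s.erase v) :=
  ⟨hy.1, hy.2.1, fun w hw => by
    by_cases h : w = v
    · rw [h, hv]
    · exact hy.2.2 w fun hs => hw (Finset.mem_erase.2 ⟨h, hs⟩)⟩

/-- The affine span of the vertices in `s`. -/
def simplexSpan [DecidableEq ι] (s : Finset ι) : AffineSubspace ℝ (ι → ℝ) :=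
  affineSpan ℝ (s.image fun v => (Pi.single v 1 : ι → ℝ))

theorem simplexFace_subset_simplexSpan [DecidableEq ι] (s : Finset ι) :
    simplexFace s ⊆ (simplexSpan s : Set (ι → ℝ)) := by
  intro y hy
  have h1 : ∑ v ∈ s, y v = 1 := by
    rw [← hy.2.1]
    exact Finset.sum_subset (Finset.subset_univ s) fun v _ hv => hy.2.2 v hv
  have h2 : y = ∑ v ∈ s, y v • (Pi.single v 1 : ι → ℝ) := by
    rw [Finset.sum_subset (Finset.subset_univ s) fun v _ hv => by rw [hy.2.2 v hv, zero_smul]]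
    exact pi_eq_sum_univ' y
  rw [h2]
  refine convexHull_subset_affineSpan _ ((convex_convexHull ℝ _).sum_mem (fun v _ => hy.1 v) h1
    fun v hv => subset_convexHull ℝ _ ?_)
  exact Finset.mem_coe.2 (Finset.mem_image_of_mem _ hv)

theorem finrank_direction_simplexSpan_lt [DecidableEq ι] {s : Finset ι} {n : ℕ} (hs : s.card ≤ n + 1) :
    Module.finrank ℝ (simplexSpan s).direction < n + 1 := by
  rw [simplexSpan, direction_affineSpan]
  rcases s.eq_empty_or_nonempty with rfl | hne
  · rw [Finset.image_empty, Finset.coe_empty, vectorSpan_empty, finrank_bot]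
    exact n.succ_pos
  · obtain ⟨k, hk⟩ := Nat.exists_eq_succ_of_ne_zero hne.card_pos.ne'
    have := finrank_vectorSpan_image_finset_le ℝ (fun v => (Pi.single v 1 : ι → ℝ)) s hk
    omega

/-- The spans of the faces, cut by finitely many rational coordinate hyperplanes. -/
def simplexSlices (ι : Type) [Fintype ι] [DecidableEq ι] : Set (AffineSubspace ℝ (ι → ℝ)) :=
  range fun p : Finset ι × List (ι × ℚ) =>
    p.2.foldr (fun c P => P ⊓ coordHyperplane c.1 c.2) (simplexSpan p.1)

theorem countable_simplexSlices [DecidableEq ι] : (simplexSlices ι).Countable := by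
  have : Countable ι := Finite.to_countable
  exact countable_range _

theorem simplexSpan_mem_simplexSlices [DecidableEq ι] (s : Finset ι) : simplexSpan s ∈ simplexSlices ι :=
  ⟨(s, []), rfl⟩

theorem inf_mem_simplexSlices [DecidableEq ι] : ∀ P ∈ simplexSlices ι, ∀ i c,
    P ⊓ coordHyperplane i c ∈ simplexSlices ι := by
  rintro _ ⟨p, rfl⟩ i c
  exact ⟨(p.1, (i, c) :: p.2), rfl⟩

/-- Pairs of points in faces from `𝓛` all of whose vertices are related by `far`. -/
def farPairs (far : ι → ι → Prop) (𝓛 : Finset (Finset ι)) : Set ((ι → ℝ) × (ι → ℝ)) :=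
  {z | ∃ s ∈ 𝓛, ∃ t ∈ 𝓛, (∀ v ∈ s, ∀ w ∈ t, far v w) ∧ z.1 ∈ simplexFace s ∧ z.2 ∈ simplexFace t}

theorem farPairs_mono {far : ι → ι → Prop} {𝓛 𝓛' : Finset (Finset ι)} (h : 𝓛 ⊆ 𝓛') :
    farPairs far 𝓛 ⊆ farPairs far 𝓛' := by
  rintro z ⟨s, hs, t, ht, hz⟩
  exact ⟨s, h hs, t, h ht, hz⟩

theorem isCompact_farPairs (far : ι → ι → Prop) (𝓛 : Finset (Finset ι)) :
    IsCompact (farPairs far 𝓛) := by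
  have h : farPairs far 𝓛 = ⋃ p ∈ {p : Finset ι × Finset ι | p.1 ∈ 𝓛 ∧ p.2 ∈ 𝓛 ∧
      ∀ v ∈ p.1, ∀ w ∈ p.2, far v w}, simplexFace p.1 ×ˢ simplexFace p.2 := by
    ext z
    simp only [farPairs, mem_ofPred_eq, mem_iUnion, mem_prod, exists_prop, Prod.exists]
    constructor
    · rintro ⟨s, hs, t, ht, hst, h1, h2⟩
      exact ⟨s, t, ⟨hs, ht, hst⟩, h1, h2⟩
    · rintro ⟨s, t, ⟨hs, ht, hst⟩, h1, h2⟩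
      exact ⟨s, hs, t, ht, hst, h1, h2⟩
  rw [h]
  exact (Set.toFinite _).isCompact_biUnion fun p _ =>
    (isCompact_simplexFace p.1).prod (isCompact_simplexFace p.2)

theorem swap_mem_farPairs {far : ι → ι → Prop} (hfar : ∀ v w, far v w → far w v)
    {𝓛 : Finset (Finset ι)} {x y : ι → ℝ} (h : (x, y) ∈ farPairs far 𝓛) :
    (y, x) ∈ farPairs far 𝓛 := by
  obtain ⟨s, hs, t, ht, hst, h1, h2⟩ := h
  exact ⟨t, ht, s, hs, fun v hv w hw => hfar w v (hst w hw v hv), h2, h1⟩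

/-- `Ψ` deforms, through nowhere zero odd maps on `W`, the difference map `f x - f y` into `Φ`. -/
structure IsOddDeformation {Y V : Type*} [TopologicalSpace Y] [NormedAddCommGroup V]
    (W : Set (Y × Y)) (Φ : Y × Y → V) (f : Y → V) (Ψ : Y × Y × ℝ → V) : Prop where
  continuous_left : Continuous f
  continuous : Continuous Ψ
  zero : ∀ x y, (x, y) ∈ W → Ψ (x, y, 0) = f x - f y
  one : ∀ x y, (x, y) ∈ W → Ψ (x, y, 1) = Φ (x, y)
  ne_zero : ∀ x y, (x, y) ∈ W → ∀ t ∈ Icc (0 : ℝ) 1, Ψ (x, y, t) ≠ 0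
  odd : ∀ x y, (x, y) ∈ W → ∀ t ∈ Icc (0 : ℝ) 1, Ψ (y, x, t) = -Ψ (x, y, t)

/-- A small perturbation of the initial map carries the deformation along. -/
theorem IsOddDeformation.exists_isGeneric {V : Type*} [NormedAddCommGroup V] [NormedSpace ℝ V]
    [FiniteDimensional ℝ V] (hV : 0 < Module.finrank ℝ V) {𝒜 : Set (AffineSubspace ℝ (ι → ℝ))}
    (h𝒜 : 𝒜.Countable) {W : Set ((ι → ℝ) × (ι → ℝ))} (hW : IsCompact W)
    {Φ : (ι → ℝ) × (ι → ℝ) → V} {f : (ι → ℝ) → V} {Ψ : (ι → ℝ) × (ι → ℝ) × ℝ → V}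
    (h : IsOddDeformation W Φ f Ψ) :
    ∃ f' Ψ', IsOddDeformation W Φ f' Ψ' ∧ IsGeneric 𝒜 f' := by
  have hfc := h.continuous_left
  have hΨc := h.continuous
  obtain ⟨η, hη, hΨη⟩ := (hW.prod (isCompact_Icc (a := (0 : ℝ)) (b := 1))).exists_pos_lt_norm
    (u := fun z : ((ι → ℝ) × (ι → ℝ)) × ℝ => Ψ (z.1.1, z.1.2, z.2)) (by fun_prop)
    (fun z hz => h.ne_zero z.1.1 z.1.2 hz.1 z.2 hz.2)
  obtain ⟨f', hf', hgen, hff'⟩ := exists_isGeneric_approx hV h𝒜 hfc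
    ((hW.image continuous_fst).union (hW.image continuous_snd)) (half_pos hη)
  refine ⟨f', fun z => Ψ z + (1 - z.2.2) • ((f' z.1 - f z.1) - (f' z.2.1 - f z.2.1)),
    ⟨hf', by fun_prop, fun x y hxy => ?_, fun x y hxy => ?_, fun x y hxy t ht h0 => ?_,
      fun x y hxy t ht => ?_⟩, hgen⟩
  · simp only [h.zero x y hxy, sub_zero, one_smul]
    abel
  · simp [h.one x y hxy]
  · have h1 := hΨη ((x, y), t) ⟨hxy, ht⟩
    have h2 := hff' x (Or.inl ⟨_, hxy, rfl⟩)
    have h3 := hff' y (Or.inr ⟨_, hxy, rfl⟩)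
    have h4 := norm_sub_le (f' x - f x) (f' y - f y)
    simp only at h0 h1
    rw [eq_neg_of_add_eq_zero_left h0, norm_neg, norm_smul,
      Real.norm_of_nonneg (by linarith [ht.2])] at h1
    nlinarith [ht.1, ht.2, norm_nonneg ((f' x - f x) - (f' y - f y))]
  · simp only [h.odd x y hxy t ht]
    rw [neg_add, ← smul_neg, neg_sub]

end Simplicial

section Induction
open Set

variable {ι : Type} [Fintype ι] {V : Type*} [NormedAddCommGroup V] [NormedSpace ℝ V]
  [FiniteDimensional ℝ V]

/-- The span of a nonempty face admits affine coordinates. -/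
theorem exists_simplexSpan_chart [DecidableEq ι] {s : Finset ι} (hs : s.Nonempty) :
    ∃ (i : (simplexSpan s).direction → ι → ℝ) (π : (ι → ℝ) → (simplexSpan s).direction),
      Continuous i ∧ Continuous π ∧ ∀ x ∈ simplexFace s, i (π x) = x := by
  obtain ⟨v₀, hv₀⟩ := hs
  set e : ι → ℝ := Pi.single v₀ 1
  have he : e ∈ simplexSpan s :=
    mem_affineSpan ℝ (Finset.mem_coe.2 (Finset.mem_image_of_mem _ hv₀))
  obtain ⟨P, hP⟩ := LinearMap.exists_leftInverse_of_injective (simplexSpan s).direction.subtype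
    (Submodule.ker_subtype _)
  have hPc := P.continuous_of_finiteDimensional
  refine ⟨fun x => e + x, fun y => P (y - e), by fun_prop, by fun_prop, fun x hx => ?_⟩
  have h1 : x - e ∈ (simplexSpan s).direction :=
    AffineSubspace.vsub_mem_direction (simplexFace_subset_simplexSpan s hx) he
  have h2 : P (x - e) = ⟨x - e, h1⟩ := LinearMap.congr_fun hP ⟨x - e, h1⟩
  simp [h2]

/-- Extension of an odd deformation over one more simplex. -/
theorem IsOddDeformation.insert [DecidableEq ι] {far : ι → ι → Prop}
    (hsymm : ∀ v w, far v w → far w v) (hirr : ∀ v, ¬ far v v) {n : ℕ}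
    (hn : 3 * (n + 1) ≤ 2 * Module.finrank ℝ V) {𝓛 : Finset (Finset ι)}
    (h𝓛 : ∀ t ∈ 𝓛, t.card ≤ n + 1) {s : Finset ι} (hs : s.Nonempty) (hsn : s.card ≤ n + 1)
    (hs𝓛 : ∀ v ∈ s, s.erase v ∈ 𝓛) (hmax : ∀ t ∈ 𝓛, ¬ s ⊆ t)
    {Φ : (ι → ℝ) × (ι → ℝ) → V} (hΦ : Continuous Φ)
    (hΦ0 : ∀ z ∈ farPairs far (insert s 𝓛), Φ z ≠ 0)
    (hΦodd : ∀ x y, (x, y) ∈ farPairs far (insert s 𝓛) → Φ (y, x) = -Φ (x, y))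
    {f : (ι → ℝ) → V} {Ψ : (ι → ℝ) × (ι → ℝ) × ℝ → V}
    (h : IsOddDeformation (farPairs far 𝓛) Φ f Ψ) (hgen : IsGeneric (simplexSlices ι) f) :
    ∃ f' Ψ', IsOddDeformation (farPairs far (insert s 𝓛)) Φ f' Ψ' := by
  have hfc := h.continuous_left
  have hΨc := h.continuous
  obtain ⟨i, π, hi, hπ, hiπ⟩ := exists_simplexSpan_chart hs
  set F : Set (ι → ℝ) := ⋃ t ∈ {t | t ∈ 𝓛 ∧ ∀ v ∈ s, ∀ w ∈ t, far v w}, simplexFace t with hF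
  set L : Set (ι → ℝ) := ⋃ t ∈ {t | t ∈ 𝓛}, simplexFace t with hL
  set D : Set (ι → ℝ) := ⋃ v ∈ {v | v ∈ s}, simplexFace (s.erase v) with hD
  have hFc : IsCompact F := (toFinite _).isCompact_biUnion fun t _ => isCompact_simplexFace t
  have hLc : IsCompact L := (toFinite _).isCompact_biUnion fun t _ => isCompact_simplexFace t
  have hDc : IsCompact D := (toFinite _).isCompact_biUnion fun t _ => isCompact_simplexFace _
  have hsc := isCompact_simplexFace s
  have hFL : F ⊆ L := biUnion_mono (fun t ht => ht.1) fun _ _ => Subset.rfl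
  have hDs : D ⊆ simplexFace s := iUnion₂_subset fun v _ => simplexFace_mono (s.erase_subset v)
  have hLs : ∀ x ∈ L, x ∈ simplexFace s → x ∈ D := by
    intro x hx hxs
    obtain ⟨t, ht, hxt⟩ := mem_iUnion₂.1 hx
    obtain ⟨v, hv, hvt⟩ := Finset.not_subset.1 (hmax t ht)
    exact mem_iUnion₂.2 ⟨v, hv, mem_simplexFace_erase hxs (hxt.2.2 v hvt)⟩
  have hFs : ∀ y ∈ F, y ∉ simplexFace s := by
    intro y hy hys
    obtain ⟨t, ⟨-, ht⟩, hyt⟩ := mem_iUnion₂.1 hy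
    obtain ⟨v, hv, hv0⟩ := exists_pos_of_mem_simplexFace hys
    have hvt : v ∈ t := by
      by_contra hvt
      exact hv0.ne' (hyt.2.2 v hvt)
    exact hirr v (ht v hv v hvt)
  have hW₀ : ∀ x ∈ D, ∀ y ∈ F, (x, y) ∈ farPairs far 𝓛 := by
    intro x hx y hy
    obtain ⟨t, ⟨ht𝓛, ht⟩, hyt⟩ := mem_iUnion₂.1 hy
    obtain ⟨v, hv, hxv⟩ := mem_iUnion₂.1 hx
    exact ⟨_, hs𝓛 v hv, t, ht𝓛, fun a ha => ht a (Finset.mem_of_mem_erase ha), hxv, hyt⟩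
  have hW₁ : ∀ x ∈ simplexFace s, ∀ y ∈ F, (x, y) ∈ farPairs far (Insert.insert s 𝓛) := by
    intro x hx y hy
    obtain ⟨t, ⟨ht𝓛, ht⟩, hyt⟩ := mem_iUnion₂.1 hy
    exact ⟨s, Finset.mem_insert_self _ _, t, Finset.mem_insert_of_mem ht𝓛, ht, hx, hyt⟩
  have hW : ∀ x y, (x, y) ∈ farPairs far (Insert.insert s 𝓛) → (x, y) ∈ farPairs far 𝓛 ∨
      (x ∈ simplexFace s ∧ y ∈ F) ∨ (x ∈ F ∧ y ∈ simplexFace s) := by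
    rintro x y ⟨a, ha, b, hb, hab, hx, hy⟩
    rcases Finset.mem_insert.1 ha with rfl | ha'
    · rcases Finset.mem_insert.1 hb with rfl | hb'
      · obtain ⟨v, hv⟩ := hs
        exact (hirr v (hab v hv v hv)).elim
      · exact Or.inr (Or.inl ⟨hx, mem_iUnion₂.2 ⟨b, ⟨hb', hab⟩, hy⟩⟩)
    · rcases Finset.mem_insert.1 hb with rfl | hb'
      · exact Or.inr (Or.inr ⟨mem_iUnion₂.2 ⟨a, ⟨ha', fun v hv w hw => hsymm _ _ (hab w hw v hv)⟩,
          hx⟩, hy⟩)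
      · exact Or.inl ⟨a, ha', b, hb', hab, hx, hy⟩
  have hWL : ∀ x y, (x, y) ∈ farPairs far 𝓛 → x ∈ L ∧ y ∈ L := by
    rintro x y ⟨a, ha, b, hb, -, hx, hy⟩
    exact ⟨mem_iUnion₂.2 ⟨a, ha, hx⟩, mem_iUnion₂.2 ⟨b, hb, hy⟩⟩
  have hcov : IsCoveredBelow (simplexSlices ι) (n + 1) F := by
    classical
    refine ⟨𝓛.image simplexSpan, fun P hP => ?_, fun y hy => ?_⟩
    · obtain ⟨t, ht, rfl⟩ := Finset.mem_image.1 hP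
      exact ⟨simplexSpan_mem_simplexSlices t, finrank_direction_simplexSpan_lt (h𝓛 t ht)⟩
    · obtain ⟨t, ⟨ht𝓛, -⟩, hyt⟩ := mem_iUnion₂.1 hy
      exact ⟨_, Finset.mem_image_of_mem _ ht𝓛, simplexFace_subset_simplexSpan t hyt⟩
  have hfin := finrank_direction_simplexSpan_lt hsn
  set ΨE : (simplexSpan s).direction × (ι → ℝ) × ℝ → V :=
    fun z => Ψ (i z.1, z.2.1, z.2.2) + z.2.2 • (Φ (i z.1, z.2.1) - Ψ (i z.1, z.2.1, 1)) with hΨE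
  have hΨED : ∀ x ∈ D, ∀ y ∈ F, ∀ t, ΨE (π x, y, t) = Ψ (x, y, t) := by
    intro x hx y hy t
    simp only [hΨE, hiπ x (hDs hx), h.one x y (hW₀ x hx y hy), sub_self, smul_zero, add_zero]
  have hdef : IsDeformation f (π '' D) F (fun x => f (i x)) ΨE := by
    refine ⟨by fun_prop, by fun_prop, ?_, ?_⟩
    · rintro _ ⟨x, hx, rfl⟩ y hy
      simp only [hΨED x hx y hy, hiπ x (hDs hx), h.zero x y (hW₀ x hx y hy)]
    · rintro _ ⟨x, hx, rfl⟩ y hy t ht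
      rw [hΨED x hx y hy]
      exact h.ne_zero x y (hW₀ x hx y hy) t ht
  obtain ⟨g', Ψ', hdef', hg', hΨ'A, hΨ'1⟩ := hgen.hasDeformationExtension inf_mem_simplexSlices hfc
    (n + 1) (simplexSpan s).direction (π '' D) (π '' simplexFace s) F _ ΨE (by omega)
    (hsc.image hπ) (hDc.image hπ) (image_mono hDs) hFc hcov hdef (by
      rintro _ ⟨x, hx, rfl⟩ y hy
      simp only [hΨE, hiπ x hx, one_smul, add_sub_cancel]
      exact hΦ0 _ (hW₁ x hx y hy))
  have hg'c := hdef'.continuous_left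
  have hΨ'c := hdef'.continuous
  obtain ⟨f', hf'c, hf'L, hf's⟩ := exists_continuous_glue hLc.isClosed hsc.isClosed
    hfc.continuousOn (v := fun x => g' (π x)) (by fun_prop) (fun x hx hxs => by
      have hxD := hLs x hx hxs
      rw [hg' ⟨x, hxD, rfl⟩]
      simp only [hiπ x hxs])
  have hclosed : ∀ A B : Set (ι → ℝ), IsClosed A → IsClosed B →
      IsClosed {z : (ι → ℝ) × (ι → ℝ) × ℝ | z.1 ∈ A ∧ z.2.1 ∈ B ∧ z.2.2 ∈ Icc (0 : ℝ) 1} :=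
    fun A B hA hB => (hA.preimage continuous_fst).inter ((hB.preimage (by fun_prop)).inter
      (isClosed_Icc.preimage (by fun_prop)))
  have hclosed₀ : IsClosed {z : (ι → ℝ) × (ι → ℝ) × ℝ |
      (z.1, z.2.1) ∈ farPairs far 𝓛 ∧ z.2.2 ∈ Icc (0 : ℝ) 1} :=
    ((isCompact_farPairs far 𝓛).isClosed.preimage (by fun_prop)).inter
      (isClosed_Icc.preimage (by fun_prop))
  obtain ⟨w₁, hw₁c, hw₁0, hw₁1⟩ := exists_continuous_glue hclosed₀
    (hclosed _ _ hsc.isClosed hFc.isClosed) hΨc.continuousOn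
    (v := fun z => Ψ' (π z.1, z.2.1, z.2.2)) (by fun_prop) (by
      rintro ⟨x, y, t⟩ ⟨hxy, -⟩ ⟨hx, hy, ht⟩
      have hxD := hLs x (hWL x y hxy).1 hx
      simp only at hy ht ⊢
      rw [hΨ'A _ ⟨x, hxD, rfl⟩ y hy t ht, hΨED x hxD y hy])
  obtain ⟨w₂, hw₂c, hw₂1, hw₂2⟩ := exists_continuous_glue
    (hclosed₀.union (hclosed _ _ hsc.isClosed hFc.isClosed))
    (hclosed _ _ hFc.isClosed hsc.isClosed) hw₁c.continuousOn
    (v := fun z => -Ψ' (π z.2.1, z.1, z.2.2)) (by fun_prop) (by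
      rintro ⟨x, y, t⟩ hxy ⟨hx, hy, ht⟩
      simp only at hx hy ht
      rcases hxy with ⟨hxy, -⟩ | ⟨hxs, -⟩
      · have hyD := hLs y (hWL x y hxy).2 hy
        have hyx := hW₀ y hyD x hx
        rw [hw₁0 ⟨hxy, ht⟩]
        simp only
        rw [hΨ'A _ ⟨y, hyD, rfl⟩ x hx t ht, hΨED y hyD x hx, h.odd y x hyx t ht]
      · exact (hFs x hx hxs).elim)
  have e₀ : ∀ x y, (x, y) ∈ farPairs far 𝓛 → ∀ t ∈ Icc (0 : ℝ) 1, w₂ (x, y, t) = Ψ (x, y, t) :=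
    fun x y hxy t ht => (hw₂1 (Or.inl ⟨hxy, ht⟩)).trans (hw₁0 ⟨hxy, ht⟩)
  have e₁ : ∀ x ∈ simplexFace s, ∀ y ∈ F, ∀ t ∈ Icc (0 : ℝ) 1,
      w₂ (x, y, t) = Ψ' (π x, y, t) :=
    fun x hx y hy t ht => (hw₂1 (Or.inr ⟨hx, hy, ht⟩)).trans (hw₁1 ⟨hx, hy, ht⟩)
  have e₂ : ∀ x ∈ F, ∀ y ∈ simplexFace s, ∀ t ∈ Icc (0 : ℝ) 1,
      w₂ (x, y, t) = -Ψ' (π y, x, t) := fun x hx y hy t ht => hw₂2 ⟨hx, hy, ht⟩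
  have h0I : (0 : ℝ) ∈ Icc (0 : ℝ) 1 := ⟨le_rfl, zero_le_one⟩
  have h1I : (1 : ℝ) ∈ Icc (0 : ℝ) 1 := ⟨zero_le_one, le_rfl⟩
  have z₁ : ∀ x ∈ simplexFace s, ∀ y ∈ F, Ψ' (π x, y, 0) = f' x - f' y := fun x hx y hy => by
    rw [hdef'.zero _ ⟨x, hx, rfl⟩ y hy, hf's hx, hf'L (hFL hy)]
  have o₁ : ∀ x ∈ simplexFace s, ∀ y ∈ F, Ψ' (π x, y, 1) = Φ (x, y) := fun x hx y hy => by
    rw [hΨ'1 _ ⟨x, hx, rfl⟩ y hy]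
    simp only [hΨE, hiπ x hx, one_smul, add_sub_cancel]
  refine ⟨f', w₂, hf'c, hw₂c, fun x y hxy => ?_, fun x y hxy => ?_, fun x y hxy t ht => ?_,
    fun x y hxy t ht => ?_⟩
  · rcases hW x y hxy with hxy | ⟨hx, hy⟩ | ⟨hx, hy⟩
    · rw [e₀ x y hxy 0 h0I, h.zero x y hxy, hf'L (hWL x y hxy).1, hf'L (hWL x y hxy).2]
    · rw [e₁ x hx y hy 0 h0I, z₁ x hx y hy]
    · rw [e₂ x hx y hy 0 h0I, z₁ y hy x hx, neg_sub]
  · rcases hW x y hxy with hxy | ⟨hx, hy⟩ | ⟨hx, hy⟩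
    · rw [e₀ x y hxy 1 h1I, h.one x y hxy]
    · rw [e₁ x hx y hy 1 h1I, o₁ x hx y hy]
    · rw [e₂ x hx y hy 1 h1I, o₁ y hy x hx, hΦodd y x (hW₁ y hy x hx)]
  · rcases hW x y hxy with hxy | ⟨hx, hy⟩ | ⟨hx, hy⟩
    · rw [e₀ x y hxy t ht]
      exact h.ne_zero x y hxy t ht
    · rw [e₁ x hx y hy t ht]
      exact hdef'.ne_zero _ ⟨x, hx, rfl⟩ y hy t ht
    · rw [e₂ x hx y hy t ht]
      exact neg_ne_zero.2 (hdef'.ne_zero _ ⟨y, hy, rfl⟩ x hx t ht)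
  · rcases hW x y hxy with hxy | ⟨hx, hy⟩ | ⟨hx, hy⟩
    · rw [e₀ x y hxy t ht, e₀ y x (swap_mem_farPairs hsymm hxy) t ht, h.odd x y hxy t ht]
    · rw [e₁ x hx y hy t ht, e₂ y hy x hx t ht]
    · rw [e₂ x hx y hy t ht, e₁ y hy x hx t ht, neg_neg]

/-- Every nowhere zero odd map on the far pairs of a complex of small dimension deforms into
the difference map of some map of the complex. -/
theorem exists_isOddDeformation {far : ι → ι → Prop}
    (hsymm : ∀ v w, far v w → far w v) (hirr : ∀ v, ¬ far v v) {n : ℕ}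
    (hn : 3 * (n + 1) ≤ 2 * Module.finrank ℝ V) {Φ : (ι → ℝ) × (ι → ℝ) → V} (hΦ : Continuous Φ)
    (𝓛 : Finset (Finset ι)) (h𝓛 : ∀ t ∈ 𝓛, t.card ≤ n + 1) (hdown : ∀ t ∈ 𝓛, ∀ s ⊆ t, s ∈ 𝓛)
    (hΦ0 : ∀ z ∈ farPairs far 𝓛, Φ z ≠ 0)
    (hΦodd : ∀ x y, (x, y) ∈ farPairs far 𝓛 → Φ (y, x) = -Φ (x, y)) :
    ∃ f Ψ, IsOddDeformation (farPairs far 𝓛) Φ f Ψ := by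
  classical
  induction 𝓛 using Finset.strongInduction with
  | H 𝓛 ih =>
  have trivial_case : farPairs far 𝓛 = ∅ → ∃ f Ψ, IsOddDeformation (farPairs far 𝓛) Φ f Ψ := by
    intro h
    rw [h]
    exact ⟨0, 0, continuous_zero, continuous_zero, by simp, by simp, by simp, by simp⟩
  rcases 𝓛.eq_empty_or_nonempty with rfl | hne
  · exact trivial_case (by simp [farPairs])
  obtain ⟨s, hs, hsmax⟩ := Finset.exists_max_image 𝓛 Finset.card hne
  rcases s.eq_empty_or_nonempty with rfl | hsne
  · refine trivial_case (eq_empty_of_forall_notMem ?_)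
    rintro z ⟨a, ha, -, -, -, hz, -⟩
    have ha0 : a = ∅ := Finset.card_eq_zero.1 (Nat.le_zero.1 (hsmax a ha))
    obtain ⟨v, hv, -⟩ := exists_pos_of_mem_simplexFace hz
    simp [ha0] at hv
  have hsub := Finset.erase_subset s 𝓛
  have hmax : ∀ t ∈ 𝓛.erase s, ¬ s ⊆ t := fun t ht hst =>
    Finset.ne_of_mem_erase ht (Finset.eq_of_subset_of_card_le hst
      (hsmax t (Finset.mem_of_mem_erase ht))).symm
  obtain ⟨f, Ψ, h⟩ := ih (𝓛.erase s) (Finset.erase_ssubset hs) (fun t ht => h𝓛 t (hsub ht))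
    (fun t ht r hr => Finset.mem_erase.2 ⟨fun hrs => hmax t ht (hrs ▸ hr),
      hdown t (hsub ht) r hr⟩)
    (fun z hz => hΦ0 z (farPairs_mono hsub hz))
    (fun x y hxy => hΦodd x y (farPairs_mono hsub hxy))
  obtain ⟨f, Ψ, h, hgen⟩ := h.exists_isGeneric (by omega) countable_simplexSlices
    (isCompact_farPairs far _)
  rw [← Finset.insert_erase hs] at hΦ0 hΦodd ⊢
  exact h.insert hsymm hirr hn (fun t ht => h𝓛 t (hsub ht)) hsne (h𝓛 s hs)
    (fun v hv => Finset.mem_erase.2 ⟨fun hv' => Finset.notMem_erase v s (hv'.symm ▸ hv),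
      hdown s hs _ (s.erase_subset v)⟩) hmax hΦ hΦ0 hΦodd hgen

end Induction

section QuasiEmbedding
open Set

/-- Barycentric coordinates of a map to the nerve of a fine finite cover of small order. -/
theorem CoveringDimLE.exists_nerve_map {X : Type} [MetricSpace X] [CompactSpace X] {n : ℕ}
    (hX : CoveringDimLE X n) {r : ℝ} (hr : 0 < r) :
    ∃ (ι : Type) (_ : Fintype ι) (U : ι → Set X) (φ : X → ι → ℝ), Continuous φ ∧
      (∀ x v, 0 ≤ φ x v) ∧ (∀ x, ∑ v, φ x v = 1) ∧ (∀ x v, φ x v ≠ 0 → x ∈ U v) ∧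
      (∀ v, (U v).Nonempty) ∧ (∀ v, ∀ x ∈ U v, ∀ y ∈ U v, dist x y ≤ r) ∧
      ∀ (s : Finset ι) (x : X), (∀ v ∈ s, x ∈ U v) → s.card ≤ n + 1 := by
  obtain ⟨𝒱, h𝒱o, h𝒱U, h𝒱r, h𝒱n⟩ := hX (range fun x : X => ball x (r / 2))
    (by rintro _ ⟨x, rfl⟩; exact isOpen_ball)
    (eq_univ_of_forall fun x => ⟨_, ⟨x, rfl⟩, mem_ball_self (half_pos hr)⟩)
  obtain ⟨T, hT⟩ := isCompact_univ.elim_finite_subcover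
    (fun v : {v : Set X // v ∈ 𝒱 ∧ v.Nonempty} => v.1) (fun v => h𝒱o v.1 v.2.1) (by
      intro x hx
      rw [← h𝒱U] at hx
      obtain ⟨v, hv, hxv⟩ := hx
      exact mem_iUnion.2 ⟨⟨v, hv, x, hxv⟩, hxv⟩)
  obtain ⟨ρ, hρ⟩ := PartitionOfUnity.exists_isSubordinate isClosed_univ (fun v : T => v.1.1)
    (fun v => h𝒱o v.1.1 v.1.2.1) (by
      intro x hx
      obtain ⟨v, hv, hxv⟩ := mem_iUnion₂.1 (hT hx)
      exact mem_iUnion.2 ⟨⟨v, hv⟩, hxv⟩)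
  refine ⟨T, inferInstance, fun v => v.1.1, fun x v => ρ v x,
    continuous_pi fun v => (ρ v).continuous, fun x v => ρ.nonneg v x, fun x => ?_,
    fun x v hv => hρ v (subset_tsupport _ hv), fun v => v.1.2.2, fun v x hx y hy => ?_,
    fun s x hs => ?_⟩
  · rw [← finsum_eq_sum_of_fintype]
    exact ρ.sum_eq_one (mem_univ x)
  · obtain ⟨_, ⟨z, rfl⟩, hz⟩ := h𝒱r v.1.1 v.1.2.1
    have h1 := mem_ball.1 (hz hx)
    have h2 := mem_ball'.1 (hz hy)
    linarith [dist_triangle x z y]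
  · have h1 := ncard_le_ncard (s := (fun v : T => v.1.1) '' s) (t := {v ∈ 𝒱 | x ∈ v})
      (by
        rintro _ ⟨v, hv, rfl⟩
        exact ⟨v.1.2.1, hs v hv⟩) (h𝒱n x).1
    rw [ncard_image_of_injective _ fun v w h => Subtype.ext (Subtype.ext h),
      ncard_coe_finset] at h1
    exact h1.trans (h𝒱n x).2

/-- An odd map on the pairs of points at distance at least `θ` produces a map separating the points
of such pairs up to a small error. -/
theorem exists_continuous_dist_le_of_eq {X : Type} [MetricSpace X] [CompactSpace X] {n : ℕ}
    (hX : CoveringDimLE X n) {V : Type*} [NormedAddCommGroup V] [NormedSpace ℝ V]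
    [FiniteDimensional ℝ V] (hn : 3 * (n + 1) ≤ 2 * Module.finrank ℝ V) {θ δ r : ℝ} (hθ : 0 < θ)
    (hr : 0 < r) (hrδ : 2 * r < δ) {g : X × X → V}
    (hg1 : ∀ x y, θ ≤ dist x y → ‖g (x, y)‖ = 1)
    (hgodd : ∀ x y, θ ≤ dist x y → g (y, x) = -g (x, y))
    (hgδ : ∀ x y x' y', θ ≤ dist x y → θ ≤ dist x' y' → dist x x' < δ → dist y y' < δ →
      ‖g (x, y) - g (x', y')‖ ≤ 1 / 2) :
    ∃ f : X → V, Continuous f ∧ ∀ x y, f x = f y → dist x y ≤ θ + 2 * r := by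
  classical
  obtain ⟨ι, _, U, φ, hφc, hφ0, hφ1, hφU, hUne, hUr, hUn⟩ := hX.exists_nerve_map hr
  choose c hc using hUne
  set far : ι → ι → Prop := fun v w => θ ≤ dist (c v) (c w) with hfar
  have hsymm : ∀ v w, far v w → far w v := fun v w h => by
    simp only [hfar, dist_comm (c w)]
    exact h
  set 𝓛 : Finset (Finset ι) := Finset.univ.filter fun s => ∃ x, ∀ v ∈ s, x ∈ U v with h𝓛
  set G : ι → ι → V := fun v w => if far v w then g (c v, c w) else 0 with hG
  have hGodd : ∀ v w, G w v = -G v w := fun v w => by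
    by_cases h : far v w
    · simp only [hG, h, hsymm v w h, if_true, hgodd _ _ h]
    · have h' : ¬ far w v := fun h' => h (hsymm w v h')
      simp [hG, h, h']
  set Φ : (ι → ℝ) × (ι → ℝ) → V := fun z => ∑ v, ∑ w, (z.1 v * z.2 w) • G v w with hΦ
  have hcdist : ∀ s ∈ 𝓛, ∀ v ∈ s, ∀ w ∈ s, dist (c v) (c w) < δ := by
    intro s hs v hv w hw
    obtain ⟨x, hx⟩ := (Finset.mem_filter.1 hs).2
    linarith [dist_triangle (c v) x (c w), hUr v _ (hc v) x (hx v hv),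
      hUr w x (hx w hw) _ (hc w)]
  obtain ⟨f, Ψ, h⟩ := exists_isOddDeformation (far := far) hsymm
    (fun v h => by simp only [hfar, dist_self] at h; linarith) hn (Φ := Φ) (by fun_prop) 𝓛
    (fun t ht => by
      obtain ⟨x, hx⟩ := (Finset.mem_filter.1 ht).2
      exact hUn t x hx)
    (fun t ht s hst => by
      obtain ⟨x, hx⟩ := (Finset.mem_filter.1 ht).2
      exact Finset.mem_filter.2 ⟨Finset.mem_univ _, x, fun v hv => hx v (hst hv)⟩)
    (by
      rintro ⟨p, q⟩ ⟨s, hs, t, ht, hst, hp, hq⟩ h0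
      obtain ⟨v₀, hv₀, -⟩ := exists_pos_of_mem_simplexFace hp
      obtain ⟨w₀, hw₀, -⟩ := exists_pos_of_mem_simplexFace hq
      set u := g (c v₀, c w₀)
      have hu : ‖u‖ = 1 := hg1 _ _ (hst v₀ hv₀ w₀ hw₀)
      have hsum : ∑ v, ∑ w, p v * q w = 1 := by
        rw [← Finset.sum_mul_sum, hp.2.1, hq.2.1, one_mul]
      have h1 : u - Φ (p, q) = ∑ v, ∑ w, (p v * q w) • (u - G v w) := by
        simp only [hΦ, smul_sub, Finset.sum_sub_distrib, ← Finset.sum_smul]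
        rw [hsum, one_smul]
      have h2 : ‖u - Φ (p, q)‖ ≤ ∑ v, ∑ w, p v * q w * (1 / 2) := by
        rw [h1]
        refine norm_sum_le_of_le _ fun v _ => norm_sum_le_of_le _ fun w _ => ?_
        by_cases hv : v ∈ s
        · by_cases hw : w ∈ t
          · have hvw := hst v hv w hw
            rw [norm_smul, Real.norm_of_nonneg (mul_nonneg (hp.1 v) (hq.1 w))]
            refine mul_le_mul_of_nonneg_left ?_ (mul_nonneg (hp.1 v) (hq.1 w))
            simp only [hG, hvw, if_true]
            exact hgδ _ _ _ _ (hst v₀ hv₀ w₀ hw₀) hvw (hcdist s hs v₀ hv₀ v hv)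
              (hcdist t ht w₀ hw₀ w hw)
          · have hw0 : q w = 0 := hq.2.2 w hw
            simp [hw0]
        · have hv0 : p v = 0 := hp.2.2 v hv
          simp [hv0]
      simp only [← Finset.sum_mul] at h2
      rw [hsum, h0, sub_zero, hu] at h2
      norm_num at h2)
    (fun p q _ => by
      simp only [hΦ]
      rw [Finset.sum_comm, ← Finset.sum_neg_distrib]
      refine Finset.sum_congr rfl fun v _ => ?_
      rw [← Finset.sum_neg_distrib]
      refine Finset.sum_congr rfl fun w _ => ?_
      rw [hGodd v w, smul_neg, mul_comm])
  have hsupp : ∀ x, Finset.univ.filter (fun v => φ x v ≠ 0) ∈ 𝓛 ∧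
      φ x ∈ simplexFace (Finset.univ.filter fun v => φ x v ≠ 0) := fun x =>
    ⟨Finset.mem_filter.2 ⟨Finset.mem_univ _, x, fun v hv => hφU x v (Finset.mem_filter.1 hv).2⟩,
      hφ0 x, hφ1 x, fun v hv => by simpa using hv⟩
  refine ⟨fun x => f (φ x), h.continuous_left.comp hφc, fun x y hxy => ?_⟩
  by_contra! hlt
  have hmem : (φ x, φ y) ∈ farPairs far 𝓛 := by
    refine ⟨_, (hsupp x).1, _, (hsupp y).1, fun v hv w hw => ?_, (hsupp x).2, (hsupp y).2⟩
    have h1 := hUr v x (hφU x v (Finset.mem_filter.1 hv).2) _ (hc v)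
    have h2 := hUr w _ (hc w) y (hφU y w (Finset.mem_filter.1 hw).2)
    have h3 := dist_triangle4 x (c v) (c w) y
    simp only [hfar]
    linarith
  refine h.ne_zero _ _ hmem 0 ⟨le_rfl, zero_le_one⟩ ?_
  rw [h.zero _ _ hmem, sub_eq_zero]
  exact hxy

end QuasiEmbedding

/-- Theorem 4.2(b) with Lemma 4.1: for `2m ≥ 3(n+1)`, an `n`-dimensional compactum
quasi-embeds in `ℝ^m` iff every compact swap-invariant subset of the deleted product
admits an equivariant map to `S^{m-1}`. -/
theorem stmt2 (n m : ℕ) (hm : 2 * m ≥ 3 * (n + 1))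
    (X : Type) [MetricSpace X] [CompactSpace X] (hdim : CoveringDimLE X n) :
    (∀ ε : ℝ, 0 < ε → ∃ f : X → EuclideanSpace ℝ (Fin m),
      Continuous f ∧ ∀ z, Metric.diam (f ⁻¹' {z}) < ε) ↔
    (∀ K : Set (X × X), IsCompact K → (∀ p ∈ K, p.1 ≠ p.2) →
      ∀ hswap : (∀ p ∈ K, (p.2, p.1) ∈ K),
      ∃ f : K → EuclideanSpace ℝ (Fin m),
        Continuous f ∧ (∀ p, ‖f p‖ = 1) ∧
        ∀ (p : X × X) (hp : p ∈ K), f ⟨(p.2, p.1), hswap p hp⟩ = - f ⟨p, hp⟩) := by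
  constructor
  · intro h K hK hKne hswap
    obtain ⟨ε, hε, hεK⟩ := hK.exists_pos_lt_norm (u := fun p : X × X => dist p.1 p.2)
      (by fun_prop) (fun p hp => dist_ne_zero.2 (hKne p hp))
    obtain ⟨f, hf, hfε⟩ := h ε hε
    have hne : ∀ p ∈ K, f p.1 - f p.2 ≠ 0 := by
      intro p hp h0
      have h1 := dist_le_diam_of_mem (s := f ⁻¹' {f p.1}) (x := p.1) (y := p.2)
        isBounded_of_compactSpace rfl (sub_eq_zero.1 h0).symm
      have h2 := hεK p hp
      rw [Real.norm_of_nonneg dist_nonneg] at h2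
      linarith [hfε (f p.1)]
    refine ⟨fun p => ‖f p.1.1 - f p.1.2‖⁻¹ • (f p.1.1 - f p.1.2), ?_, fun p => ?_, fun p hp => ?_⟩
    · have hfc : Continuous fun p : K => f p.1.1 - f p.1.2 := by fun_prop
      exact (hfc.norm.inv₀ fun p => norm_ne_zero_iff.2 (hne p.1 p.2)).smul hfc
    · exact norm_smul_inv_norm (𝕜 := ℝ) (hne p.1 p.2)
    · simp only
      rw [← smul_neg, neg_sub, norm_sub_rev]
  · intro h ε hε
    have hK : IsCompact {p : X × X | ε / 4 ≤ dist p.1 p.2} :=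
      (isClosed_le continuous_const continuous_dist).isCompact
    obtain ⟨g, hgc, hg1, hgodd⟩ := h _ hK (fun p hp h0 => by
      have : ε / 4 ≤ dist p.1 p.2 := hp
      rw [h0, dist_self] at this
      linarith) (fun p hp => by
      have : ε / 4 ≤ dist p.1 p.2 := hp
      rwa [dist_comm] at this)
    have : CompactSpace {p : X × X | ε / 4 ≤ dist p.1 p.2} := isCompact_iff_compactSpace.1 hK
    obtain ⟨δ, hδ, hgδ⟩ := Metric.uniformContinuous_iff.1
      (CompactSpace.uniformContinuous_of_continuous hgc) (1 / 2) (by norm_num)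
    classical
    set g' : X × X → EuclideanSpace ℝ (Fin m) := fun p =>
      if hp : ε / 4 ≤ dist p.1 p.2 then g ⟨p, hp⟩ else 0 with hg'
    have hg'g : ∀ x y (hxy : ε / 4 ≤ dist x y), g' (x, y) = g ⟨(x, y), hxy⟩ := fun x y hxy => by
      simp [hg', hxy]
    obtain ⟨f, hf, hfε⟩ := exists_continuous_dist_le_of_eq hdim
      (V := EuclideanSpace ℝ (Fin m)) (by simpa using hm) (θ := ε / 4) (δ := δ)
      (r := min (ε / 8) (δ / 4)) (by positivity) (by positivity)
      (by linarith [min_le_right (ε / 8) (δ / 4)]) (g := g')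
      (fun x y hxy => by rw [hg'g x y hxy, hg1])
      (fun x y hxy => by
        have hyx : ε / 4 ≤ dist y x := by rwa [dist_comm]
        rw [hg'g x y hxy, hg'g y x hyx]
        exact hgodd (x, y) hxy)
      (fun x y x' y' hxy hxy' hx hy => by
        rw [hg'g x y hxy, hg'g x' y' hxy', ← dist_eq_norm]
        exact (hgδ (max_lt hx hy)).le)
    refine ⟨f, hf, fun z => lt_of_le_of_lt (diam_le_of_forall_dist_le (C := ε / 2) (by positivity)
      fun x hx y hy => ?_) (half_lt_self hε)⟩
    have := hfε x y (hx.trans hy.symm)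
    linarith [min_le_left (ε / 8) (δ / 4)]
end

section
/- A compact metric space X admits a topological embedding into ℝ^m if and only if there exist a sequence of continuous maps f_i : X → ℝ^m (i = 1, 2, …), where each f_i is a (1/i)-map, and a sequence of pseudo-isotopies H^i of ℝ^m such that H^i takes f_{i+1} onto f_i, i.e., H^i_1 ∘ f_{i+1} = f_i for every i. -/
open Topology Metric unitInterval

/-- A pseudo-isotopy of `ℝ^m`: a continuous map `H : ℝ^m × [0,1] → ℝ^m` such that
`H(·,0)` is the identity and `H(·,t)` is a homeomorphism for every `t < 1`. -/
def IsPseudoIsotopy {m : ℕ}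
    (H : EuclideanSpace ℝ (Fin m) × unitInterval → EuclideanSpace ℝ (Fin m)) : Prop :=
  Continuous H ∧ (∀ x, H (x, 0) = x) ∧
    ∀ t : unitInterval, (t : ℝ) < 1 → IsHomeomorph (fun x => H (x, t))

/-- Maps whose point-inverses have all their pairs of points at distance less than `ε` form an
open set of the space of continuous maps on a compactum. -/
theorem isOpen_setOf_fiber_dist_lt {X E : Type*} [MetricSpace X] [CompactSpace X]
    [MetricSpace E] (ε : ℝ) :
    IsOpen {F : C(X, E) | ∀ x y, F x = F y → dist x y < ε} := by
  have hclosed : IsClosed {p : C(X, E) × (X × X) | p.1 p.2.1 = p.1 p.2.2 ∧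
      ε ≤ dist p.2.1 p.2.2} := by
    refine IsClosed.inter (s₁ := {p : C(X, E) × (X × X) | p.1 p.2.1 = p.1 p.2.2})
      (s₂ := {p : C(X, E) × (X × X) | ε ≤ dist p.2.1 p.2.2}) ?_ ?_
    · exact isClosed_eq (by fun_prop) (by fun_prop)
    · exact isClosed_le (by fun_prop) (by fun_prop)
  have hproj := isClosedMap_fst_of_compactSpace _ hclosed
  rw [← isOpen_compl_iff] at hproj
  convert hproj using 1
  ext F
  simp

/-- The compositions of a map `f : X → E` with the continuous injective self-maps of `E`. -/
def injectiveCompositions {X E : Type*} [TopologicalSpace X] [TopologicalSpace E] (f : X → E) :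
    Set C(X, E) :=
  {F | ∃ φ : E → E, Continuous φ ∧ Function.Injective φ ∧ ∀ x, F x = φ (f x)}

/-- If a pseudo-isotopy takes `g` onto `f`, then every injective composition of `f` is a uniform
limit of injective compositions of `g`. -/
theorem IsPseudoIsotopy.injectiveCompositions_subset_closure {m : ℕ} {X : Type*}
    [TopologicalSpace X]
    {H : EuclideanSpace ℝ (Fin m) × unitInterval → EuclideanSpace ℝ (Fin m)}
    (hH : IsPseudoIsotopy H) {f g : X → EuclideanSpace ℝ (Fin m)} (hg : Continuous g)
    (hfg : ∀ x, H (g x, 1) = f x) :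
    injectiveCompositions f ⊆ closure (injectiveCompositions g) := by
  rintro F ⟨φ, hφ, hφi, hF⟩
  obtain ⟨hHc, -, hHh⟩ := hH
  let G : C(unitInterval × X, EuclideanSpace ℝ (Fin m)) :=
    ⟨fun p => φ (H (g p.2, p.1)), by fun_prop⟩
  have hF1 : F = G.curry 1 := by
    ext1 x
    simp [G, hF, hfg]
  have h1 : (1 : unitInterval) ∈ closure (Set.Iio 1) := by
    rw [closure_Iio' ⟨0, zero_lt_one⟩]
    exact Set.mem_Iic.2 le_rfl
  rw [hF1]
  refine map_mem_closure G.curry.continuous h1 fun t ht => ?_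
  have ht' := hHh t (by exact_mod_cast ht)
  exact ⟨fun z => φ (H (z, t)), hφ.comp ht'.continuous, hφi.comp ht'.injective, fun x => rfl⟩

/-- Criterion 3.2: a compactum `X` embeds in `ℝ^m` iff there exist `(1/i)`-maps
`f_i : X → ℝ^m` and pseudo-isotopies `H^i` of `ℝ^m` taking `f_{i+1}` onto `f_i`. -/
theorem stmt5 (m : ℕ) (X : Type) [MetricSpace X] [CompactSpace X] :
    (∃ g : X → EuclideanSpace ℝ (Fin m), IsEmbedding g) ↔
    (∃ (f : ℕ → X → EuclideanSpace ℝ (Fin m))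
       (H : ℕ → EuclideanSpace ℝ (Fin m) × unitInterval → EuclideanSpace ℝ (Fin m)),
      (∀ i : ℕ, 1 ≤ i → Continuous (f i) ∧
        ∀ z, Metric.diam (f i ⁻¹' {z}) < 1 / (i : ℝ)) ∧
      (∀ i : ℕ, 1 ≤ i → IsPseudoIsotopy (H i)) ∧
      (∀ i : ℕ, 1 ≤ i → ∀ x, H i (f (i + 1) x, 1) = f i x)) := by
  constructor
  · rintro ⟨g, hg⟩
    refine ⟨fun _ => g, fun _ p => p.1, fun i hi => ⟨hg.continuous, fun z => ?_⟩,
      fun i hi => ⟨continuous_fst, fun x => rfl, fun t ht => (Homeomorph.refl _).isHomeomorph⟩,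
      fun i hi x => rfl⟩
    rw [Metric.diam_subsingleton (Set.subsingleton_singleton.preimage hg.injective)]
    positivity
  · rintro ⟨f, H, hf, hH, hfH⟩
    let S : ℕ → Set C(X, EuclideanSpace ℝ (Fin m)) := fun k => injectiveCompositions (f k)
    let U : ℕ → Set C(X, EuclideanSpace ℝ (Fin m)) :=
      fun n => {F | ∀ x y, F x = F y → dist x y < 1 / ((n : ℝ) + 1)}
    let A := closure (⋃ k, S (k + 1))
    have hSU : ∀ n k, n ≤ k → S (k + 1) ⊆ U n := by
      rintro n k hnk F ⟨φ, -, hφ, hF⟩ x y hxy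
      rw [hF, hF] at hxy
      have hle : dist x y ≤ Metric.diam (f (k + 1) ⁻¹' {f (k + 1) y}) :=
        Metric.dist_le_diam_of_mem (Metric.isBounded_of_compactSpace) (hφ hxy) rfl
      refine (hle.trans_lt ((hf (k + 1) (by lia)).2 _)).trans_le ?_
      push_cast
      gcongr
    have hstep : ∀ k j, S (k + 1) ⊆ closure (S (k + j + 1)) := by
      intro k j
      induction j with
      | zero => exact subset_closure
      | succ j ih =>
        exact ih.trans (closure_minimal ((hH (k + j + 1)
          (by lia)).injectiveCompositions_subset_closure (hf _ (by lia)).1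
          (hfH _ (by lia))) isClosed_closure)
    have hA : IsClosed A := isClosed_closure
    have : CompleteSpace A := hA.completeSpace_coe
    have hdense : Dense (⋂ n, ((↑) : A → C(X, EuclideanSpace ℝ (Fin m))) ⁻¹' U n) := by
      refine dense_iInter_of_isOpen
        (fun n => (isOpen_setOf_fiber_dist_lt _).preimage continuous_subtype_val) fun n => ?_
      rw [Subtype.dense_iff]
      refine closure_minimal (Set.iUnion_subset fun k => (hstep k n).trans ?_) isClosed_closure
      refine closure_mono fun F hF => ?_
      exact ⟨⟨F, subset_closure (Set.mem_iUnion.2 ⟨k + n, hF⟩)⟩, hSU n (k + n) (by lia) hF, rfl⟩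
    have : Nonempty A := ⟨⟨⟨f 1, (hf 1 le_rfl).1⟩, subset_closure (Set.mem_iUnion.2
      ⟨0, id, continuous_id, Function.injective_id, fun x => rfl⟩)⟩⟩
    obtain ⟨F, hF⟩ := hdense.nonempty
    refine ⟨F.1, (F.1.continuous.isClosedEmbedding fun x y hxy => ?_).isEmbedding⟩
    by_contra hne
    obtain ⟨n, hn⟩ := exists_nat_one_div_lt (dist_pos.2 hne)
    exact lt_asymm hn (Set.mem_iInter.1 hF n x y hxy)
end

section
/- Let n ≥ 1. Let Δ^{2n} ⊆ ℝ^{2n+1} be the standard 2n-simplex (the convex hull of the standard basis vectors e_1,…,e_{2n+1}), let K = {x ∈ Δ^{2n} : at most n coordinates of x are nonzero} be its (n−1)-skeleton, and let T ⊆ ℝ^{2n+2} be the cone over K, namely T = {((1−t)·x, t) : x ∈ K, t ∈ [0,1]}. Let ℕ* denote the one-point compactification of the discrete space ℕ. Then the compact space T × ℕ* admits no topological embedding into ℝ^{2n}. (For n = 1, T is the triod and T × ℕ* does not embed in the plane.) -/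
open Topology Metric

/-- The `(n-1)`-skeleton of the standard `2n`-simplex: points of the simplex with at most
`n` nonzero coordinates. -/
def simplexSkeleton (n : ℕ) : Set (Fin (2 * n + 1) → ℝ) :=
  {x | x ∈ stdSimplex ℝ (Fin (2 * n + 1)) ∧ {i | x i ≠ 0}.ncard ≤ n}

/-- The cone `T ⊆ ℝ^{2n+2}` over the `(n-1)`-skeleton of the standard `2n`-simplex. -/
def coneOverSkeleton (n : ℕ) : Set ((Fin (2 * n + 1) → ℝ) × ℝ) :=
  {p | ∃ x ∈ simplexSkeleton n, ∃ t ∈ Set.Icc (0 : ℝ) 1, p = ((1 - t) • x, t)}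

/-- Mod 2 chains of ordered tuples. The empty tuple is allowed, so the complex is augmented. -/
abbrev TupleChain (E : Type*) := List E →₀ ZMod 2

namespace TupleChain

variable {E : Type*}

/-- The operator that prepends the vertex `a` to every tuple. -/
noncomputable def cone (a : E) : TupleChain E →ₗ[ZMod 2] TupleChain E :=
  Finsupp.lmapDomain (ZMod 2) (ZMod 2) (List.cons a)

/-- The operator induced by a map of vertices. -/
noncomputable def push (φ : E → E) : TupleChain E →ₗ[ZMod 2] TupleChain E :=
  Finsupp.lmapDomain (ZMod 2) (ZMod 2) (List.map φ)

/-- The boundary of a single tuple. -/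
noncomputable def tupleBoundary : List E → TupleChain E
  | [] => 0
  | a :: l => Finsupp.single l 1 + cone a (tupleBoundary l)

/-- The boundary operator. -/
noncomputable def boundary : TupleChain E →ₗ[ZMod 2] TupleChain E :=
  Finsupp.linearCombination (ZMod 2) tupleBoundary

/-- The prism over a single tuple, running from `φ` to `ψ`. -/
noncomputable def tuplePrism (φ ψ : E → E) : List E → TupleChain E
  | [] => 0
  | a :: l => Finsupp.single (φ a :: ψ a :: l.map ψ) 1 + cone (φ a) (tuplePrism φ ψ l)

/-- The prism operator from `φ` to `ψ`. -/
noncomputable def prism (φ ψ : E → E) : TupleChain E →ₗ[ZMod 2] TupleChain E :=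
  Finsupp.linearCombination (ZMod 2) (tuplePrism φ ψ)

@[simp] lemma cone_single (a : E) (l : List E) (c : ZMod 2) :
    cone a (Finsupp.single l c) = Finsupp.single (a :: l) c := by
  simp [cone, Finsupp.lmapDomain_apply]

@[simp] lemma push_single (φ : E → E) (l : List E) (c : ZMod 2) :
    push φ (Finsupp.single l c) = Finsupp.single (l.map φ) c := by
  simp [push, Finsupp.lmapDomain_apply]

@[simp] lemma boundary_single (l : List E) :
    boundary (Finsupp.single l 1) = tupleBoundary l := by
  simp [boundary, Finsupp.linearCombination_single]

@[simp] lemma prism_single (φ ψ : E → E) (l : List E) :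
    prism φ ψ (Finsupp.single l 1) = tuplePrism φ ψ l := by
  simp [prism, Finsupp.linearCombination_single]

lemma add_self_chain (z : TupleChain E) : z + z = 0 := by
  ext l
  simpa using CharTwo.add_self_eq_zero (z l)

lemma ext_single {M : Type*} [AddCommMonoid M] [Module (ZMod 2) M]
    {f g : TupleChain E →ₗ[ZMod 2] M}
    (h : ∀ l, f (Finsupp.single l 1) = g (Finsupp.single l 1)) : f = g := by
  refine Finsupp.lhom_ext fun l c => ?_
  have : Finsupp.single l c = c • (Finsupp.single l 1 : TupleChain E) := by simp
  rw [this, map_smul, map_smul, h]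

lemma boundary_cone (a : E) (z : TupleChain E) :
    boundary (cone a z) = z + cone a (boundary z) := by
  have : (boundary ∘ₗ cone a : TupleChain E →ₗ[ZMod 2] TupleChain E) =
      LinearMap.id + cone a ∘ₗ boundary :=
    ext_single fun l => by simp [tupleBoundary]
  exact LinearMap.congr_fun this z

lemma push_cone (φ : E → E) (a : E) (z : TupleChain E) :
    push φ (cone a z) = cone (φ a) (push φ z) := by
  have : push φ ∘ₗ cone a = cone (φ a) ∘ₗ push φ := ext_single fun l => by simp
  exact LinearMap.congr_fun this z

lemma push_tupleBoundary (φ : E → E) (l : List E) :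
    push φ (tupleBoundary l) = tupleBoundary (l.map φ) := by
  induction l with
  | nil => simp [tupleBoundary]
  | cons a l ih => simp [tupleBoundary, push_cone, ih]

lemma push_boundary (φ : E → E) (z : TupleChain E) :
    push φ (boundary z) = boundary (push φ z) := by
  have : push φ ∘ₗ boundary = boundary ∘ₗ push φ :=
    ext_single fun l => by simp [push_tupleBoundary]
  exact LinearMap.congr_fun this z

lemma prism_cone (φ ψ : E → E) (a : E) (z : TupleChain E) :
    prism φ ψ (cone a z) =
      cone (φ a) (cone (ψ a) (push ψ z)) + cone (φ a) (prism φ ψ z) := by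
  have : prism φ ψ ∘ₗ cone a =
      cone (φ a) ∘ₗ cone (ψ a) ∘ₗ push ψ + cone (φ a) ∘ₗ prism φ ψ :=
    ext_single fun l => by simp [tuplePrism]
  exact LinearMap.congr_fun this z

lemma boundary_tuplePrism (φ ψ : E → E) (l : List E) :
    boundary (tuplePrism φ ψ l) + prism φ ψ (tupleBoundary l) =
      Finsupp.single (l.map φ) 1 + Finsupp.single (l.map ψ) 1 := by
  induction l with
  | nil => simp [tuplePrism, tupleBoundary, add_self_chain]
  | cons a l ih =>
    have key := congrArg (cone (φ a)) ih
    simp only [map_add, cone_single] at key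
    have h1 := add_self_chain (tuplePrism φ ψ l)
    have h2 := add_self_chain (cone (φ a) (cone (ψ a) (tupleBoundary (l.map ψ))))
    have h3 := add_self_chain (Finsupp.single (φ a :: l.map ψ) 1 : TupleChain E)
    simp only [tuplePrism, tupleBoundary, map_add, boundary_single, boundary_cone, prism_single,
      prism_cone, push_tupleBoundary, List.map_cons, cone_single]
    generalize cone (φ a) (cone (ψ a) (tupleBoundary (l.map ψ))) = x1 at *
    generalize tuplePrism φ ψ l = x2 at *
    generalize cone (φ a) (boundary x2) = x3 at *
    generalize cone (φ a) (prism φ ψ (tupleBoundary l)) = x4 at *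
    generalize (Finsupp.single (φ a :: l.map ψ) 1 : TupleChain E) = x5 at *
    generalize (Finsupp.single (φ a :: l.map φ) 1 : TupleChain E) = x6 at *
    generalize (Finsupp.single (ψ a :: l.map ψ) 1 : TupleChain E) = x7 at *
    calc _ = (x3 + x4) + (x1 + x1) + (x2 + x2) + x5 + x7 := by abel
      _ = x6 + (x5 + x5) + x7 := by rw [key, h1, h2]; abel
      _ = _ := by rw [h3]; abel

lemma boundary_prism (φ ψ : E → E) {z : TupleChain E} (hz : boundary z = 0) :
    boundary (prism φ ψ z) = push φ z + push ψ z := by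
  have : boundary ∘ₗ prism φ ψ + prism φ ψ ∘ₗ boundary = push φ + push ψ :=
    ext_single fun l => by simp [boundary_tuplePrism]
  simpa [hz] using LinearMap.congr_fun this z

lemma boundary_sum_prism (φ : ℕ → E → E) {z : TupleChain E} (hz : boundary z = 0) (N : ℕ) :
    boundary (∑ i ∈ Finset.range N, prism (φ i) (φ (i + 1)) z) =
      push (φ 0) z + push (φ N) z := by
  induction N with
  | zero => simp [add_self_chain]
  | succ N ih =>
    rw [Finset.sum_range_succ, map_add, ih, boundary_prism _ _ hz]
    calc _ = push (φ 0) z + push (φ (N + 1)) z + (push (φ N) z + push (φ N) z) := by abel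
      _ = _ := by rw [add_self_chain, add_zero]

/-- The chains all of whose tuples satisfy `Q`. -/
abbrev carried (Q : List E → Prop) : Submodule (ZMod 2) (TupleChain E) :=
  Finsupp.supported (ZMod 2) (ZMod 2) {l | Q l}

lemma single_mem_carried {Q : List E → Prop} {l : List E} (h : Q l) :
    Finsupp.single l 1 ∈ carried Q :=
  Finsupp.single_mem_supported _ _ h

lemma map_mem_of_mem_carried {M : Type*} [AddCommGroup M] [Module (ZMod 2) M]
    {Q : List E → Prop} {S : Submodule (ZMod 2) M} (f : TupleChain E →ₗ[ZMod 2] M)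
    (h : ∀ l, Q l → f (Finsupp.single l 1) ∈ S) {z : TupleChain E} (hz : z ∈ carried Q) :
    f z ∈ S := by
  rw [carried, Finsupp.supported_eq_span_single] at hz
  have : Submodule.span (ZMod 2) ((fun l => (Finsupp.single l 1 : TupleChain E)) '' {l | Q l}) ≤
      S.comap f := by
    rw [Submodule.span_le]
    rintro _ ⟨l, hl, rfl⟩
    exact h l hl
  exact this hz

lemma tuplePrism_mem_carried (φ ψ : E → E) (l : List E) :
    tuplePrism φ ψ l ∈ carried fun l' => l'.length = l.length + 1 ∧
      ∀ x ∈ l', ∃ y ∈ l, x = φ y ∨ x = ψ y := by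
  induction l with
  | nil => exact Submodule.zero_mem _
  | cons a l ih =>
    refine Submodule.add_mem _ (single_mem_carried ⟨by simp, ?_⟩)
      (map_mem_of_mem_carried _ (fun l' hl' => ?_) ih)
    · intro x hx
      simp only [List.mem_cons, List.mem_map] at hx
      rcases hx with rfl | rfl | ⟨y, hy, rfl⟩
      · exact ⟨a, by simp, Or.inl rfl⟩
      · exact ⟨a, by simp, Or.inr rfl⟩
      · exact ⟨y, by simp [hy], Or.inr rfl⟩
    · rw [cone_single]
      refine single_mem_carried ⟨by simp [hl'.1], fun x hx => ?_⟩
      rcases List.mem_cons.1 hx with rfl | hx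
      · exact ⟨a, by simp, Or.inl rfl⟩
      · obtain ⟨y, hy, h⟩ := hl'.2 x hx
        exact ⟨y, by simp [hy], h⟩

/-- A tuple of `k` points of `A` with pairwise distances at most `ε`. -/
def IsSmall [PseudoMetricSpace E] (A : Set E) (k : ℕ) (ε : ℝ) (l : List E) : Prop :=
  l.length = k ∧ (∀ x ∈ l, x ∈ A) ∧ ∀ x ∈ l, ∀ y ∈ l, dist x y ≤ ε

lemma exists_boundary_eq [NormedAddCommGroup E] [NormedSpace ℝ E] {A A' : Set E} {p : E}
    {k : ℕ} {ε D : ℝ} (hε : 0 < ε) (hp : p ∈ A')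
    (hA : ∀ x ∈ A, ∀ t ∈ Set.Icc (0 : ℝ) 1, x + t • (p - x) ∈ A')
    (hD : ∀ x ∈ A, ‖p - x‖ ≤ D) {z : TupleChain E} (hz : boundary z = 0)
    (hzA : z ∈ carried (IsSmall A k (ε / 2))) :
    ∃ h ∈ carried (IsSmall A' (k + 1) ε), boundary h = z := by
  obtain ⟨N, hN⟩ := exists_nat_gt (max 0 (2 * D / ε))
  have hN0 : (0 : ℝ) < N := lt_of_le_of_lt (le_max_left _ _) hN
  have hND : D / N ≤ ε / 2 := by
    have := lt_of_le_of_lt (le_max_right _ _) hN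
    rw [div_lt_iff₀ hε] at this
    rw [div_le_iff₀ hN0]
    linarith
  let φ : ℕ → E → E := fun i x => x + ((i : ℝ) / N) • (p - x)
  have hφ0 : φ 0 = id := by funext x; simp [φ]
  have hφN : ∀ x, φ N x = p := by intro x; simp [φ, hN0.ne']
  have ht : ∀ i, i ≤ N → ((i : ℝ) / N) ∈ Set.Icc (0 : ℝ) 1 := fun i hi =>
    ⟨by positivity, (div_le_one hN0).2 (by exact_mod_cast hi)⟩
  have same : ∀ i, i ≤ N → ∀ x y, dist (φ i x) (φ i y) ≤ dist x y := by
    intro i hi x y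
    have h := ht i hi
    have : φ i x - φ i y = (1 - (i : ℝ) / N) • (x - y) := by simp only [φ]; module
    rw [dist_eq_norm, dist_eq_norm, this, norm_smul, Real.norm_eq_abs,
      abs_of_nonneg (by linarith [h.2])]
    nlinarith [h.1, norm_nonneg (x - y)]
  have step : ∀ i x, x ∈ A → dist (φ i x) (φ (i + 1) x) ≤ ε / 2 := by
    intro i x hx
    have : φ i x - φ (i + 1) x = -((1 / (N : ℝ)) • (p - x)) := by
      have : (((i + 1 : ℕ) : ℝ) / N) = (i : ℝ) / N + 1 / N := by push_cast; ring
      simp only [φ, this]; module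
    rw [dist_eq_norm, this, norm_neg, norm_smul, Real.norm_eq_abs, abs_of_pos (by positivity)]
    calc 1 / (N : ℝ) * ‖p - x‖ ≤ 1 / N * D := by gcongr; exact hD x hx
      _ = D / N := by ring
      _ ≤ ε / 2 := hND
  refine ⟨∑ i ∈ Finset.range N, prism (φ i) (φ (i + 1)) z + cone p (push (φ N) z),
    Submodule.add_mem _ (Submodule.sum_mem _ fun i hi => ?_) ?_, ?_⟩
  · refine map_mem_of_mem_carried _ (fun l hl => ?_) hzA
    have hi' : i + 1 ≤ N := Finset.mem_range.1 hi
    rw [prism_single]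
    refine Finsupp.supported_mono ?_ (tuplePrism_mem_carried (φ i) (φ (i + 1)) l)
    rintro l' ⟨hlen, hmem⟩
    refine ⟨by rw [hlen, hl.1], fun x hx => ?_, fun x hx y hy => ?_⟩
    · obtain ⟨w, hw, rfl | rfl⟩ := hmem x hx
      · exact hA _ (hl.2.1 w hw) _ (ht i (by omega))
      · exact hA _ (hl.2.1 w hw) _ (ht _ hi')
    · obtain ⟨v, hv, hxv⟩ := hmem x hx
      obtain ⟨w, hw, hyw⟩ := hmem y hy
      have h0 := hl.2.2 v hv w hw
      have h1 := same i (by omega) v w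
      have h2 := same (i + 1) hi' v w
      have h3 := step i w (hl.2.1 w hw)
      rcases hxv with rfl | rfl <;> rcases hyw with rfl | rfl
      · linarith
      · linarith [dist_triangle (φ i v) (φ i w) (φ (i + 1) w)]
      · rw [dist_comm] at h3
        linarith [dist_triangle (φ (i + 1) v) (φ (i + 1) w) (φ i w)]
      · linarith
  · refine map_mem_of_mem_carried (cone p ∘ₗ push (φ N)) (fun l hl => ?_) hzA
    simp only [LinearMap.comp_apply, push_single, cone_single]
    have : ∀ x ∈ p :: l.map (φ N), x = p := by
      intro x hx
      simp only [List.mem_cons, List.mem_map] at hx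
      rcases hx with rfl | ⟨y, -, rfl⟩
      · rfl
      · exact hφN y
    refine single_mem_carried ⟨by simp [hl.1], fun x hx => ?_, fun x hx y hy => ?_⟩
    · rw [this x hx]; exact hp
    · rw [this x hx, this y hy, dist_self]; exact hε.le
  · rw [map_add, boundary_sum_prism φ hz, boundary_cone, ← push_boundary, hz, hφ0]
    have : push (id : E → E) z = z := by
      have : push (id : E → E) = LinearMap.id := ext_single fun l => by simp
      rw [this]; rfl
    rw [this, map_zero, map_zero, add_zero, add_assoc, add_self_chain, add_zero]

end TupleChain

/-- The indicator, mod 2, of the alternating sign sequences that start with `s`. -/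
def altSigns : Bool → List Bool → ZMod 2
  | _, [] => 1
  | s, b :: l => if b = s then altSigns (!s) l else 0

/-- The sum of the values of `g` on the tuples obtained from a tuple by deleting one entry. -/
def faceSum {L : Type*} (g : List L → ZMod 2) : List L → ZMod 2
  | [] => 0
  | a :: l => g l + faceSum (fun l' => g (a :: l')) l

lemma faceSum_zero {L : Type*} (l : List L) : faceSum (fun _ : List L => (0 : ZMod 2)) l = 0 := by
  induction l with
  | nil => rfl
  | cons a l ih => simp [faceSum, ih]

lemma faceSum_congr {L : Type*} {g g' : List L → ZMod 2} {l : List L}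
    (h : ∀ l', l'.Sublist l → g l' = g' l') : faceSum g l = faceSum g' l := by
  induction l generalizing g g' with
  | nil => rfl
  | cons a l ih =>
    simp only [faceSum]
    rw [h l (List.sublist_cons_self a l), ih fun l' hl' => h _ (hl'.cons_cons a)]

lemma faceSum_map {L L' : Type*} (f : L → L') (g : List L' → ZMod 2) (l : List L) :
    faceSum (fun l' => g (l'.map f)) l = faceSum g (l.map f) := by
  induction l generalizing g with
  | nil => rfl
  | cons a l ih => simp only [faceSum, List.map_cons, ← ih]

lemma faceSum_perm {L : Type*} {g : List L → ZMod 2}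
    (hg : ∀ l l', l.Perm l' → g l = g l') {l l' : List L} (h : l.Perm l') :
    faceSum g l = faceSum g l' := by
  induction h generalizing g with
  | nil => rfl
  | cons a h ih =>
    simp only [faceSum]
    rw [hg _ _ h, ih fun _ _ h' => hg _ _ (h'.cons a)]
  | swap a b l =>
    have : (fun l' => g (b :: a :: l')) = fun l' => g (a :: b :: l') :=
      funext fun l' => hg _ _ (List.Perm.swap a b l')
    simp only [faceSum, this]
    ring
  | trans _ _ ih₁ ih₂ => rw [ih₁ hg, ih₂ hg]

lemma faceSum_altSigns (s : Bool) (l : List Bool) :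
    faceSum (altSigns s) l = altSigns s l + altSigns (!s) l := by
  induction l generalizing s with
  | nil => simp [faceSum, altSigns, CharTwo.add_self_eq_zero]
  | cons b l ih =>
    by_cases hb : b = s
    · subst hb
      have : (fun l' => altSigns b (b :: l')) = altSigns (!b) := by funext l'; simp [altSigns]
      simp only [faceSum, this, ih]
      simp only [altSigns, Bool.not_not, if_true]
      have : ¬ b = !b := by cases b <;> simp
      rw [if_neg this, add_left_comm, CharTwo.add_self_eq_zero]
    · have : (fun l' => altSigns s (b :: l')) = fun _ => 0 := by funext l'; simp [altSigns, hb]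
      have hb' : b = !s := by cases b <;> cases s <;> simp_all
      simp only [faceSum, this, faceSum_zero]
      simp [altSigns, hb']

lemma altSigns_map_not (s : Bool) (l : List Bool) :
    altSigns s (l.map (!·)) = altSigns (!s) l := by
  induction l generalizing s with
  | nil => rfl
  | cons b l ih => cases b <;> cases s <;> simp [altSigns, ih]

/-- The indicator, mod 2, of the tuples of labels whose signs alternate, starting with `s`, when
the labels are put in the order of their (distinct) indices. -/
def altLabels {m : ℕ} (s : Bool) (l : List (Fin m × Bool)) : ZMod 2 :=
  if (l.map Prod.fst).Nodup then
    altSigns s ((l.insertionSort fun a b => a.1 ≤ b.1).map Prod.snd)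
  else 0

lemma altLabels_perm {m : ℕ} (s : Bool) (l l' : List (Fin m × Bool)) (h : l.Perm l') :
    altLabels s l = altLabels s l' := by
  have hn : (l.map Prod.fst).Nodup ↔ (l'.map Prod.fst).Nodup := (h.map _).nodup_iff
  unfold altLabels
  by_cases hl : (l.map Prod.fst).Nodup
  · rw [if_pos hl, if_pos (hn.1 hl)]
    have : l.insertionSort (fun a b => a.1 ≤ b.1) = l'.insertionSort fun a b => a.1 ≤ b.1 := by
      have hp := ((List.perm_insertionSort (fun a b : Fin m × Bool => a.1 ≤ b.1) l).trans h).trans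
        (List.perm_insertionSort (fun a b => a.1 ≤ b.1) l').symm
      have : Std.Total fun a b : Fin m × Bool => a.1 ≤ b.1 := ⟨fun a b => le_total a.1 b.1⟩
      have : IsTrans (Fin m × Bool) fun a b => a.1 ≤ b.1 := ⟨fun a b c => le_trans⟩
      refine List.Perm.eq_of_pairwise (fun a b ha hb hab hba => ?_)
        (List.pairwise_insertionSort _ _) (List.pairwise_insertionSort _ _) hp
      have ha' : a ∈ l := (List.mem_insertionSort _).1 ha
      have hb' : b ∈ l := h.mem_iff.2 ((List.mem_insertionSort _).1 hb)
      exact List.inj_on_of_nodup_map hl ha' hb' (le_antisymm hab hba)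
    rw [this]
  · rw [if_neg hl, if_neg fun h => hl (hn.2 h)]

lemma altLabels_neg {m : ℕ} (s : Bool) (l : List (Fin m × Bool)) :
    altLabels s (l.map fun a => (a.1, !a.2)) = altLabels (!s) l := by
  unfold altLabels
  rw [List.map_map, ← List.map_insertionSort (fun a b => a.1 ≤ b.1) (fun a b => a.1 ≤ b.1)
    (fun a : Fin m × Bool => (a.1, !a.2)) l (fun _ _ _ _ => Iff.rfl), List.map_map,
    ← altSigns_map_not, List.map_map]
  rfl

lemma altLabels_eq_zero {m : ℕ} (s : Bool) {l : List (Fin m × Bool)} (h : m < l.length) :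
    altLabels s l = 0 := by
  refine if_neg fun hn => ?_
  have := hn.length_le_card
  simp at this
  omega

lemma faceSum_altLabels {m : ℕ} (s : Bool) {l : List (Fin m × Bool)}
    (h : ∀ a ∈ l, ∀ b ∈ l, a.1 = b.1 → a = b) :
    faceSum (altLabels s) l = altLabels s l + altLabels (!s) l := by
  by_cases hl : (l.map Prod.fst).Nodup
  · let l' := l.insertionSort fun a b => a.1 ≤ b.1
    have hp : l'.Perm l := List.perm_insertionSort _ l
    have hsort : l'.Pairwise fun a b => a.1 ≤ b.1 := by
      have : Std.Total fun a b : Fin m × Bool => a.1 ≤ b.1 := ⟨fun a b => le_total a.1 b.1⟩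
      have : IsTrans (Fin m × Bool) fun a b => a.1 ≤ b.1 := ⟨fun a b c => le_trans⟩
      exact List.pairwise_insertionSort _ _
    have hnd : (l'.map Prod.fst).Nodup := (hp.map _).nodup_iff.2 hl
    have key : ∀ t, ∀ l'' : List (Fin m × Bool), l''.Sublist l' →
        altLabels t l'' = altSigns t (l''.map Prod.snd) := by
      intro t l'' hsub
      unfold altLabels
      rw [if_pos (hnd.sublist (hsub.map _)), (hsort.sublist hsub).insertionSort_eq]
    rw [← faceSum_perm (altLabels_perm s) hp, faceSum_congr (key s),
      faceSum_map Prod.snd (altSigns s), faceSum_altSigns, ← key _ _ (List.Sublist.refl _),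
      ← key _ _ (List.Sublist.refl _), altLabels_perm _ _ _ hp, altLabels_perm _ _ _ hp]
  · have hdup : ¬ l.Nodup := fun hn =>
      hl (List.Nodup.map_on (fun a ha b hb hab => h a ha b hb hab) hn)
    obtain ⟨a, ha⟩ : ∃ a, List.Duplicate a l := by
      by_contra hcon
      push Not at hcon
      exact hdup (List.nodup_iff_forall_not_duplicate.2 hcon)
    obtain ⟨l'', hp⟩ : ∃ l'', l.Perm (a :: a :: l'') := by
      exact (List.duplicate_iff_sublist.1 ha).exists_perm_append
    have hz : (fun l' => altLabels s (a :: a :: l')) = fun _ => 0 := by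
      funext l'
      exact if_neg (by simp)
    rw [faceSum_perm (altLabels_perm s) hp]
    simp only [faceSum, hz, faceSum_zero]
    rw [add_zero, CharTwo.add_self_eq_zero]
    simp [altLabels, hl]

/-- The number, mod 2, of tuples of a chain whose labels alternate in sign, starting with `s`. -/
noncomputable def altCount {E : Type*} {m : ℕ} (lab : E → Fin m × Bool) (s : Bool) :
    TupleChain E →ₗ[ZMod 2] ZMod 2 :=
  Finsupp.linearCombination (ZMod 2) fun l => altLabels s (l.map lab)

open TupleChain

@[simp] lemma altCount_single {E : Type*} {m : ℕ} (lab : E → Fin m × Bool) (s : Bool)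
    (l : List E) : altCount lab s (Finsupp.single l 1) = altLabels s (l.map lab) := by
  simp [altCount, Finsupp.linearCombination_single]

lemma linearCombination_tupleBoundary {E : Type*} (g : List E → ZMod 2) (l : List E) :
    Finsupp.linearCombination (ZMod 2) g (tupleBoundary l) = faceSum g l := by
  induction l generalizing g with
  | nil => simp [tupleBoundary, faceSum]
  | cons a l ih =>
    have : Finsupp.linearCombination (ZMod 2) g ∘ₗ cone a =
        Finsupp.linearCombination (ZMod 2) fun l' => g (a :: l') :=
      ext_single fun l => by simp [Finsupp.linearCombination_single]
    have h := LinearMap.congr_fun this (tupleBoundary l)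
    simp only [LinearMap.comp_apply] at h
    simp [tupleBoundary, faceSum, h, ih, Finsupp.linearCombination_single]

section labels

variable {E : Type*} [PseudoMetricSpace E] {m : ℕ} {lab : E → Fin m × Bool} {A : Set E} {k : ℕ}
  {ε : ℝ} {z : TupleChain E}

lemma altCount_boundary
    (hlab : ∀ x ∈ A, ∀ y ∈ A, dist x y ≤ ε → (lab x).1 = (lab y).1 → lab x = lab y)
    (s : Bool) (hz : z ∈ carried (IsSmall A k ε)) :
    altCount lab s (boundary z) = altCount lab s z + altCount lab (!s) z := by
  have := map_mem_of_mem_carried (S := ⊥)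
    (altCount lab s ∘ₗ boundary - (altCount lab s + altCount lab (!s))) (fun l hl => ?_) hz
  · rw [Submodule.mem_bot] at this
    exact sub_eq_zero.1 this
  · have h : faceSum (altLabels s) (l.map lab) =
        altLabels s (l.map lab) + altLabels (!s) (l.map lab) := by
      refine faceSum_altLabels s fun a ha b hb hab => ?_
      obtain ⟨x, hx, rfl⟩ := List.mem_map.1 ha
      obtain ⟨y, hy, rfl⟩ := List.mem_map.1 hb
      exact hlab x (hl.2.1 x hx) y (hl.2.1 y hy) (hl.2.2 x hx y hy) hab
    rw [← faceSum_map, ← linearCombination_tupleBoundary] at h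
    simp only [Submodule.mem_bot, LinearMap.sub_apply, LinearMap.add_apply, LinearMap.comp_apply,
      altCount_single, boundary_single]
    exact sub_eq_zero.2 h

lemma altCount_push_neg [Neg E] (hlab : ∀ x ∈ A, lab (-x) = ((lab x).1, !(lab x).2)) (s : Bool)
    (hz : z ∈ carried (IsSmall A k ε)) :
    altCount lab s (push (fun x => -x) z) = altCount lab (!s) z := by
  have := map_mem_of_mem_carried (S := ⊥)
    (altCount lab s ∘ₗ push (fun x => -x) - altCount lab (!s)) (fun l hl => ?_) hz
  · rw [Submodule.mem_bot] at this
    exact sub_eq_zero.1 this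
  · have h : (l.map fun x => -x).map lab = (l.map lab).map fun a => (a.1, !a.2) := by
      rw [List.map_map, List.map_map]
      exact List.map_congr_left fun x hx => hlab x (hl.2.1 x hx)
    simp only [Submodule.mem_bot, LinearMap.sub_apply, LinearMap.comp_apply, altCount_single,
      push_single, h, altLabels_neg, sub_self]

lemma altCount_eq_zero (s : Bool) (hk : m < k) (hz : z ∈ carried (IsSmall A k ε)) :
    altCount lab s z = 0 := by
  have := map_mem_of_mem_carried (S := ⊥) (altCount lab s) (fun l hl => ?_) hz
  · simpa using this
  · rw [Submodule.mem_bot, altCount_single]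
    exact altLabels_eq_zero s (by simpa [hl.1] using hk)

end labels

/-- The unit sphere of the `ℓ¹` norm on the span of the first `k` coordinate vectors. -/
def l1Sphere (m k : ℕ) : Set (Fin m → ℝ) :=
  {x | ∑ i, |x i| = 1 ∧ ∀ i : Fin m, k ≤ i → x i = 0}

/-- The unit ball of the `ℓ¹` norm. -/
def l1Ball (m : ℕ) : Set (Fin m → ℝ) :=
  {x | ∑ i, |x i| ≤ 1}

lemma neg_mem_l1Sphere {m k : ℕ} {x : Fin m → ℝ} (hx : x ∈ l1Sphere m k) :
    -x ∈ l1Sphere m k := by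
  simpa [l1Sphere] using hx

lemma norm_le_of_sum_abs_le {m : ℕ} {x : Fin m → ℝ} {c : ℝ} (h : ∑ i, |x i| ≤ c) :
    ‖x‖ ≤ c := by
  refine (pi_norm_le_iff_of_nonneg ((Finset.sum_nonneg fun i _ => abs_nonneg _).trans h)).2
    fun i => ?_
  exact (Finset.single_le_sum (f := fun i => |x i|) (fun i _ => abs_nonneg _)
    (Finset.mem_univ i)).trans h

lemma single_mem_l1Sphere {m : ℕ} (k : Fin m) : Pi.single k 1 ∈ l1Sphere m (k + 1) := by
  refine ⟨?_, fun i hi => Pi.single_eq_of_ne (by rintro rfl; omega) _⟩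
  rw [Finset.sum_eq_single k]
  · simp
  · intro i _ hi; simp [hi]
  · simp

lemma join_mem_l1Sphere {m : ℕ} (k : Fin m) {x : Fin m → ℝ} (hx : x ∈ l1Sphere m k) {t : ℝ}
    (ht : t ∈ Set.Icc (0 : ℝ) 1) : x + t • (Pi.single k 1 - x) ∈ l1Sphere m (k + 1) := by
  have hxk : x k = 0 := hx.2 k le_rfl
  have habs : ∀ i, |(x + t • (Pi.single k 1 - x) : Fin m → ℝ) i| =
      (1 - t) * |x i| + t * |(Pi.single k 1 : Fin m → ℝ) i| := by
    intro i
    by_cases hi : i = k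
    · subst hi
      simp [hxk, abs_of_nonneg ht.1]
    · simp only [Pi.add_apply, Pi.smul_apply, Pi.sub_apply, Pi.single_eq_of_ne hi, smul_eq_mul]
      rw [show x i + t * (0 - x i) = (1 - t) * x i by ring, abs_mul,
        abs_of_nonneg (by linarith [ht.2] : 0 ≤ 1 - t)]
      simp
  refine ⟨?_, fun i hi => ?_⟩
  · simp only [habs, Finset.sum_add_distrib, ← Finset.mul_sum, hx.1, (single_mem_l1Sphere k).1]
    ring
  · have hik : i ≠ k := by rintro rfl; omega
    simp [hik, hx.2 i (by omega)]

/-- A form of Tucker's lemma: every labelling of the `ℓ¹` unit ball by signed indices which is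
antipodal on the boundary has complementary labels at arbitrarily close points. -/
theorem tucker {m : ℕ} (lab : (Fin m → ℝ) → Fin m × Bool) {ε₀ : ℝ} (hε₀ : 0 < ε₀)
    (hanti : ∀ x, ∑ i, |x i| = 1 → lab (-x) = ((lab x).1, !(lab x).2))
    (hlab : ∀ x ∈ l1Ball m, ∀ y ∈ l1Ball m, dist x y ≤ ε₀ → (lab x).1 = (lab y).1 →
      lab x = lab y) : False := by
  have hball : ∀ k, l1Sphere m k ⊆ l1Ball m := fun k x hx => hx.1.le
  have spheres : ∀ k ≤ m, ∀ ε, 0 < ε → ε ≤ ε₀ → ∃ z ∈ carried (IsSmall (l1Sphere m k) k ε),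
      boundary z = 0 ∧ push (fun x => -x) z = z ∧ altCount lab true z = 1 := by
    intro k
    induction k with
    | zero =>
      intro _ ε hε _
      refine ⟨Finsupp.single [] 1, single_mem_carried ⟨rfl, by simp, by simp⟩, ?_, ?_, ?_⟩
      · simp [tupleBoundary]
      · simp
      · simp [altLabels, altSigns]
    | succ k ih =>
      intro hk ε hε hεε
      obtain ⟨z, hz, hbz, hnz, hcz⟩ := ih (by omega) (ε / 2) (by positivity) (by linarith)
      let k' : Fin m := ⟨k, hk⟩
      obtain ⟨h, hh, hbh⟩ := exists_boundary_eq (A' := l1Sphere m (k + 1)) (D := 2) hε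
        (single_mem_l1Sphere k') (fun x hx t ht => join_mem_l1Sphere k' hx ht)
        (fun x hx => by
          have h1 := norm_le_of_sum_abs_le hx.1.le
          have h2 := norm_le_of_sum_abs_le (single_mem_l1Sphere k').1.le
          linarith [norm_sub_le (Pi.single k' 1) x]) hbz hz
      have hanti' : ∀ x ∈ l1Sphere m (k + 1), lab (-x) = ((lab x).1, !(lab x).2) :=
        fun x hx => hanti x hx.1
      refine ⟨h + push (fun x => -x) h, Submodule.add_mem _ hh
        (map_mem_of_mem_carried _ (fun l hl => ?_) hh), ?_, ?_, ?_⟩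
      · rw [push_single]
        refine single_mem_carried ⟨by simpa using hl.1, fun x hx => ?_, fun x hx y hy => ?_⟩
        · obtain ⟨x, hx', rfl⟩ := List.mem_map.1 hx
          exact neg_mem_l1Sphere (hl.2.1 x hx')
        · obtain ⟨x, hx', rfl⟩ := List.mem_map.1 hx
          obtain ⟨y, hy', rfl⟩ := List.mem_map.1 hy
          rw [dist_neg_neg]
          exact hl.2.2 x hx' y hy'
      · rw [map_add, ← push_boundary, hbh, hnz, add_self_chain]
      · have : push (fun x : Fin m → ℝ => -x) ∘ₗ push (fun x => -x) = LinearMap.id :=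
          ext_single fun l => by simp
        have := LinearMap.congr_fun this h
        simp only [LinearMap.comp_apply, LinearMap.id_apply] at this
        rw [map_add, this, add_comm]
      · rw [map_add, altCount_push_neg hanti' true hh, ← altCount_boundary
          (fun x hx y hy hxy => hlab x (hball _ hx) y (hball _ hy) (hxy.trans hεε)) true hh,
          hbh, hcz]
  obtain ⟨z, hz, hbz, -, hcz⟩ := spheres m le_rfl (ε₀ / 2) (by positivity) (by linarith)
  obtain ⟨h, hh, hbh⟩ := exists_boundary_eq (A' := l1Ball m) (p := 0) (D := 1) hε₀
    (by simp [l1Ball])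
    (fun x hx t ht => by
      have : x + t • (0 - x) = (1 - t) • x := by module
      simp only [this, l1Ball, Set.mem_ofPred_eq, Pi.smul_apply, smul_eq_mul, abs_mul,
        ← Finset.mul_sum, hx.1]
      rw [abs_of_nonneg (by linarith [ht.2])]
      linarith [ht.1])
    (fun x hx => by simpa using norm_le_of_sum_abs_le hx.1.le) hbz hz
  have := altCount_boundary hlab true hh
  rw [hbh, hcz, altCount_eq_zero _ (Nat.lt_succ_self m) hh,
    altCount_eq_zero _ (Nat.lt_succ_self m) hh] at this
  simp at this

lemma isCompact_l1Ball (m : ℕ) : IsCompact (l1Ball m) := by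
  refine Metric.isCompact_of_isClosed_isBounded ?_ ?_
  · exact isClosed_le (by fun_prop) continuous_const
  · refine (Metric.isBounded_closedBall (x := 0) (r := 1)).subset fun x hx => ?_
    simpa using norm_le_of_sum_abs_le hx

/-- An index of a coordinate of maximal absolute value. -/
noncomputable def maxAbsIndex {m : ℕ} [Nonempty (Fin m)] (v : Fin m → ℝ) : Fin m :=
  (Finite.exists_max fun i => |v i|).choose

lemma norm_eq_abs_maxAbsIndex {m : ℕ} [Nonempty (Fin m)] (v : Fin m → ℝ) :
    ‖v‖ = |v (maxAbsIndex v)| :=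
  le_antisymm ((pi_norm_le_iff_of_nonneg (abs_nonneg _)).2
    (Finite.exists_max fun i => |v i|).choose_spec) (norm_le_pi_norm v _)

lemma maxAbsIndex_neg {m : ℕ} [Nonempty (Fin m)] (v : Fin m → ℝ) :
    maxAbsIndex (-v) = maxAbsIndex v := by
  simp [maxAbsIndex]

/-- A form of the Borsuk–Ulam theorem: a continuous map on the `ℓ¹` unit ball of `ℝ^m` whose
restriction to the boundary is close to an odd map cannot be bounded away from zero. -/
theorem borsuk_ulam_of_close {m : ℕ} [Nonempty (Fin m)] {F G : (Fin m → ℝ) → Fin m → ℝ}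
    (hG : Continuous G) {δ : ℝ} (hδ : 0 < δ) (hGδ : ∀ x ∈ l1Ball m, δ ≤ ‖G x‖)
    (hF : ∀ x, ∑ i, |x i| = 1 → F (-x) = -F x)
    (hFG : ∀ x, ∑ i, |x i| = 1 → δ + ‖F x - G x‖ ≤ ‖F x‖) : False := by
  classical
  let V : (Fin m → ℝ) → Fin m → ℝ := fun x => if ∑ i, |x i| = 1 then F x else G x
  let lab : (Fin m → ℝ) → Fin m × Bool :=
    fun x => (maxAbsIndex (V x), decide (0 < V x (maxAbsIndex (V x))))
  have hV : ∀ x ∈ l1Ball m, δ + ‖V x - G x‖ ≤ ‖V x‖ := by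
    intro x hx
    by_cases h : ∑ i, |x i| = 1
    · simpa only [V, if_pos h] using hFG x h
    · simpa [V, if_neg h] using hGδ x hx
  have hsgn : ∀ x ∈ l1Ball m, ((lab x).2 = true → δ ≤ G x (lab x).1) ∧
      ((lab x).2 = false → G x (lab x).1 ≤ -δ) := by
    intro x hx
    have h1 := hV x hx
    rw [norm_eq_abs_maxAbsIndex (V x)] at h1
    have h2 := norm_le_pi_norm (V x - G x) (maxAbsIndex (V x))
    rw [Real.norm_eq_abs, Pi.sub_apply, abs_le] at h2
    simp only [lab, decide_eq_true_eq, decide_eq_false_iff_not, not_lt]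
    constructor
    · intro h
      rw [abs_of_pos h] at h1
      linarith [h2.2]
    · intro h
      rw [abs_of_nonpos h] at h1
      linarith [h2.1]
  obtain ⟨ε, hε, hGε⟩ := Metric.uniformContinuousOn_iff.1
    ((isCompact_l1Ball m).uniformContinuousOn_of_continuous hG.continuousOn) δ hδ
  refine tucker lab (half_pos hε) (fun x hx => ?_) fun x hx y hy hxy hidx => ?_
  · have hx' : ∑ i, |(-x) i| = 1 := by simpa using hx
    have hneg : V (-x) = -V x := by simp only [V, if_pos hx, if_pos hx', hF x hx]
    have hne : V x (maxAbsIndex (V x)) ≠ 0 := by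
      have := hV x (le_of_eq hx)
      rw [norm_eq_abs_maxAbsIndex (V x)] at this
      exact abs_pos.1 (by linarith [norm_nonneg (V x - G x)])
    simp only [lab, hneg, maxAbsIndex_neg, Pi.neg_apply, Left.neg_pos_iff, Prod.mk.injEq,
      true_and]
    rcases hne.lt_or_gt with h | h <;> simp [h, h.le, not_lt]
  · refine Prod.ext hidx ?_
    have hd := (norm_le_pi_norm (G x - G y) (lab x).1).trans_lt
      ((dist_eq_norm (G x) (G y)).symm.trans_lt (hGε x hx y hy (by linarith)))
    rw [Real.norm_eq_abs, Pi.sub_apply, abs_lt] at hd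
    have h1 := hsgn x hx
    have h2 := hsgn y hy
    rw [← hidx] at h2
    cases hbx : (lab x).2 <;> cases hby : (lab y).2
    · rfl
    · linarith [h1.2 hbx, h2.1 hby]
    · linarith [h1.1 hbx, h2.2 hby]
    · rfl

/-- A median of `2n+1` real numbers, as a minimum of maxima over subsets of size `n + 1`. -/
noncomputable def median (n : ℕ) (x : Fin (2 * n + 1) → ℝ) : ℝ :=
  ⨅ S : {S : Finset (Fin (2 * n + 1)) // S.card = n + 1},
    S.1.sup' (Finset.card_pos.1 (by rw [S.2]; omega)) x

lemma nonempty_finset_card_eq (n : ℕ) :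
    Nonempty {S : Finset (Fin (2 * n + 1)) // S.card = n + 1} := by
  obtain ⟨S, -, hS⟩ := Finset.exists_subset_card_eq
    (s := (Finset.univ : Finset (Fin (2 * n + 1)))) (n := n + 1) (by simp; omega)
  exact ⟨⟨S, hS⟩⟩

lemma continuous_median (n : ℕ) : Continuous (median n) := by
  have := nonempty_finset_card_eq n
  have h : median n = fun x => Finset.univ.inf' Finset.univ_nonempty
      fun S : {S : Finset (Fin (2 * n + 1)) // S.card = n + 1} =>
        S.1.sup' (Finset.card_pos.1 (by rw [S.2]; omega)) x := by
    funext x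
    rw [Finset.inf'_univ_eq_ciInf]
    rfl
  rw [h]
  exact Continuous.finset_inf'_apply _ fun S _ =>
    Continuous.finset_sup'_apply _ fun i _ => continuous_apply i

lemma card_lt_median_le (n : ℕ) (x : Fin (2 * n + 1) → ℝ) :
    (Finset.univ.filter fun i => x i < median n x).card ≤ n := by
  by_contra! h
  obtain ⟨S, hS, hcard⟩ := Finset.exists_subset_card_eq (n := n + 1) h
  have hne : S.Nonempty := Finset.card_pos.1 (by omega)
  have h1 : median n x ≤ S.sup' hne x := 
    ciInf_le (f := fun S : {S : Finset (Fin (2 * n + 1)) // S.card = n + 1} =>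
      S.1.sup' (Finset.card_pos.1 (by rw [S.2]; omega)) x) (Set.finite_range _).bddBelow ⟨S, hcard⟩
  have h2 : S.sup' hne x < median n x :=
    (Finset.sup'_lt_iff hne).2 fun i hi => (Finset.mem_filter.1 (hS hi)).2
  exact absurd h1 (not_le.2 h2)

lemma card_median_lt_le (n : ℕ) (x : Fin (2 * n + 1) → ℝ) :
    (Finset.univ.filter fun i => median n x < x i).card ≤ n := by
  have := nonempty_finset_card_eq n
  obtain ⟨S, hS⟩ := exists_eq_ciInf_of_finite
    (f := fun S : {S : Finset (Fin (2 * n + 1)) // S.card = n + 1} =>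
      S.1.sup' (Finset.card_pos.1 (by rw [S.2]; omega)) x)
  have hle : ∀ i ∈ S.1, x i ≤ median n x := fun i hi =>
    (Finset.le_sup' x hi).trans_eq hS
  have hsub : (Finset.univ.filter fun i => median n x < x i) ⊆ S.1ᶜ := by
    intro i hi
    rw [Finset.mem_compl]
    exact fun hiS => absurd (hle i hiS) (not_le.2 (Finset.mem_filter.1 hi).2)
  refine (Finset.card_le_card hsub).trans ?_
  rw [Finset.card_compl, S.2, Fintype.card_fin]
  omega

lemma le_of_card_le {n : ℕ} {x : Fin (2 * n + 1) → ℝ} {c d : ℝ}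
    (hc : (Finset.univ.filter fun i => c < x i).card ≤ n)
    (hd : (Finset.univ.filter fun i => x i < d).card ≤ n) : d ≤ c := by
  by_contra! h
  have hsub : (Finset.univ : Finset (Fin (2 * n + 1))) ⊆
      (Finset.univ.filter fun i => c < x i) ∪ Finset.univ.filter fun i => x i < d := by
    intro i _
    simp only [Finset.mem_union, Finset.mem_filter, Finset.mem_univ, true_and]
    rcases lt_or_ge c (x i) with h' | h'
    · exact Or.inl h'
    · exact Or.inr (h'.trans_lt h)
  have := (Finset.card_le_card hsub).trans (Finset.card_union_le _ _)
  rw [Finset.card_univ, Fintype.card_fin] at this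
  omega

lemma median_neg (n : ℕ) (x : Fin (2 * n + 1) → ℝ) : median n (-x) = -median n x := by
  have h1 := card_lt_median_le n (-x)
  have h2 := card_median_lt_le n (-x)
  have e1 : ∀ i, (-x) i < median n (-x) ↔ -median n (-x) < x i := fun i => neg_lt
  have e2 : ∀ i, median n (-x) < (-x) i ↔ x i < -median n (-x) := fun i => lt_neg
  simp only [e1] at h1
  simp only [e2] at h2
  have h3 := le_of_card_le h1 (card_lt_median_le n x)
  have h4 := le_of_card_le (card_median_lt_le n x) h2
  linarith

lemma mem_coneOverSkeleton {n : ℕ} (hn : 1 ≤ n) {v : Fin (2 * n + 1) → ℝ} (hv : ∀ i, 0 ≤ v i)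
    (hsum : ∑ i, v i ≤ 1) (hcard : {i | v i ≠ 0}.ncard ≤ n) :
    (v, 1 - ∑ i, v i) ∈ coneOverSkeleton n := by
  have h0 : 0 ≤ ∑ i, v i := Finset.sum_nonneg fun i _ => hv i
  rcases h0.eq_or_lt with h | h
  · have hv0 : v = 0 := funext fun i =>
      (Finset.sum_eq_zero_iff_of_nonneg fun i _ => hv i).1 h.symm i (Finset.mem_univ i)
    refine ⟨Pi.single 0 1, ⟨single_mem_stdSimplex ℝ 0, ?_⟩, 1, by simp, ?_⟩
    · have : {i | (Pi.single 0 1 : Fin (2 * n + 1) → ℝ) i ≠ 0} = {0} := by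
        ext i
        simp [Pi.single_apply]
      rw [this, Set.ncard_singleton]
      exact hn
    · simp [hv0]
  · refine ⟨(∑ i, v i)⁻¹ • v, ⟨⟨fun i => ?_, ?_⟩, ?_⟩, 1 - ∑ i, v i,
      ⟨by linarith, by linarith⟩, ?_⟩
    · exact mul_nonneg (inv_nonneg.2 h0) (hv i)
    · simp [← Finset.mul_sum, h.ne']
    · simpa [h.ne'] using hcard
    · rw [sub_sub_cancel, smul_smul, mul_inv_cancel₀ h.ne', one_smul]

/-- The vector in `ℝ^{2n+1}` with median zero obtained from `w` by appending a zero coordinate and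
subtracting the median. -/
noncomputable def medianCentered (n : ℕ) (w : Fin (2 * n) → ℝ) : Fin (2 * n + 1) → ℝ :=
  fun i => (Fin.snoc w 0 : Fin (2 * n + 1) → ℝ) i - median n (Fin.snoc w 0)

lemma continuous_medianCentered (n : ℕ) : Continuous (medianCentered n) := by
  have h : Continuous fun w : Fin (2 * n) → ℝ => (Fin.snoc w 0 : Fin (2 * n + 1) → ℝ) := by
    fun_prop
  exact continuous_pi fun i =>
    ((continuous_apply i).comp h).sub ((continuous_median n).comp h)

lemma medianCentered_neg (n : ℕ) (w : Fin (2 * n) → ℝ) :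
    medianCentered n (-w) = -medianCentered n w := by
  have h : (Fin.snoc (-w) 0 : Fin (2 * n + 1) → ℝ) = -Fin.snoc w 0 := by
    funext i
    refine Fin.lastCases ?_ (fun j => ?_) i <;> simp
  funext i
  simp only [medianCentered, h, median_neg, Pi.neg_apply]
  ring

lemma eq_zero_of_medianCentered_eq_zero {n : ℕ} {w : Fin (2 * n) → ℝ}
    (h : medianCentered n w = 0) : w = 0 := by
  have hl := congrFun h (Fin.last _)
  simp only [medianCentered, Fin.snoc_last, Pi.zero_apply] at hl
  funext j
  have hj := congrFun h j.castSucc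
  simp only [medianCentered, Fin.snoc_castSucc, Pi.zero_apply] at hj
  simp only [Pi.zero_apply]
  linarith

/-- The normalized positive part of `medianCentered n w`. -/
noncomputable def positivePart (n : ℕ) (w : Fin (2 * n) → ℝ) : Fin (2 * n + 1) → ℝ :=
  (1 + ∑ i, |medianCentered n w i|)⁻¹ • fun i => max (medianCentered n w i) 0

lemma norm_factor_pos (n : ℕ) (w : Fin (2 * n) → ℝ) : 0 < 1 + ∑ i, |medianCentered n w i| :=
  add_pos_of_pos_of_nonneg one_pos (Finset.sum_nonneg fun _ _ => abs_nonneg _)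

lemma continuous_positivePart (n : ℕ) : Continuous (positivePart n) := by
  have h := continuous_medianCentered n
  have h' : ∀ i, Continuous fun w => medianCentered n w i := fun i => (continuous_apply i).comp h
  refine Continuous.smul (Continuous.inv₀ ?_ fun w => (norm_factor_pos n w).ne') ?_
  · exact continuous_const.add (continuous_finsetSum _ fun i _ => (h' i).abs)
  · exact continuous_pi fun i => (h' i).max continuous_const

lemma positivePart_mem (n : ℕ) (hn : 1 ≤ n) (w : Fin (2 * n) → ℝ) :
    (positivePart n w, 1 - ∑ i, positivePart n w i) ∈ coneOverSkeleton n := by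
  have hpos := norm_factor_pos n w
  refine mem_coneOverSkeleton hn (fun i => ?_) ?_ ?_
  · exact mul_nonneg (inv_nonneg.2 hpos.le) (le_max_right _ _)
  · simp only [positivePart, Pi.smul_apply, smul_eq_mul, ← Finset.mul_sum]
    rw [inv_mul_le_one₀ hpos]
    have : ∑ i, max (medianCentered n w i) 0 ≤ ∑ i, |medianCentered n w i| :=
      Finset.sum_le_sum fun i _ => max_le (le_abs_self _) (abs_nonneg _)
    linarith
  · rw [Set.ncard_eq_toFinset_card']
    refine (Finset.card_le_card fun i hi => ?_).trans (card_median_lt_le n (Fin.snoc w 0))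
    rw [Set.mem_toFinset] at hi
    refine Finset.mem_filter.2 ⟨Finset.mem_univ i, ?_⟩
    by_contra! hle
    refine hi ?_
    have : medianCentered n w i ≤ 0 := sub_nonpos.2 hle
    simp [positivePart, max_eq_right this]

lemma eq_zero_of_positivePart_neg {n : ℕ} {w : Fin (2 * n) → ℝ}
    (h : positivePart n (-w) = positivePart n w) : w = 0 := by
  refine eq_zero_of_medianCentered_eq_zero (funext fun i => ?_)
  have hi := congrFun h i
  simp only [positivePart, medianCentered_neg, Pi.neg_apply, abs_neg, Pi.smul_apply,
    smul_eq_mul] at hi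
  have := mul_left_cancel₀ (inv_ne_zero (norm_factor_pos n w).ne') hi
  rcases le_total (medianCentered n w i) 0 with h0 | h0
  · rw [max_eq_left (by linarith), max_eq_right h0] at this
    simpa using this
  · rw [max_eq_right (by linarith), max_eq_left h0] at this
    exact this.symm

/-- The map to the cone over the skeleton given by the positive part. -/
noncomputable def conePoint (n : ℕ) (hn : 1 ≤ n) (w : Fin (2 * n) → ℝ) : coneOverSkeleton n :=
  ⟨(positivePart n w, 1 - ∑ i, positivePart n w i), positivePart_mem n hn w⟩

lemma continuous_conePoint (n : ℕ) (hn : 1 ≤ n) : Continuous (conePoint n hn) := by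
  have h := continuous_positivePart n
  refine Continuous.subtype_mk (h.prodMk ?_) _
  exact continuous_const.sub (continuous_finsetSum _ fun i _ => (continuous_apply i).comp h)

/-- Example 2.17 (reproving [RSS]): `T × ℕ*` does not embed in `ℝ^{2n}`, where `T` is the
cone over the `(n-1)`-skeleton of the `2n`-simplex and `ℕ*` is the one-point
compactification of `ℕ`. -/
theorem stmt6 (n : ℕ) (hn : 1 ≤ n) :
    ¬ ∃ f : coneOverSkeleton n × OnePoint ℕ → EuclideanSpace ℝ (Fin (2 * n)),
      IsEmbedding f := by
  rintro ⟨f, hf⟩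
  have : Nonempty (Fin (2 * n)) := ⟨⟨0, by omega⟩⟩
  let e : coneOverSkeleton n × OnePoint ℕ → Fin (2 * n) → ℝ := fun a => WithLp.ofLp (f a)
  have he : Continuous e := (PiLp.continuous_ofLp 2 _).comp hf.continuous
  have hinj : Function.Injective e := (WithLp.ofLp_injective 2).comp hf.injective
  have hp := continuous_conePoint n hn
  have hp' : Continuous fun w => conePoint n hn (-w) := hp.comp continuous_neg
  let F : (Fin (2 * n) → ℝ) → Fin (2 * n) → ℝ := fun w =>
    e (conePoint n hn w, OnePoint.infty) - e (conePoint n hn (-w), OnePoint.infty)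
  have hFcont : Continuous F :=
    (he.comp (hp.prodMk continuous_const)).sub (he.comp (hp'.prodMk continuous_const))
  have hB := isCompact_l1Ball (2 * n)
  obtain ⟨c, hc, hFc⟩ : ∃ c > 0, ∀ w, ∑ i, |w i| = 1 → c ≤ ‖F w‖ := by
    have hS : IsCompact {w : Fin (2 * n) → ℝ | ∑ i, |w i| = 1} :=
      hB.of_isClosed_subset (isClosed_eq (by fun_prop) continuous_const) fun w hw => le_of_eq hw
    refine (hS.exists_forall_le' (a := 0) hFcont.norm.continuousOn fun w hw => ?_)
    refine norm_pos_iff.2 fun h => ?_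
    have h1 := congrArg Prod.fst (hinj (sub_eq_zero.1 h))
    have h2 : positivePart n w = positivePart n (-w) := congrArg (fun a => a.1.1) h1
    have h3 := eq_zero_of_positivePart_neg h2.symm
    have hw' : ∑ i, |w i| = 1 := hw
    simp [h3] at hw'
  obtain ⟨k, hk⟩ : ∃ k : ℕ, ∀ w ∈ l1Ball (2 * n),
      ‖e (conePoint n hn (-w), (k : OnePoint ℕ)) -
        e (conePoint n hn (-w), OnePoint.infty)‖ < c / 2 := by
    have hev : ∀ᶠ a in 𝓝 (OnePoint.infty : OnePoint ℕ), ∀ w ∈ l1Ball (2 * n),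
        ‖e (conePoint n hn (-w), a) - e (conePoint n hn (-w), OnePoint.infty)‖ < c / 2 := by
      refine hB.eventually_forall_of_forall_eventually fun w _ => ?_
      have hcont : Continuous fun z : OnePoint ℕ × (Fin (2 * n) → ℝ) =>
          ‖e (conePoint n hn (-z.2), z.1) - e (conePoint n hn (-z.2), OnePoint.infty)‖ :=
        ((he.comp ((hp'.comp continuous_snd).prodMk continuous_fst)).sub
          (he.comp ((hp'.comp continuous_snd).prodMk continuous_const))).norm
      refine hcont.continuousAt.eventually_lt continuousAt_const ?_
      simpa using hc
    obtain ⟨a, ha, hne⟩ :=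
      ((hev.filter_mono nhdsWithin_le_nhds).and
        (self_mem_nhdsWithin : {OnePoint.infty}ᶜ ∈ 𝓝[≠] (OnePoint.infty : OnePoint ℕ))).exists
    obtain ⟨k, rfl⟩ := OnePoint.ne_infty_iff_exists.1 hne
    exact ⟨k, ha⟩
  let G : (Fin (2 * n) → ℝ) → Fin (2 * n) → ℝ := fun w =>
    e (conePoint n hn w, OnePoint.infty) - e (conePoint n hn (-w), (k : OnePoint ℕ))
  have hGcont : Continuous G :=
    (he.comp (hp.prodMk continuous_const)).sub (he.comp (hp'.prodMk continuous_const))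
  obtain ⟨d, hd, hGd⟩ : ∃ d > 0, ∀ w ∈ l1Ball (2 * n), d ≤ ‖G w‖ := by
    refine hB.exists_forall_le' (a := 0) hGcont.norm.continuousOn fun w _ => ?_
    refine norm_pos_iff.2 fun h => ?_
    exact OnePoint.infty_ne_coe k (congrArg Prod.snd (hinj (sub_eq_zero.1 h)))
  refine borsuk_ulam_of_close (F := F) hGcont (δ := min d (c / 2)) (by positivity)
    (fun w hw => (min_le_left _ _).trans (hGd w hw)) (fun w _ => by simp [F]) fun w hw => ?_
  have h1 := hk w (le_of_eq hw)
  have h2 : F w - G w = e (conePoint n hn (-w), (k : OnePoint ℕ)) -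
      e (conePoint n hn (-w), OnePoint.infty) := by simp only [F, G]; abel
  rw [h2]
  linarith [hFc w hw, min_le_right d (c / 2)]
end
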